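/- arXiv:1308.1346 — 6 statements merged into one kernel-verified Lean document; each statement's English description precedes it below -/
import Mathlib

section
/- Let k be a finite field and n ≥ 4 an integer. Let R be a complete Noetherian local commutative ring with residue field k, and let S be an Artinian local commutative ring with residue field k. Then for every group homomorphism ρ : SL_n(R) → GL_n(S) lifting the natural representation (i.e. π_S(ρ(A)(i,j)) = π_R(A(i,j)) for all A ∈ SL_n(R) and all indices i,j), there exist a local ring homomorphism f : R → S with π_S ∘ f = π_R and a matrix X ∈ GL_n(S) with X ≡ I mod m_S such that ρ(A) = X · f(A) · X⁻¹ for all A ∈ SL_n(R), where f(A) denotes f applied entrywise. -/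
open Matrix IsLocalRing

namespace SLnLift

section Gen
variable {R : Type*} [CommRing R] {n : ℕ}

/-- The elementary subgroup. -/
def elemSubgroup (n : ℕ) (R : Type*) [CommRing R] : Subgroup (SpecialLinearGroup (Fin n) R) :=
  Subgroup.closure {g | ∃ (i j : Fin n) (h : i ≠ j) (c : R),
    g = SpecialLinearGroup.transvection h c}

lemma transvection_mem {i j : Fin n} (h : i ≠ j) (c : R) :
    SpecialLinearGroup.transvection h c ∈ elemSubgroup n R :=
  Subgroup.subset_closure ⟨i, j, h, c, rfl⟩

lemma coe_tr_mul_same {i j : Fin n} (h : i ≠ j) (c : R) (A : SpecialLinearGroup (Fin n) R)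
    (b : Fin n) :
    (SpecialLinearGroup.transvection h c * A).1 i b = A.1 i b + c * A.1 j b := by
  change (Matrix.transvection i j c * A.1) i b = _
  simp

lemma coe_tr_mul_ne {i j : Fin n} (h : i ≠ j) (c : R) (A : SpecialLinearGroup (Fin n) R)
    (a b : Fin n) (ha : a ≠ i) :
    (SpecialLinearGroup.transvection h c * A).1 a b = A.1 a b := by
  change (Matrix.transvection i j c * A.1) a b = _
  simp [ha]

/-- The first `t` columns are standard. -/
def StdCols (t : ℕ) (A : SpecialLinearGroup (Fin n) R) : Prop :=
  ∀ s : Fin n, s.1 < t → ∀ i, A.1 i s = if i = s then 1 else 0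

lemma StdCols.tr_mul {t : ℕ} {A : SpecialLinearGroup (Fin n) R} (hA : StdCols t A)
    {i j : Fin n} (h : i ≠ j) (c : R) (hj : t ≤ j.1) :
    StdCols t (SpecialLinearGroup.transvection h c * A) := by
  intro s hs a
  by_cases ha : a = i
  · subst ha
    rw [coe_tr_mul_same, hA s hs, hA s hs, if_neg (c := j = s)]
    · simp
    · rintro rfl; omega
  · rw [coe_tr_mul_ne _ _ _ _ _ ha, hA s hs]

lemma clear_col {t : ℕ} (ht : t < n)
    (ih : ∀ A : SpecialLinearGroup (Fin n) R, StdCols (t + 1) A → A ∈ elemSubgroup n R) (m : ℕ) :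
    ∀ A : SpecialLinearGroup (Fin n) R, StdCols t A → A.1 ⟨t, ht⟩ ⟨t, ht⟩ = 1 →
      (∀ i : Fin n, m ≤ i.1 → i.1 ≠ t → A.1 i ⟨t, ht⟩ = 0) → A ∈ elemSubgroup n R := by
  induction m with
  | zero =>
    intro A hA h1 h0
    refine ih A fun s hs i => ?_
    by_cases hst : s.1 < t
    · exact hA s hst i
    · have : s = ⟨t, ht⟩ := Fin.ext (by simp; omega)
      subst this
      split_ifs with h
      · rw [h, h1]
      · exact h0 i (Nat.zero_le _) (fun h' => h (Fin.ext h'))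
  | succ m ihm =>
    intro A hA h1 h0
    by_cases hm : m < n ∧ m ≠ t
    · obtain ⟨hmn, hmt⟩ := hm
      have hne : (⟨m, hmn⟩ : Fin n) ≠ ⟨t, ht⟩ := by simpa [Fin.ext_iff] using hmt
      rw [← Subgroup.mul_mem_cancel_left _ (transvection_mem hne (- A.1 ⟨m, hmn⟩ ⟨t, ht⟩))]
      refine ihm _ (hA.tr_mul hne _ le_rfl) ?_ ?_
      · rw [coe_tr_mul_ne _ _ _ _ _ hne.symm, h1]
      · intro i hi hit
        by_cases him : i = ⟨m, hmn⟩
        · subst him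
          rw [coe_tr_mul_same, h1]; ring
        · rw [coe_tr_mul_ne _ _ _ _ _ him]
          refine h0 i ?_ hit
          have : i.1 ≠ m := fun h => him (Fin.ext h)
          omega
    · refine ihm A hA h1 fun i hi hit => h0 i ?_ hit
      have := i.2
      have : i.1 ≠ m := by rintro rfl; exact hm ⟨this, hit⟩
      omega

lemma elem_top [IsLocalRing R] (A : SpecialLinearGroup (Fin n) R) : A ∈ elemSubgroup n R := by
  have key : ∀ d t : ℕ, t + d = n → ∀ A : SpecialLinearGroup (Fin n) R, StdCols t A →
      A ∈ elemSubgroup n R := by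
    intro d
    induction d with
    | zero =>
      intro t ht A hA
      have : A = 1 := by
        ext i j
        rw [hA j (by omega) i]
        simp [Matrix.one_apply]
      rw [this]; exact one_mem _
    | succ d ih =>
      intro t ht A hA
      have htn : t < n := by omega
      have ih' := ih (t + 1) (by omega)
      by_cases hd : d = 0
      · -- last column: determinant
        refine clear_col htn ih' n A hA ?_ (fun i hi => absurd i.2 (by omega))
        have hdet := A.2
        rw [Matrix.det_of_isUpperTriangular] at hdet
        · rw [Finset.prod_eq_single ⟨t, htn⟩] at hdet
          · exact hdet
          · intro b _ hb
            rw [hA b _ b, if_pos rfl]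
            have : b.1 ≠ t := fun h => hb (Fin.ext h)
            omega
          · simp
        · intro i j hij
          have hij' : j < i := hij
          rw [hA j _ i, if_neg (ne_of_gt hij')]
          have := Fin.lt_def.1 hij'
          omega
      · -- find unit
        have hlast : t + 1 < n := by omega
        set T : Fin n := ⟨t, htn⟩ with hT
        -- the case with a unit strictly below
        have case1 : ∀ (B : SpecialLinearGroup (Fin n) R), StdCols t B →
            ∀ l : Fin n, t < l.1 → IsUnit (B.1 l T) → B ∈ elemSubgroup n R := by
          intro B hB l hl hu
          obtain ⟨u, hu⟩ := hu
          have hne : T ≠ l := by rintro rfl; simp [hT] at hl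
          rw [← Subgroup.mul_mem_cancel_left _
            (transvection_mem hne ((1 - B.1 T T) * (↑u⁻¹ : R)))]
          refine clear_col htn ih' n _ (hB.tr_mul hne _ hl.le) ?_
            (fun i hi => absurd i.2 (by omega))
          rw [coe_tr_mul_same, ← hT, ← hu]
          simp [mul_assoc]
        have hex : ∃ l : Fin n, t ≤ l.1 ∧ IsUnit (A.1 l T) := by
          by_contra! hcon
          have hinv : ∀ s : Fin n, s.1 < t → (A⁻¹).1 T s = 0 := by
            intro s hs
            have h := congrFun (congrFun (congrArg Subtype.val (inv_mul_cancel A)) T) s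
            have h2 : ((A⁻¹).1 * A.1) T s = (1 : Matrix (Fin n) (Fin n) R) T s := h
            rw [Matrix.mul_apply, Finset.sum_eq_single s, hA s hs s, Matrix.one_apply_ne] at h2
            · simpa using h2
            · rintro h; rw [← h] at hs; simp [hT] at hs
            · intro b _ hb; rw [hA s hs b, if_neg hb, mul_zero]
            · simp
          have h := congrFun (congrFun (congrArg Subtype.val (inv_mul_cancel A)) T) T
          have h2 : ((A⁻¹).1 * A.1) T T = (1 : Matrix (Fin n) (Fin n) R) T T := h
          rw [Matrix.mul_apply, Matrix.one_apply_eq] at h2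
          have : (1 : R) ∈ maximalIdeal R := by
            rw [← h2]
            refine Ideal.sum_mem _ fun l _ => ?_
            by_cases hl : l.1 < t
            · rw [hinv l hl, zero_mul]; exact zero_mem _
            · exact Ideal.mul_mem_left _ _ ((mem_maximalIdeal _).2 (hcon l (by omega)))
          exact (mem_maximalIdeal _).1 this isUnit_one
        obtain ⟨l, hl, hu⟩ := hex
        by_cases hlt : t < l.1
        · exact case1 A hA l hlt hu
        · have hlT : l = T := Fin.ext (by simp [hT]; omega)
          rw [hlT] at hl hu
          by_cases hu2 : IsUnit (A.1 ⟨t + 1, hlast⟩ T)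
          · exact case1 A hA ⟨t + 1, hlast⟩ (by simp) hu2
          · have hne : (⟨t + 1, hlast⟩ : Fin n) ≠ T := by
              intro h; have := congrArg Fin.val h; simp [hT] at this
            rw [← Subgroup.mul_mem_cancel_left _ (transvection_mem hne (1 : R))]
            refine case1 _ (hA.tr_mul hne _ hl) ⟨t + 1, hlast⟩ (by simp) ?_
            rw [coe_tr_mul_same, one_mul]
            by_contra hcon
            have h1 := (mem_maximalIdeal _).2 hcon
            have h2 := (mem_maximalIdeal _).2 hu2
            have h3 := (Ideal.add_mem_iff_right _ h2).1 h1
            exact (mem_maximalIdeal _).1 h3 hu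
  exact key n 0 (by omega) A (fun s hs => absurd hs (by omega))

end Gen
end SLnLift
namespace SLnLift

section Nak
variable {S k : Type*} [CommRing S] [IsLocalRing S] [Field k] {n : ℕ}

/-- All entries lie in the ideal `J`. -/
def Ent (J : Ideal S) (D : Matrix (Fin n) (Fin n) S) : Prop := ∀ i j, D i j ∈ J

lemma nak (hm : IsNilpotent (maximalIdeal S)) (D : Matrix (Fin n) (Fin n) S)
    (h : ∀ J : Ideal S, Ent J D → Ent (maximalIdeal S * J) D) : D = 0 := by
  have key : ∀ t : ℕ, Ent ((maximalIdeal S) ^ t) D := by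
    intro t
    induction t with
    | zero => intro i j; simp
    | succ t ih => rw [pow_succ']; exact h _ ih
  obtain ⟨t, ht⟩ := hm
  ext i j
  have := key t i j
  rw [ht] at this
  simpa using this

variable (π : S →+* k) (hπ : RingHom.ker π = maximalIdeal S)
include hπ

lemma mem_of_pi {x : S} (h : π x = 0) : x ∈ maximalIdeal S := by
  rw [← hπ]; exact h

lemma isUnit_of_pi {x : S} (h : π x ≠ 0) : IsUnit x := by
  by_contra hc
  have : x ∈ RingHom.ker π := by rw [hπ]; exact (mem_maximalIdeal _).2 hc
  exact h this

lemma ent_mul_right {J : Ideal S} {D A B : Matrix (Fin n) (Fin n) S} (hD : Ent J D)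
    (h : A.map π = B.map π) : Ent (maximalIdeal S * J) (D * A - D * B) := by
  intro i j
  rw [← mul_sub, Matrix.mul_apply]
  refine Ideal.sum_mem _ fun l _ => ?_
  rw [mul_comm (D i l)]
  refine Ideal.mul_mem_mul (mem_of_pi π hπ ?_) (hD i l)
  have := congrFun (congrFun h l) j
  simp only [Matrix.map_apply] at this
  simp [this]

lemma ent_mul_left {J : Ideal S} {D A B : Matrix (Fin n) (Fin n) S} (hD : Ent J D)
    (h : A.map π = B.map π) : Ent (maximalIdeal S * J) (A * D - B * D) := by
  intro i j
  rw [← sub_mul, Matrix.mul_apply]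
  refine Ideal.sum_mem _ fun l _ => ?_
  refine Ideal.mul_mem_mul (mem_of_pi π hπ ?_) (hD l j)
  have := congrFun (congrFun h i) l
  simp only [Matrix.map_apply] at this
  simp [this]

lemma idem_zero (hm : IsNilpotent (maximalIdeal S)) {D : Matrix (Fin n) (Fin n) S}
    (hD : D * D = D) (h0 : D.map π = 0) : D = 0 := by
  refine nak hm D fun J hJ => ?_
  have := ent_mul_right π hπ hJ (A := D) (B := 0) (by rw [h0]; ext; simp)
  simpa [hD] using this

lemma col_zero {J : Ideal S} {D e : Matrix (Fin n) (Fin n) S} (hD : Ent J D) {a b : Fin n}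
    (hab : a ≠ b) (he : e.map π = single a a 1 + single b b 1) (h : D * e = 0) (i : Fin n) :
    D i a ∈ maximalIdeal S * J ∧ D i b ∈ maximalIdeal S * J := by
  have := ent_mul_right π hπ hD (A := e) (B := single a a 1 + single b b 1)
    (by rw [he]; ext x y; simp [Matrix.single_apply, apply_ite π])
  rw [h, zero_sub, mul_add] at this
  have h1 := this i a
  have h2 := this i b
  simp [hab, hab.symm, Matrix.mul_single_apply_of_ne] at h1 h2
  exact ⟨h1, h2⟩

lemma row_zero {J : Ideal S} {D e : Matrix (Fin n) (Fin n) S} (hD : Ent J D) {a b : Fin n}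
    (hab : a ≠ b) (he : e.map π = single a a 1 + single b b 1) (h : e * D = 0) (i : Fin n) :
    D a i ∈ maximalIdeal S * J ∧ D b i ∈ maximalIdeal S * J := by
  have := ent_mul_left π hπ hD (A := e) (B := single a a 1 + single b b 1)
    (by rw [he]; ext x y; simp [Matrix.single_apply, apply_ite π])
  rw [h, zero_sub, add_mul] at this
  have h1 := this a i
  have h2 := this b i
  simp [hab, hab.symm, Matrix.single_mul_apply_of_ne] at h1 h2
  exact ⟨h1, h2⟩

end Nak

lemma exists_fourth {n : ℕ} (hn : 4 ≤ n) (i j k : Fin n) : ∃ l, l ≠ i ∧ l ≠ j ∧ l ≠ k := by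
  have h : (({i, j, k} : Finset (Fin n))).card < (Finset.univ : Finset (Fin n)).card := by
    have := Finset.card_le_three (a := i) (b := j) (c := k)
    simp; omega
  obtain ⟨l, _, hl⟩ := Finset.exists_mem_notMem_of_card_lt_card h
  simp at hl
  exact ⟨l, hl.1, hl.2.1, hl.2.2⟩

/-- The data extracted from a lift. -/
structure Stein {R S k : Type*} [CommRing R] [CommRing S] [Field k] {n : ℕ}
    (πR : R →+* k) (π : S →+* k)
    (E : Fin n → Fin n → R → Matrix (Fin n) (Fin n) S)
    (e : Fin n → Fin n → Matrix (Fin n) (Fin n) S) : Prop where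
  zero : ∀ i j, i ≠ j → E i j 0 = 1
  add : ∀ i j r s, i ≠ j → E i j (r + s) = E i j r * E i j s
  comm : ∀ i j k l r s, i ≠ j → k ≠ l → j ≠ k → i ≠ l → E i j r * E k l s = E k l s * E i j r
  stein : ∀ i j k r s, i ≠ j → j ≠ k → i ≠ k →
    E i j r * E j k s = E i k (r * s) * E j k s * E i j r
  res : ∀ i j r, i ≠ j → (E i j r).map π = 1 + single i j (πR r)
  idem : ∀ i j, i ≠ j → e i j * e i j = e i j
  ecomm : ∀ i j k l r, i ≠ j → k ≠ l → i ≠ k → i ≠ l → j ≠ k → j ≠ l →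
    e i j * E k l r = E k l r * e i j
  ee : ∀ i j k l, i ≠ j → k ≠ l → i ≠ k → i ≠ l → j ≠ k → j ≠ l →
    e i j * e k l = e k l * e i j
  eres : ∀ i j, i ≠ j → (e i j).map π = single i i 1 + single j j 1

namespace Stein
variable {R S k : Type*} [CommRing R] [CommRing S] [IsLocalRing S] [Field k] {n : ℕ}
    {πR : R →+* k} {π : S →+* k}
    {E : Fin n → Fin n → R → Matrix (Fin n) (Fin n) S}
    {e : Fin n → Fin n → Matrix (Fin n) (Fin n) S}
    (H : Stein πR π E e) (hm : IsNilpotent (maximalIdeal S))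
    (hπ : RingHom.ker π = maximalIdeal S) (hn : 4 ≤ n)
include H hm hπ

lemma ee_zero {i j k l : Fin n} (h1 : i ≠ j) (h2 : k ≠ l) (h3 : i ≠ k) (h4 : i ≠ l)
    (h5 : j ≠ k) (h6 : j ≠ l) : e i j * e k l = 0 := by
  refine idem_zero π hπ hm ?_ ?_
  · have hc := H.ee i j k l h1 h2 h3 h4 h5 h6
    calc e i j * e k l * (e i j * e k l) = e i j * (e k l * e i j) * e k l := by noncomm_ring
      _ = (e i j * e i j) * (e k l * e k l) := by rw [← hc]; noncomm_ring
      _ = _ := by rw [H.idem _ _ h1, H.idem _ _ h2]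
  · rw [Matrix.map_mul, H.eres _ _ h1, H.eres _ _ h2]
    simp [add_mul, mul_add, h3, h4, h5, h6]

include hn

lemma e_comm_E {k l : Fin n} (hkl : k ≠ l) (r : R) : e k l * E k l r = E k l r * e k l := by
  set g := E k l r with hg
  set f := e k l with hf
  have hff : f * f = f := H.idem _ _ hkl
  have d1 : f * g * (1 - f) = 0 := by
    refine nak hm _ fun J hJ i a => ?_
    by_cases ha : a = k ∨ a = l
    · have := col_zero π hπ hJ hkl (H.eres _ _ hkl)
        (by rw [mul_assoc, sub_mul, one_mul, hff, sub_self, mul_zero]) i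
      rcases ha with rfl | rfl
      · exact this.1
      · exact this.2
    · push Not at ha
      obtain ⟨b, hb1, hb2, hb3⟩ := exists_fourth hn a k l
      refine (col_zero π hπ hJ hb1.symm (H.eres _ _ hb1.symm) ?_ i).1
      have hc := H.ecomm a b k l r hb1.symm hkl ha.1 ha.2 hb2 hb3
      have hz := H.ee_zero hm hπ hkl hb1.symm ha.1.symm hb2.symm ha.2.symm hb3.symm
      calc f * g * (1 - f) * e a b = f * (g * e a b) - f * g * (f * e a b) := by noncomm_ring
        _ = (f * e a b) * g - f * g * (f * e a b) := by rw [← hc]; noncomm_ring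
        _ = 0 := by rw [hz]; simp
  have d2 : (1 - f) * g * f = 0 := by
    refine nak hm _ fun J hJ a i => ?_
    by_cases ha : a = k ∨ a = l
    · have := row_zero π hπ hJ hkl (H.eres _ _ hkl)
        (by rw [← mul_assoc, ← mul_assoc, mul_sub, mul_one, ← hf, hff, sub_self, zero_mul,
          zero_mul]) i
      rcases ha with rfl | rfl
      · exact this.1
      · exact this.2
    · push Not at ha
      obtain ⟨b, hb1, hb2, hb3⟩ := exists_fourth hn a k l
      refine (row_zero π hπ hJ hb1.symm (H.eres _ _ hb1.symm) ?_ i).1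
      have hc := H.ecomm a b k l r hb1.symm hkl ha.1 ha.2 hb2 hb3
      have hz := H.ee_zero hm hπ hb1.symm hkl ha.1 ha.2 hb2 hb3
      calc e a b * ((1 - f) * g * f) = (e a b * g) * f - (e a b * f) * g * f := by noncomm_ring
        _ = g * (e a b * f) - (e a b * f) * g * f := by rw [hc]; noncomm_ring
        _ = 0 := by rw [hz]; simp
  have : f * g - g * f = f * g * (1 - f) - (1 - f) * g * f := by noncomm_ring
  rw [d1, d2, sub_zero] at this
  exact sub_eq_zero.1 this

lemma chi_exists {k l : Fin n} (hkl : k ≠ l) (r : R) :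
    ∃ χ : S, IsUnit χ ∧ (E k l r - χ • (1 : Matrix (Fin n) (Fin n) S)) * (1 - e k l) = 0 := by
  obtain ⟨z, hzk, hzl, -⟩ := exists_fourth hn k l l
  set g := E k l r with hg
  set f := 1 - e k l with hf
  have hfm : f.map π = 1 - (single k k 1 + single l l 1) := by
    rw [hf, ← H.eres _ _ hkl]; ext x y; simp [Matrix.one_apply, apply_ite π]
  have hfz : π (f z z) = 1 := by
    have := congrFun (congrFun hfm z) z
    simpa [hzk.symm, hzl.symm] using this
  have hgfz : π ((g * f) z z) = 1 := by
    have : ((g * f).map π) z z = 1 := by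
      rw [Matrix.map_mul, hfm, H.res _ _ _ hkl]
      simp [add_mul, mul_sub, mul_add, hzk, hzk.symm, hzl.symm]
    simpa using this
  obtain ⟨u, hu⟩ := isUnit_of_pi π hπ (x := f z z) (by rw [hfz]; exact one_ne_zero)
  obtain ⟨v, hv⟩ := isUnit_of_pi π hπ (x := (g * f) z z) (by rw [hgfz]; exact one_ne_zero)
  refine ⟨v * (↑u⁻¹ : S), by simp, ?_⟩
  set χ : S := v * (↑u⁻¹ : S) with hχ
  set D := (g - χ • (1 : Matrix (Fin n) (Fin n) S)) * f with hD
  have hDz : D z z = 0 := by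
    have : D z z = (g * f) z z - χ * f z z := by simp [hD, sub_mul]
    rw [this, ← hv, ← hu, hχ, mul_assoc]; simp
  refine nak hm _ fun J hJ => ?_
  have hcol : ∀ i a, (a = k ∨ a = l) → D i a ∈ maximalIdeal S * J := by
    intro i a ha
    have := col_zero π hπ hJ hkl (H.eres _ _ hkl)
        (by rw [hD, mul_assoc, hf, sub_mul 1, one_mul, H.idem _ _ hkl, sub_self, mul_zero]) i
    rcases ha with rfl | rfl
    · exact this.1
    · exact this.2
  have hcomm : ∀ a b, a ≠ b → a ≠ k → a ≠ l → b ≠ k → b ≠ l →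
      Ent (maximalIdeal S * J) (D * single a b 1 - single a b 1 * D) := by
    intro a b hab h1 h2 h3 h4
    have hmap : (E a b 1).map π = (1 + single a b 1 : Matrix (Fin n) (Fin n) S).map π := by
      rw [H.res _ _ _ hab]
      ext x y; simp [Matrix.one_apply, Matrix.single_apply, apply_ite π]
    have hA := ent_mul_right π hπ hJ hmap
    have hB := ent_mul_left π hπ hJ hmap
    have hc1 := H.comm a b k l 1 r hab hkl h3 h2
    have hc2 := H.ecomm k l a b 1 hkl hab h1.symm h3.symm h2.symm h4.symm
    have hc : D * E a b 1 = E a b 1 * D := by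
      have hfc : f * E a b 1 = E a b 1 * f := by rw [hf, sub_mul, mul_sub, hc2]; simp
      rw [hD, mul_assoc, hfc, ← mul_assoc, ← mul_assoc]
      congr 1
      rw [sub_mul, mul_sub, hg, ← hc1]; simp
    intro i j
    have h5 := sub_mem (hB i j) (hA i j)
    rw [hc] at h5
    simp only [Matrix.sub_apply, mul_add, add_mul, Matrix.add_apply, mul_one, one_mul] at h5 ⊢
    convert h5 using 1
    ring
  intro i a
  by_cases ha : a = k ∨ a = l
  · exact hcol i a ha
  push Not at ha
  by_cases hia : i = a
  · subst hia
    by_cases hiz : i = z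
    · rw [hiz, hDz]; exact zero_mem _
    · have := hcomm i z hiz ha.1 ha.2 hzk hzl i z
      simpa [hDz] using this
  · obtain ⟨b, hb1, hb2, hb3⟩ := exists_fourth hn a k l
    have := hcomm a b hb1.symm ha.1 ha.2 hb2 hb3 i b
    simpa [hia, Matrix.single_mul_apply_of_ne] using this

end Stein
end SLnLift
namespace SLnLift
namespace Stein
variable {R S k : Type*} [CommRing R] [CommRing S] [IsLocalRing S] [Field k] {n : ℕ}
    {πR : R →+* k} {π : S →+* k}
    {E : Fin n → Fin n → R → Matrix (Fin n) (Fin n) S}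
    {e : Fin n → Fin n → Matrix (Fin n) (Fin n) S}
    (H : Stein πR π E e) (hm : IsNilpotent (maximalIdeal S))
    (hπ : RingHom.ker π = maximalIdeal S) (hn : 4 ≤ n)
include H

lemma inv_mul {i j : Fin n} (h : i ≠ j) (r : R) : E i j (-r) * E i j r = 1 := by
  rw [← H.add _ _ _ _ h, neg_add_cancel, H.zero _ _ h]

lemma mul_inv {i j : Fin n} (h : i ≠ j) (r : R) : E i j r * E i j (-r) = 1 := by
  rw [← H.add _ _ _ _ h, add_neg_cancel, H.zero _ _ h]

lemma left_cancel {i j : Fin n} (h : i ≠ j) (r : R) {A B : Matrix (Fin n) (Fin n) S}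
    (hAB : E i j r * A = E i j r * B) : A = B := by
  have := congrArg (fun X => E i j (-r) * X) hAB
  simpa only [← mul_assoc, H.inv_mul h, one_mul] using this

lemma right_cancel {i j : Fin n} (h : i ≠ j) (r : R) {A B : Matrix (Fin n) (Fin n) S}
    (hAB : A * E i j r = B * E i j r) : A = B := by
  have := congrArg (fun X => X * E i j (-r)) hAB
  simpa only [mul_assoc, H.mul_inv h, mul_one] using this

lemma pi_entry {i j : Fin n} (h : i ≠ j) (r : R) (a b : Fin n) :
    π ((E i j r - 1) a b) = (single i j (πR r) : Matrix (Fin n) (Fin n) k) a b := by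
  have := congrFun (congrFun (H.res i j r h) a) b
  simp only [Matrix.map_apply, Matrix.add_apply] at this
  rw [Matrix.sub_apply, map_sub, this]
  simp [Matrix.one_apply, apply_ite π]

include hm hπ hn

lemma exists_chi : ∃ χ : Fin n → Fin n → R → S, (∀ i j r, i ≠ j → IsUnit (χ i j r)) ∧
    ∀ i j k l r s, i ≠ j → k ≠ l → i ≠ k → i ≠ l → j ≠ k → j ≠ l →
      (E i j r - χ i j r • (1 : Matrix (Fin n) (Fin n) S)) *
        (E k l s - χ k l s • (1 : Matrix (Fin n) (Fin n) S)) = 0 := by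
  have hex : ∀ i j r, ∃ χ : S, i ≠ j → IsUnit χ ∧
      (E i j r - χ • (1 : Matrix (Fin n) (Fin n) S)) * (1 - e i j) = 0 := by
    intro i j r
    by_cases h : i = j
    · exact ⟨0, fun h' => absurd h h'⟩
    · obtain ⟨χ, hχ⟩ := H.chi_exists hm hπ hn h r
      exact ⟨χ, fun _ => hχ⟩
  choose χ hχ using hex
  refine ⟨χ, fun i j r h => (hχ i j r h).1, ?_⟩
  intro i j k l r s h1 h2 h3 h4 h5 h6
  have hP := (hχ i j r h1).2
  have hQ := (hχ k l s h2).2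
  have hPc : e i j * (E i j r - χ i j r • (1 : Matrix (Fin n) (Fin n) S)) =
      (E i j r - χ i j r • (1 : Matrix (Fin n) (Fin n) S)) * e i j := by
    rw [mul_sub, sub_mul, H.e_comm_E hm hπ hn h1]; simp
  have hPQ : (E i j r - χ i j r • (1 : Matrix (Fin n) (Fin n) S)) *
        (E k l s - χ k l s • (1 : Matrix (Fin n) (Fin n) S)) =
        (E k l s - χ k l s • (1 : Matrix (Fin n) (Fin n) S)) *
        (E i j r - χ i j r • (1 : Matrix (Fin n) (Fin n) S)) := by
    simp only [sub_mul, mul_sub, H.comm i j k l r s h1 h2 h5 h4, smul_mul_assoc, mul_smul_comm,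
      one_mul, mul_one, smul_sub, smul_comm (χ i j r) (χ k l s)]
    abel
  rw [hPQ]
  have hz := H.ee_zero hm hπ h2 h1 h3.symm h5.symm h4.symm h6.symm
  generalize E i j r - χ i j r • (1 : Matrix (Fin n) (Fin n) S) = P at *
  generalize E k l s - χ k l s • (1 : Matrix (Fin n) (Fin n) S) = Q at *
  have hP1 : P = e i j * P := by
    rw [mul_sub, mul_one, sub_eq_zero] at hP
    rw [hPc]; exact hP
  have hQ1 : Q = Q * e k l := by
    rw [mul_sub, mul_one, sub_eq_zero] at hQ
    exact hQ
  rw [hP1, hQ1, mul_assoc, ← mul_assoc (e k l), hz]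
  simp

lemma basic : (∀ i j k l r s, i ≠ j → k ≠ l → i ≠ k → i ≠ l → j ≠ k → j ≠ l →
      (E i j r - 1) * (E k l s - 1) = 0) ∧
    (∀ i j k r s, i ≠ j → i ≠ k → j ≠ k → (E i k r - 1) * (E i j s - 1) = 0) := by
  obtain ⟨χ, hu, hχ⟩ := H.exists_chi hm hπ hn
  have hrow : ∀ i j k r s, i ≠ j → i ≠ k → j ≠ k →
      (E i k r - 1) * (E i j s - χ i j s • (1 : Matrix (Fin n) (Fin n) S)) = 0 := by
    intro i j k r s hij hik hjk
    obtain ⟨l, hli, hlj, hlk⟩ := exists_fourth hn i j k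
    have st := H.stein i l k r 1 hli.symm hlk hik
    rw [mul_one] at st
    have hd := hχ i j l k s 1 hij hlk hli.symm hik hlj.symm hjk
    have hcl : ∀ t, (E i j s - χ i j s • (1 : Matrix (Fin n) (Fin n) S)) * E i l t =
        E i l t * (E i j s - χ i j s • (1 : Matrix (Fin n) (Fin n) S)) := by
      intro t
      rw [sub_mul, mul_sub, H.comm i j i l s t hij hli.symm hij.symm hli.symm]; simp
    have hck : ∀ t, (E i j s - χ i j s • (1 : Matrix (Fin n) (Fin n) S)) * E i k t =
        E i k t * (E i j s - χ i j s • (1 : Matrix (Fin n) (Fin n) S)) := by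
      intro t
      rw [sub_mul, mul_sub, H.comm i j i k s t hij hik hij.symm hik]; simp
    generalize E i j s - χ i j s • (1 : Matrix (Fin n) (Fin n) S) = P at *
    have hPl : P * E l k 1 = χ l k 1 • P := by
      rw [mul_sub, sub_eq_zero] at hd
      rw [hd]; simp
    have h1 : P * (E i l r * E l k 1) = χ l k 1 • (E i l r * P) := by
      rw [← mul_assoc, hcl, mul_assoc, hPl]; simp
    have h2 : P * (E i k r * E l k 1 * E i l r) = χ l k 1 • (E i l r * (E i k r * P)) := by
      calc P * (E i k r * E l k 1 * E i l r) = (P * E i k r) * E l k 1 * E i l r := by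
            simp only [mul_assoc]
        _ = E i k r * (P * E l k 1) * E i l r := by rw [hck]; simp only [mul_assoc]
        _ = χ l k 1 • (E i k r * (P * E i l r)) := by rw [hPl]; simp [mul_assoc]
        _ = χ l k 1 • ((E i k r * E i l r) * P) := by rw [hcl]; simp only [mul_assoc]
        _ = _ := by rw [H.comm i k i l r r hik hli.symm hik.symm hli.symm]; simp only [mul_assoc]
    rw [st, h2] at h1
    obtain ⟨u, hu'⟩ := hu l k 1 hlk
    rw [← hu'] at h1
    have h3 : E i l r * (E i k r * P) = E i l r * P := by
      have := congrArg (fun X => (↑u⁻¹ : S) • X) h1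
      simpa only [smul_smul, Units.inv_mul, one_smul] using this
    have h4 := H.left_cancel hli.symm r h3
    rw [sub_mul, h4, one_mul, sub_self]
  have hlam : ∀ i j k r s, i ≠ j → i ≠ k → j ≠ k →
      (χ i j s - 1) • (E i k r - 1) = (χ i k r - 1) • (E i j s - 1) := by
    intro i j k r s hij hik hjk
    have h1 := hrow i j k r s hij hik hjk
    have h2 := hrow i k j s r hik hij hjk.symm
    have hc := H.comm i j i k s r hij hik hij.symm hik
    simp only [sub_mul, mul_sub, one_mul, mul_one, mul_smul_comm, sub_smul, smul_sub, one_smul]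
      at h1 h2 ⊢
    rw [hc] at h2
    rw [← sub_eq_zero]
    have h3 := congrArg₂ (· - ·) h2 h1
    simp only [sub_zero] at h3
    rw [← h3]; abel
  have hone : ∀ i j, i ≠ j → χ i j 1 = 1 := by
    intro i j hij
    obtain ⟨k, hki, hkj, -⟩ := exists_fourth hn i j j
    have h := hlam i j k 1 1 hij hki.symm hkj.symm
    have ha := congrFun (congrFun h i) k
    have hb := congrFun (congrFun h i) j
    rw [Matrix.smul_apply, Matrix.smul_apply, smul_eq_mul, smul_eq_mul] at ha hb
    have p1 := H.pi_entry hki.symm 1 i k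
    have p2 := H.pi_entry hij 1 i k
    have p3 := H.pi_entry hki.symm 1 i j
    have p4 := H.pi_entry hij 1 i j
    simp [hkj, hkj.symm, -Matrix.sub_apply] at p1 p2 p3 p4
    generalize (E i k 1 - 1) i k = x at *
    generalize (E i j 1 - 1) i k = y at *
    generalize (E i k 1 - 1) i j = z at *
    generalize (E i j 1 - 1) i j = w at *
    have hun : IsUnit (x * w - y * z) := isUnit_of_pi π hπ (by simp [p1, p2, p3, p4])
    have : (x * w - y * z) * (χ i j 1 - 1) = 0 := by
      linear_combination w * ha - y * hb
    have := (hun.mul_right_eq_zero).1 this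
    exact sub_eq_zero.1 this
  have hall : ∀ i j s, i ≠ j → χ i j s = 1 := by
    intro i j s hij
    obtain ⟨k, hki, hkj, -⟩ := exists_fourth hn i j j
    have h := hlam i j k 1 s hij hki.symm hkj.symm
    rw [hone i k hki.symm, sub_self, zero_smul] at h
    have ha := congrFun (congrFun h i) k
    rw [Matrix.smul_apply, smul_eq_mul, Matrix.zero_apply] at ha
    have p1 := H.pi_entry hki.symm 1 i k
    simp [-Matrix.sub_apply] at p1
    have hun : IsUnit ((E i k 1 - 1) i k) := isUnit_of_pi π hπ (by rw [p1]; exact one_ne_zero)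
    exact sub_eq_zero.1 ((hun.mul_left_eq_zero).1 ha)
  constructor
  · intro i j k l r s h1 h2 h3 h4 h5 h6
    have := hχ i j k l r s h1 h2 h3 h4 h5 h6
    rwa [hall i j r h1, hall k l s h2, one_smul] at this
  · intro i j k r s h1 h2 h3
    have := hrow i j k r s h1 h2 h3
    rwa [hall i j s h1, one_smul] at this

lemma col_prod {i j k : Fin n} (r s : R) (hij : i ≠ j) (hik : i ≠ k) (hjk : j ≠ k) :
    (E k i r - 1) * (E j i s - 1) = 0 := by
  obtain ⟨hd, hr⟩ := H.basic hm hπ hn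
  obtain ⟨l, hli, hlj, hlk⟩ := exists_fourth hn i j k
  have st := H.stein k l i r 1 hlk.symm hli hik.symm
  rw [mul_one] at st
  have hc1 : E l i 1 * (E j i s - 1) = (E j i s - 1) * E l i 1 := by
    rw [sub_mul, mul_sub, H.comm l i j i 1 s hli hij.symm hij hli]; simp
  have hz := hd k l j i r s hlk.symm hij.symm hjk.symm hik.symm hlj hli
  have h1 : E k l r * (E j i s - 1) = E j i s - 1 := by
    rw [sub_mul, one_mul, sub_eq_zero] at hz; exact hz
  generalize E j i s - 1 = P at *
  have h2 : E k l r * E l i 1 * P = P * E l i 1 := by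
    rw [mul_assoc, hc1, ← mul_assoc, h1]
  have h3 : E k i r * E l i 1 * E k l r * P = E k i r * P * E l i 1 := by
    rw [mul_assoc, h1, mul_assoc, hc1, mul_assoc]
  rw [st, h3] at h2
  rw [sub_mul, one_mul, H.right_cancel hli 1 h2, sub_self]

lemma sq_prod {i j : Fin n} (r s : R) (hij : i ≠ j) :
    (E i j r - 1) * (E i j s - 1) = 0 := by
  obtain ⟨hd, hr⟩ := H.basic hm hπ hn
  obtain ⟨l, hli, hlj, -⟩ := exists_fourth hn i j j
  have st := H.stein i l j r 1 hli.symm hlj hij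
  rw [mul_one] at st
  have hc1 : (E i j s - 1) * E i l r = E i l r * (E i j s - 1) := by
    rw [sub_mul, mul_sub, H.comm i j i l s r hij hli.symm hij.symm hli.symm]; simp
  have hc2 : (E i j s - 1) * E i j r = E i j r * (E i j s - 1) := by
    rw [sub_mul, mul_sub, H.comm i j i j s r hij hij hij.symm hij]; simp
  have h1 : E i l r * (E i j s - 1) = E i j s - 1 := by
    have := hr i j l r s hij hli.symm hlj.symm
    rw [sub_mul, one_mul, sub_eq_zero] at this; exact this
  have h2 : (E i j s - 1) * E l j 1 = E i j s - 1 := by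
    have := H.col_prod hm hπ hn s 1 hlj.symm hij.symm hli
    rw [mul_sub, mul_one, sub_eq_zero] at this; exact this
  generalize E i j s - 1 = P at *
  have h3 : P * (E i l r * E l j 1) = P := by rw [← mul_assoc, hc1, h1, h2]
  have h4 : P * (E i j r * E l j 1 * E i l r) = E i j r * P := by
    rw [← mul_assoc, ← mul_assoc, hc2, mul_assoc (E i j r), h2, mul_assoc, hc1, h1]
  rw [st, h4] at h3
  rw [sub_mul, one_mul, h3, sub_self]

lemma chain {i j k : Fin n} (r s : R) (hij : i ≠ j) (hik : i ≠ k) (hjk : j ≠ k) :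
    (E i j r - 1) * (E j k s - 1) = (E i k (r * s) - 1) + (E j k s - 1) * (E i j r - 1) := by
  obtain ⟨hd, hr⟩ := H.basic hm hπ hn
  have st := H.stein i j k r s hij hjk hik
  have h1 := hr i j k (r * s) r hij hik hjk
  have h2 := H.col_prod hm hπ hn (r * s) s hjk.symm hik.symm hij.symm
  obtain ⟨A, hA⟩ : ∃ A, A = E i j r - 1 := ⟨_, rfl⟩
  obtain ⟨B, hB⟩ : ∃ B, B = E j k s - 1 := ⟨_, rfl⟩
  obtain ⟨C, hC⟩ : ∃ C, C = E i k (r * s) - 1 := ⟨_, rfl⟩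
  rw [← hA, ← hC] at h1
  rw [← hB, ← hC] at h2
  rw [← hA, ← hB, ← hC]
  rw [show E i j r = 1 + A by rw [hA]; abel, show E j k s = 1 + B by rw [hB]; abel,
    show E i k (r * s) = 1 + C by rw [hC]; abel] at st
  have h3 : (1 + C) * (1 + B) * (1 + A) = 1 + A + B + C + B * A + C * A + C * B + (C * B) * A := by
    noncomm_ring
  rw [h3, h1, h2] at st
  have h4 : (1 + A) * (1 + B) = 1 + A + B + A * B := by noncomm_ring
  rw [h4] at st
  simp only [zero_mul, add_zero] at st
  have := congrArg (fun X => X - 1 - A - B) st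
  have e1 : 1 + A + B + A * B - 1 - A - B = A * B := by abel
  have e2 : 1 + A + B + C + B * A - 1 - A - B = C + B * A := by abel
  rw [e1, e2] at this
  exact this

lemma back {i j k : Fin n} (r s : R) (hij : i ≠ j) (hik : i ≠ k) (hjk : j ≠ k) :
    (E j k s - 1) * (E i j r - 1) = 0 := by
  obtain ⟨hd, hr⟩ := H.basic hm hπ hn
  obtain ⟨l, hli, hlj, hlk⟩ := exists_fourth hn i j k
  set Q := (E j k s - 1) * (E i j r - 1) with hQ
  have hjy : ∀ y, j ≠ y → (E j y 1 - 1) * Q = 0 := by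
    intro y hy
    rw [hQ, ← mul_assoc]
    by_cases hyk : y = k
    · subst hyk
      rw [H.sq_prod hm hπ hn 1 s hjk, zero_mul]
    · rw [hr j k y 1 s hjk hy (Ne.symm hyk), zero_mul]
  have hlj' : (E l j 1 - 1) * Q = 0 := by
    rw [hQ, ← mul_assoc, H.chain hm hπ hn 1 s hlj hlk hjk, add_mul, mul_assoc,
      hd l k i j _ r hlk hij hli hlj hik.symm hjk.symm,
      H.col_prod hm hπ hn 1 r hij.symm hlj.symm hli.symm, mul_zero, add_zero]
  refine nak hm Q fun J hJ => ?_
  have hmap : ∀ a b, a ≠ b → (E a b 1 - 1).map π =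
      (single a b 1 : Matrix (Fin n) (Fin n) S).map π := by
    intro a b hab
    ext x y
    rw [Matrix.map_apply, H.pi_entry hab]
    simp [Matrix.single_apply, apply_ite π]
  intro y c
  by_cases hy : y = j
  · subst hy
    have := ent_mul_left π hπ hJ (hmap l y hlj) l c
    rw [hlj'] at this
    simpa using this
  · have := ent_mul_left π hπ hJ (hmap j y (Ne.symm hy)) j c
    rw [hjy y (Ne.symm hy)] at this
    simpa using this

end Stein
end SLnLift
namespace SLnLift
namespace Stein
variable {R S k : Type*} [CommRing R] [CommRing S] [IsLocalRing S] [Field k] {n : ℕ}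
    {πR : R →+* k} {π : S →+* k}
    {E : Fin n → Fin n → R → Matrix (Fin n) (Fin n) S}
    {e : Fin n → Fin n → Matrix (Fin n) (Fin n) S}

/-- A system of matrix units. -/
lemma exists_units (H : Stein πR π E e) (hm : IsNilpotent (maximalIdeal S))
    (hπ : RingHom.ker π = maximalIdeal S) (hn : 4 ≤ n) :
    ∃ (f : R →+* S) (X : GL (Fin n) S),
      (X.1.map π = 1) ∧ (∀ r : R, π (f r) = πR r) ∧
      ∀ i j r, i ≠ j → E i j r * X.1 = X.1 * (1 + single i j (f r)) := by
  obtain ⟨N, hN⟩ : ∃ N : Fin n → Fin n → R → Matrix (Fin n) (Fin n) S,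
    ∀ i j r, N i j r = E i j r - 1 := ⟨fun i j r => E i j r - 1, fun _ _ _ => rfl⟩
  have hEN : ∀ i j r, E i j r = 1 + N i j r := by intro i j r; rw [hN]; abel
  have zero : ∀ i j k l r s, i ≠ j → k ≠ l → j ≠ k → N i j r * N k l s = 0 := by
    intro i j k l r s hij hkl hjk
    obtain ⟨hd, hr⟩ := H.basic hm hπ hn
    rw [hN, hN]
    by_cases hil : i = l
    · subst hil; exact H.back hm hπ hn s r hkl hjk.symm hij
    · by_cases hik : i = k
      · subst hik
        by_cases hjl : j = l
        · subst hjl; exact H.sq_prod hm hπ hn r s hij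
        · exact hr i l j r s hkl hij (Ne.symm hjl)
      · by_cases hjl : j = l
        · subst hjl; exact H.col_prod hm hπ hn r s hjk (Ne.symm hij) (Ne.symm hik)
        · exact hd i j k l r s hij hkl hik hil hjk hjl
  have chain : ∀ i j k r s, i ≠ j → i ≠ k → j ≠ k → N i j r * N j k s = N i k (r * s) := by
    intro i j k r s hij hik hjk
    rw [hN, hN, hN, H.chain hm hπ hn r s hij hik hjk, H.back hm hπ hn r s hij hik hjk, add_zero]
  have chain1 : ∀ i j k, i ≠ j → i ≠ k → j ≠ k → N i j 1 * N j k 1 = N i k 1 := by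
    intro i j k h1 h2 h3; rw [chain i j k 1 1 h1 h2 h3, one_mul]
  have add : ∀ i j r s, i ≠ j → N i j (r + s) = N i j r + N i j s := by
    intro i j r s hij
    have h := H.add i j r s hij
    have h2 := zero i j i j r s hij hij hij.symm
    rw [hEN, hEN, hEN] at h
    have h3 : (1 + N i j r) * (1 + N i j s) = 1 + (N i j r + N i j s) + N i j r * N i j s := by
      noncomm_ring
    rw [h3, h2, add_zero] at h
    exact add_left_cancel h
  have pin : ∀ i j r, i ≠ j → (N i j r).map π = single i j (πR r) := by
    intro i j r hij
    ext a b
    rw [hN, Matrix.map_apply, H.pi_entry hij]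
  obtain ⟨o, p, q, hop, hoq, hpq⟩ : ∃ o p q : Fin n, o ≠ p ∧ o ≠ q ∧ p ≠ q :=
    ⟨⟨0, by omega⟩, ⟨1, by omega⟩, ⟨2, by omega⟩, by simp, by simp, by simp⟩
  obtain ⟨U, hU⟩ : ∃ U : Fin n → Matrix (Fin n) (Fin n) S,
    ∀ l, U l = if l = o then N o p 1 * N p o 1 else N l o 1 := ⟨_, fun _ => rfl⟩
  have hUo : U o = N o p 1 * N p o 1 := by rw [hU, if_pos rfl]
  have hUl : ∀ l, l ≠ o → U l = N l o 1 := fun l hl => by rw [hU, if_neg hl]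
  have hNU : ∀ i j, i ≠ j → N i j 1 * U j = U i := by
    intro i j hij
    by_cases hj : j = o
    · subst hj
      rw [hUo, hUl i hij]
      by_cases hi : i = p
      · subst hi
        calc N i j 1 * (N j i 1 * N i j 1)
            = N i j 1 * ((N j q 1 * N q i 1) * N i j 1) := by
              rw [chain1 j q i hoq hop hpq.symm]
          _ = (N i j 1 * N j q 1) * (N q i 1 * N i j 1) := by simp only [mul_assoc]
          _ = N i j 1 := by
              rw [chain1 i j q hij hpq hoq, chain1 q i j hpq.symm hoq.symm hij,
                chain1 i q j hpq hij hoq.symm]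
      · rw [← mul_assoc, chain1 i j p hij hi hop, chain1 i p j hi hij hop.symm]
    · rw [hUl j hj]
      by_cases hi : i = o
      · subst hi
        rw [hUo]
        by_cases hjp : j = p
        · rw [hjp]
        · rw [← chain1 j p i hjp hj hop.symm, ← mul_assoc, chain1 i j p hij hop hjp]
      · rw [chain1 i j o hij hi hj, hUl i hi]
  have hNU0 : ∀ i j l, i ≠ j → l ≠ j → N i j 1 * U l = 0 := by
    intro i j l hij hlj
    by_cases hl : l = o
    · subst hl
      rw [hUo, ← mul_assoc, zero i j l p 1 1 hij hop hlj.symm, zero_mul]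
    · rw [hUl l hl, zero i j l o 1 1 hij hl hlj.symm]
  obtain ⟨X, hX⟩ : ∃ X : Matrix (Fin n) (Fin n) S, ∀ a l, X a l = U l a o :=
    ⟨fun a l => U l a o, fun _ _ => rfl⟩
  have hXπ : X.map π = 1 := by
    ext a l
    rw [Matrix.map_apply, hX]
    have : (U l).map π = single l o 1 := by
      by_cases hl : l = o
      · subst hl
        rw [hUo, Matrix.map_mul, pin _ _ _ hop, pin _ _ _ hop.symm]
        simp
      · rw [hUl l hl, pin _ _ _ hl, map_one]
    have h2 := congrFun (congrFun this a) o
    rw [Matrix.map_apply] at h2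
    rw [h2]
    simp [Matrix.single_apply, Matrix.one_apply, eq_comm]
  have hdet : IsUnit X.det := by
    refine isUnit_of_pi π hπ ?_
    rw [RingHom.map_det]
    have : π.mapMatrix X = 1 := hXπ
    rw [this]; simp
  obtain ⟨Y, hY⟩ : ∃ Y : GL (Fin n) S, Y.1 = X :=
    ⟨Matrix.nonsingInvUnit X hdet, rfl⟩
  obtain ⟨Z, hZ⟩ : ∃ Z : Matrix (Fin n) (Fin n) S, Z = (Y⁻¹).1 := ⟨_, rfl⟩
  have hXZ : X * Z = 1 := by rw [hZ, ← hY]; exact Y.mul_inv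
  have hZX : Z * X = 1 := by rw [hZ, ← hY]; exact Y.inv_mul
  obtain ⟨M, hM⟩ : ∃ M : Fin n → Fin n → R → Matrix (Fin n) (Fin n) S,
    ∀ i j r, M i j r = Z * N i j r * X := ⟨_, fun _ _ _ => rfl⟩
  have Mmul : ∀ i j k l r s, M i j r * M k l s = Z * (N i j r * N k l s) * X := by
    intro i j k l r s
    rw [hM, hM]
    calc Z * N i j r * X * (Z * N k l s * X) = Z * N i j r * (X * Z) * N k l s * X := by
          simp only [mul_assoc]
      _ = _ := by rw [hXZ]; simp only [mul_assoc, one_mul]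
  have Mchain : ∀ i j k r s, i ≠ j → i ≠ k → j ≠ k → M i j r * M j k s = M i k (r * s) := by
    intro i j k r s h1 h2 h3
    rw [Mmul, chain i j k r s h1 h2 h3, hM]
  have M1 : ∀ i j, i ≠ j → M i j 1 = single i j 1 := by
    intro i j hij
    have : N i j 1 * X = X * single i j 1 := by
      ext a l
      have hl : (N i j 1 * X) a l = (N i j 1 * U l) a o := by
        simp only [Matrix.mul_apply, hX]
      rw [hl]
      by_cases hlj : l = j
      · subst hlj
        rw [hNU i l hij]; simp [hX]
      · rw [hNU0 i j l hij hlj]; simp [hlj]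
    rw [hM, mul_assoc, this, ← mul_assoc, hZX, one_mul]
  have Mform : ∀ i j r, i ≠ j → ∃ c, M i j r = single i j c := by
    intro i j r hij
    obtain ⟨a, hai, haj, -⟩ := exists_fourth hn i j j
    obtain ⟨b, hbi, hbj, hba⟩ := exists_fourth hn i j a
    refine ⟨(M a b r) a b, ?_⟩
    have h1 := Mchain a b j r 1 hba.symm haj hbj
    have h2 := Mchain i a j 1 (r * 1) hai.symm hij haj
    rw [one_mul, mul_one, ← mul_one r, ← h1, M1 i a hai.symm, M1 b j hbj, mul_one, ← mul_assoc] at h2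
    rw [← h2]
    simp
  choose! g hg using Mform
  have gr : ∀ i j k r, i ≠ j → i ≠ k → j ≠ k → g i j r = g i k r := by
    intro i j k r h1 h2 h3
    have h := Mchain i k j r 1 h2 h1 h3.symm
    rw [mul_one, hg _ _ _ h2, M1 k j h3.symm, hg _ _ _ h1] at h
    have := congrFun (congrFun h i) j
    simpa using this.symm
  have gc : ∀ i j k r, i ≠ j → i ≠ k → j ≠ k → g i j r = g k j r := by
    intro i j k r h1 h2 h3
    have h := Mchain i k j 1 r h2 h1 h3.symm
    rw [one_mul, hg _ _ _ h3.symm, M1 i k h2, hg _ _ _ h1] at h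
    have := congrFun (congrFun h i) j
    simpa using this.symm
  have gall : ∀ i j r, i ≠ j → g i j r = g o p r := by
    intro i j r hij
    obtain ⟨l, hli, hlo, hlp⟩ := exists_fourth hn i o p
    have e1 : g i j r = g i l r := by
      by_cases h : j = l
      · rw [h]
      · exact gr i j l r hij hli.symm h
    have e2 : g i l r = g o l r := by
      by_cases h : i = o
      · rw [h]
      · exact gc i l o r hli.symm h hlo
    rw [e1, e2, gr o l p r hlo.symm hop hlp]
  have hMg : ∀ i j r, i ≠ j → M i j r = single i j (g o p r) := by
    intro i j r hij; rw [hg i j r hij, gall i j r hij]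
  have f1 : g o p 1 = 1 := by
    have := (M1 o p hop).symm.trans (hg o p 1 hop)
    have := congrFun (congrFun this o) p
    simpa using this.symm
  have fadd : ∀ r s, g o p (r + s) = g o p r + g o p s := by
    intro r s
    have h : M o p (r + s) = M o p r + M o p s := by
      rw [hM, hM, hM, add o p r s hop, mul_add, add_mul]
    rw [hMg _ _ _ hop, hMg _ _ _ hop, hMg _ _ _ hop] at h
    have := congrFun (congrFun h o) p
    simpa using this
  have fmul : ∀ r s, g o p (r * s) = g o p r * g o p s := by
    intro r s
    have h := Mchain o q p r s hoq hop hpq.symm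
    rw [hMg _ _ _ hop, hMg _ _ _ hoq, hMg _ _ _ hpq.symm] at h
    have := congrFun (congrFun h o) p
    simpa using this.symm
  have f0 : g o p 0 = 0 := by
    have := fadd 0 0
    simpa using this
  refine ⟨{ toFun := g o p, map_one' := f1, map_mul' := fmul, map_zero' := f0, map_add' := fadd },
    Y, by rw [hY]; exact hXπ, ?_, ?_⟩
  · intro r
    change π (g o p r) = πR r
    have hZπ : Z.map π = 1 := by
      have h : (Z * X).map π = 1 := by rw [hZX]; ext; simp [Matrix.one_apply, apply_ite π]
      rw [Matrix.map_mul, hXπ, mul_one] at h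
      exact h
    have h : (M o p r).map π = single o p (πR r) := by
      rw [hM, Matrix.map_mul, Matrix.map_mul, hXπ, hZπ, pin _ _ _ hop, one_mul, mul_one]
    rw [hMg _ _ _ hop] at h
    have := congrFun (congrFun h o) p
    simpa using this
  · intro i j r hij
    change E i j r * Y.1 = Y.1 * (1 + single i j (g o p r))
    rw [hY, ← hMg i j r hij, hEN, hM, mul_add, add_mul, ← mul_assoc, ← mul_assoc, hXZ]
    simp

end Stein
end SLnLift

namespace SLnLift
section Final
variable {R S k : Type*} [CommRing R] [CommRing S] [IsLocalRing S] [Field k] {n : ℕ}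

lemma ss_same {A : Type*} [CommRing A] (i j l : Fin n) (c d : A) :
    single i j c * single j l d = single i l (c * d) := single_mul_single_same ..

lemma ss_ne {A : Type*} [CommRing A] {i j l m : Fin n} (h : j ≠ l) (c d : A) :
    single i j c * single l m d = 0 := single_mul_single_of_ne _ _ _ _ h _

/-- The word of type `[[1-c, -c], [1, 1]]`. -/
lemma word_eq {A : Type*} [CommRing A] {i j : Fin n} (c : A) :
    (1 + single i j c) * (1 + single j i 1) =
      1 + single i j c + single j i 1 + single i i c := by
  rw [add_mul, mul_add, mul_add, ss_same]; simp only [mul_one, one_mul]; abel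

lemma word2_sq {A : Type*} [CommRing A] {i j : Fin n} (h : i ≠ j) :
    ((1 + single i j (-2 : A)) * (1 + single j i 1)) ^ 2 =
      1 - (2 : A) • (single i i 1 + single j j 1) := by
  rw [word_eq, pow_two]
  simp only [mul_add, add_mul, ss_same, ss_ne h, ss_ne h.symm, mul_one, one_mul, smul_add,
    smul_single, smul_eq_mul]
  ext a b
  simp only [Matrix.add_apply, Matrix.sub_apply, Matrix.single_apply, Matrix.zero_apply]
  split_ifs <;> ring

lemma word2_four {A : Type*} [CommRing A] {i j : Fin n} (h : i ≠ j) :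
    ((1 + single i j (-2 : A)) * (1 + single j i 1)) ^ 4 = 1 := by
  rw [show 4 = 2 * 2 from rfl, pow_mul, word2_sq h, pow_two]
  simp only [mul_add, add_mul, mul_sub, sub_mul, ss_same, ss_ne h, ss_ne h.symm, mul_one, one_mul,
    smul_add, smul_single, smul_eq_mul]
  ext a b
  simp only [Matrix.add_apply, Matrix.sub_apply, Matrix.single_apply, Matrix.zero_apply]
  split_ifs <;> ring

lemma word3_sq {A : Type*} [CommRing A] {i j : Fin n} (h : i ≠ j) :
    ((1 + single i j (-3 : A)) * (1 + single j i 1)) ^ 2 =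
      2 - (1 + single i j (-3 : A)) * (1 + single j i 1)
        - (3 : A) • (single i i 1 + single j j 1) := by
  have h2 : (2 : Matrix (Fin n) (Fin n) A) = 1 + 1 := by norm_num
  rw [word_eq, pow_two, h2]
  simp only [mul_add, add_mul, ss_same, ss_ne h, ss_ne h.symm, mul_one, one_mul, smul_add,
    smul_single, smul_eq_mul]
  ext a b
  simp only [Matrix.add_apply, Matrix.sub_apply, Matrix.single_apply, Matrix.zero_apply]
  split_ifs <;> ring

lemma word3_cube {A : Type*} [CommRing A] {i j : Fin n} (h : i ≠ j) :
    ((1 + single i j (-3 : A)) * (1 + single j i 1)) ^ 3 = 1 := by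
  have h2 : (2 : Matrix (Fin n) (Fin n) A) = 1 + 1 := by norm_num
  rw [pow_succ, word3_sq h, word_eq, h2]
  simp only [mul_add, add_mul, mul_sub, sub_mul, ss_same, ss_ne h, ss_ne h.symm, mul_one, one_mul,
    smul_add, smul_single, smul_eq_mul]
  ext a b
  simp only [Matrix.add_apply, Matrix.sub_apply, Matrix.single_apply, Matrix.zero_apply]
  split_ifs <;> ring

lemma word_coe {i j : Fin n} (h : i ≠ j) (c d : R) :
    ((SpecialLinearGroup.transvection h c * SpecialLinearGroup.transvection h.symm d :
      SpecialLinearGroup (Fin n) R) : Matrix (Fin n) (Fin n) R) =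
    (1 + single i j c) * (1 + single j i d) := rfl

lemma tr_add {i j : Fin n} (h : i ≠ j) (r s : R) :
    SpecialLinearGroup.transvection h (r + s) =
    SpecialLinearGroup.transvection h r * SpecialLinearGroup.transvection h s := by
  apply Subtype.ext
  change 1 + single i j (r + s) = (1 + single i j r) * (1 + single i j s)
  simp only [mul_add, add_mul, ss_ne h.symm, mul_one, one_mul, single_add]
  abel

lemma tr_comm {i j k l : Fin n} (h : i ≠ j) (h' : k ≠ l) (hjk : j ≠ k) (hil : i ≠ l) (r s : R) :
    SpecialLinearGroup.transvection h r * SpecialLinearGroup.transvection h' s =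
    SpecialLinearGroup.transvection h' s * SpecialLinearGroup.transvection h r := by
  apply Subtype.ext
  change (1 + single i j r) * (1 + single k l s) = (1 + single k l s) * (1 + single i j r)
  simp only [mul_add, add_mul, ss_ne hjk, ss_ne hil.symm, mul_one, one_mul]
  abel

lemma tr_stein {i j k : Fin n} (h : i ≠ j) (h' : j ≠ k) (h'' : i ≠ k) (r s : R) :
    SpecialLinearGroup.transvection h r * SpecialLinearGroup.transvection h' s =
    SpecialLinearGroup.transvection h'' (r * s) * SpecialLinearGroup.transvection h' s *
      SpecialLinearGroup.transvection h r := by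
  apply Subtype.ext
  change (1 + single i j r) * (1 + single j k s) =
    (1 + single i k (r * s)) * (1 + single j k s) * (1 + single i j r)
  simp only [mul_add, add_mul, ss_same, ss_ne h'.symm, ss_ne h''.symm, mul_one, one_mul, zero_mul]
  abel

/-- The images of transvections. -/
noncomputable def EE (ρ : SpecialLinearGroup (Fin n) R →* GL (Fin n) S) (i j : Fin n) (r : R) :
    Matrix (Fin n) (Fin n) S :=
  if h : i ≠ j then (ρ (SpecialLinearGroup.transvection h r)).1 else 1

lemma EE_eq (ρ : SpecialLinearGroup (Fin n) R →* GL (Fin n) S) {i j : Fin n} (h : i ≠ j) (r : R) :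
    EE ρ i j r = (ρ (SpecialLinearGroup.transvection h r)).1 := by
  rw [EE, dif_pos h]

lemma EE_res (πR : R →+* k) (πS : S →+* k)
    (ρ : SpecialLinearGroup (Fin n) R →* GL (Fin n) S)
    (hlift : ∀ (A : SpecialLinearGroup (Fin n) R) (i j : Fin n),
      πS ((ρ A : Matrix (Fin n) (Fin n) S) i j) = πR ((A : Matrix (Fin n) (Fin n) R) i j))
    {i j : Fin n} (h : i ≠ j) (r : R) :
    (EE ρ i j r).map πS = 1 + single i j (πR r) := by
  ext a b
  rw [Matrix.map_apply, EE_eq ρ h, hlift]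
  change πR ((1 + single i j r) a b) = _
  simp only [Matrix.add_apply, Matrix.one_apply, Matrix.single_apply, map_add]
  split_ifs <;> simp

/-- Images of words. -/
noncomputable def WW (ρ : SpecialLinearGroup (Fin n) R →* GL (Fin n) S) (c : R) (i j : Fin n) :
    Matrix (Fin n) (Fin n) S := EE ρ i j c * EE ρ j i 1

lemma WW_eq (ρ : SpecialLinearGroup (Fin n) R →* GL (Fin n) S) (c : R) {i j : Fin n} (h : i ≠ j) :
    WW ρ c i j = (ρ (SpecialLinearGroup.transvection h c *
      SpecialLinearGroup.transvection h.symm 1)).1 := by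
  rw [WW, EE_eq ρ h, EE_eq ρ h.symm, map_mul]; rfl

lemma WW_pow (ρ : SpecialLinearGroup (Fin n) R →* GL (Fin n) S) (c : R) {i j : Fin n} (h : i ≠ j)
    (m : ℕ) (hc : ((1 + single i j c) * (1 + single j i 1)) ^ m = 1) : WW ρ c i j ^ m = 1 := by
  have : (SpecialLinearGroup.transvection h c * SpecialLinearGroup.transvection h.symm 1) ^ m = 1 := by
    apply Subtype.ext
    refine (Matrix.SpecialLinearGroup.coe_pow _ _).trans ?_
    rw [word_coe, hc]; rfl
  rw [WW_eq ρ c h, ← Units.val_pow_eq_pow_val, ← map_pow, this, map_one]; rfl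

lemma EE_comm (ρ : SpecialLinearGroup (Fin n) R →* GL (Fin n) S) {i j k l : Fin n}
    (h : i ≠ j) (h' : k ≠ l) (hjk : j ≠ k) (hil : i ≠ l) (r s : R) :
    Commute (EE ρ i j r) (EE ρ k l s) := by
  rw [EE_eq ρ h, EE_eq ρ h']
  change _ * _ = _ * _
  rw [← Units.val_mul, ← Units.val_mul, ← map_mul, ← map_mul, tr_comm h h' hjk hil]

lemma WW_comm (ρ : SpecialLinearGroup (Fin n) R →* GL (Fin n) S) {i j k l : Fin n} (c : R)
    (h : i ≠ j) (h' : k ≠ l) (hik : i ≠ k) (hil : i ≠ l) (hjk : j ≠ k) (hjl : j ≠ l) (s : R) :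
    Commute (WW ρ c i j) (EE ρ k l s) :=
  (EE_comm ρ h h' hjk hil c s).mul_left (EE_comm ρ h.symm h' hik hjl 1 s)

lemma WW_comm2 (ρ : SpecialLinearGroup (Fin n) R →* GL (Fin n) S) {i j k l : Fin n} (c : R)
    (h : i ≠ j) (h' : k ≠ l) (hik : i ≠ k) (hil : i ≠ l) (hjk : j ≠ k) (hjl : j ≠ l) :
    Commute (WW ρ c i j) (WW ρ c k l) :=
  (WW_comm ρ c h h' hik hil hjk hjl c).mul_right (WW_comm ρ c h h'.symm hil hik hjl hjk 1)

lemma idem3 (z : Matrix (Fin n) (Fin n) S) (hz : z ^ 3 = 1) (t : S) (ht : t * 3 = 1) :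
    (t • (1 + 1 - z - z ^ 2)) * (t • (1 + 1 - z - z ^ 2)) = t • (1 + 1 - z - z ^ 2) := by
  have key : (1 + 1 - z - z ^ 2) * (1 + 1 - z - z ^ 2) = (3 : S) • (1 + 1 - z - z ^ 2) := by
    have e3 : (3 : S) • (1 + 1 - z - z ^ 2) = (3 : ℕ) • (1 + 1 - z - z ^ 2) := by
      rw [← Nat.cast_smul_eq_nsmul S]; norm_num
    have h1 : (1 + 1 - z - z ^ 2) * (1 + 1 - z - z ^ 2) =
      (4 : ℕ) • 1 - (4 : ℕ) • z - (3 : ℕ) • z ^ 2 + (2 : ℕ) • z ^ 3 + z ^ 3 * z := by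
      noncomm_ring
    rw [e3, h1, hz]; noncomm_ring
  rw [smul_mul_assoc, mul_smul_comm, key, smul_smul t 3, ht, one_smul]

lemma idem2 (z : Matrix (Fin n) (Fin n) S) (hz : z ^ 4 = 1) (t : S) (ht : t * 2 = 1) :
    (t • (1 - z ^ 2)) * (t • (1 - z ^ 2)) = t • (1 - z ^ 2) := by
  have key : (1 - z ^ 2) * (1 - z ^ 2) = (2 : S) • (1 - z ^ 2) := by
    have e3 : (2 : S) • (1 - z ^ 2) = (2 : ℕ) • (1 - z ^ 2) := by
      rw [← Nat.cast_smul_eq_nsmul S]; norm_num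
    have h1 : (1 - z ^ 2) * (1 - z ^ 2) = 1 - (2 : ℕ) • z ^ 2 + z ^ 4 := by
      noncomm_ring
    rw [e3, h1, hz]; noncomm_ring
  rw [smul_mul_assoc, mul_smul_comm, key, smul_smul t 2, ht, one_smul]

lemma exists_stein (πR : R →+* k) (πS : S →+* k) (hkerS : RingHom.ker πS = maximalIdeal S)
    (ρ : SpecialLinearGroup (Fin n) R →* GL (Fin n) S)
    (hlift : ∀ (A : SpecialLinearGroup (Fin n) R) (i j : Fin n),
      πS ((ρ A : Matrix (Fin n) (Fin n) S) i j) = πR ((A : Matrix (Fin n) (Fin n) R) i j)) :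
    ∃ e, Stein πR πS (EE ρ) e := by
  suffices h : ∃ e : Fin n → Fin n → Matrix (Fin n) (Fin n) S,
      (∀ i j, i ≠ j → e i j * e i j = e i j) ∧
      (∃ c : R, ∀ i j, ∀ M, Commute (WW ρ c i j) M → Commute (e i j) M) ∧
      (∀ i j, i ≠ j → (e i j).map πS = single i i 1 + single j j 1) by
    obtain ⟨e, h1, ⟨c, h2⟩, h3⟩ := h
    refine ⟨e, ?_, ?_, ?_, ?_, ?_, h1, ?_, ?_, h3⟩
    · intro i j h
      rw [EE_eq ρ h, SpecialLinearGroup.transvection_coeff_zero, map_one]; rfl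
    · intro i j r s h
      rw [EE_eq ρ h, EE_eq ρ h, EE_eq ρ h, tr_add, map_mul]; rfl
    · intro i j k l r s h h' hjk hil
      exact EE_comm ρ h h' hjk hil r s
    · intro i j k r s h h' h''
      rw [EE_eq ρ h, EE_eq ρ h', EE_eq ρ h'', ← Units.val_mul, ← Units.val_mul, ← Units.val_mul,
        ← map_mul, ← map_mul, ← map_mul, tr_stein h h' h'']
    · intro i j r h
      exact EE_res πR πS ρ hlift h r
    · intro i j k l r h h' hik hil hjk hjl
      exact h2 i j _ (WW_comm ρ c h h' hik hil hjk hjl r)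
    · intro i j k l h h' hik hil hjk hjl
      exact h2 i j _ (h2 k l _ (WW_comm2 ρ c h h' hik hil hjk hjl).symm).symm
  have hW : ∀ (c : R) i j, i ≠ j → (WW ρ c i j).map πS =
      (1 + single i j (πR c)) * (1 + single j i 1) := by
    intro c i j h
    rw [WW, Matrix.map_mul, EE_res πR πS ρ hlift h, EE_res πR πS ρ hlift h.symm, map_one]
  have hmapS : ∀ M : Matrix (Fin n) (Fin n) S, M.map πS = πS.mapMatrix M := fun _ => rfl
  have hsm : ∀ (t : S) (M : Matrix (Fin n) (Fin n) S), πS.mapMatrix (t • M) =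
      πS t • πS.mapMatrix M := by
    intro t M; ext a b; simp
  by_cases h2 : (2 : k) = 0
  · have h3 : (3 : k) ≠ 0 := by
      have : (3 : k) = 2 + 1 := by norm_num
      rw [this, h2]; simp
    obtain ⟨u, hu⟩ := isUnit_of_pi (x := (3 : S)) πS hkerS (by rw [map_ofNat]; exact h3)
    obtain ⟨t, ht⟩ : ∃ t : S, t * 3 = 1 := ⟨(u⁻¹).1, by rw [← hu]; simp⟩
    have htk : πS t * 3 = 1 := by
      have := congrArg πS ht
      rwa [map_mul, map_ofNat, map_one] at this
    refine ⟨fun i j => t • (1 + 1 - WW ρ (-3) i j - WW ρ (-3) i j ^ 2), ?_, ⟨-3, ?_⟩, ?_⟩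
    · intro i j h
      have hz := WW_pow ρ (-3) h 3 (word3_cube h)
      exact idem3 _ hz t ht
    · intro i j M hM
      exact (((((Commute.one_left M).add_left (Commute.one_left M)).sub_left hM).sub_left (hM.pow_left 2))).smul_left t
    · intro i j h
      have hz := hW (-3) i j h
      simp only [map_neg, map_ofNat] at hz
      rw [hmapS] at hz ⊢
      rw [hsm, map_sub, map_sub, map_pow, hz, word3_sq h, map_add, map_one, one_add_one_eq_two]
      rw [show ∀ a b c : Matrix (Fin n) (Fin n) k, a - b - (a - b - c) = c from
        fun a b c => by abel, smul_smul, htk, one_smul]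
  · obtain ⟨u, hu⟩ := isUnit_of_pi (x := (2 : S)) πS hkerS (by rw [map_ofNat]; exact h2)
    obtain ⟨t, ht⟩ : ∃ t : S, t * 2 = 1 := ⟨(u⁻¹).1, by rw [← hu]; simp⟩
    have htk : πS t * 2 = 1 := by
      have := congrArg πS ht
      rwa [map_mul, map_ofNat, map_one] at this
    refine ⟨fun i j => t • (1 - WW ρ (-2) i j ^ 2), ?_, ⟨-2, ?_⟩, ?_⟩
    · intro i j h
      have hz := WW_pow ρ (-2) h 4 (word2_four h)
      exact idem2 _ hz t ht
    · intro i j M hM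
      exact (((Commute.one_left M).sub_left (hM.pow_left 2))).smul_left t
    · intro i j h
      have hz := hW (-2) i j h
      simp only [map_neg, map_ofNat] at hz
      rw [hmapS] at hz ⊢
      rw [hsm, map_sub, map_pow, hz, word2_sq h, map_one, sub_sub_cancel, smul_smul, htk, one_smul]

end Final
end SLnLift

/-- For `n ≥ 4`, `R` complete Noetherian local with residue field `k`,
`S` Artinian local with residue field `k`, every lift `ρ : SL_n(R) → GL_n(S)` of the
natural representation is conjugate (by a matrix `≡ I mod m_S`) to one induced by a
local ring homomorphism `f : R → S` compatible with the reductions. -/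
theorem sln_universal_lift_dim_ge_four
    {k : Type*} [Field k] [Fintype k]
    {R : Type*} [CommRing R] [IsLocalRing R] [IsNoetherianRing R]
    [IsAdicComplete (maximalIdeal R) R]
    {S : Type*} [CommRing S] [IsLocalRing S] [IsArtinianRing S]
    (n : ℕ) (hn : 4 ≤ n)
    (πR : R →+* k) (hπR : Function.Surjective πR)
    (hkerR : RingHom.ker πR = maximalIdeal R)
    (πS : S →+* k) (hπS : Function.Surjective πS)
    (hkerS : RingHom.ker πS = maximalIdeal S)
    (ρ : SpecialLinearGroup (Fin n) R →* GL (Fin n) S)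
    (hlift : ∀ (A : SpecialLinearGroup (Fin n) R) (i j : Fin n),
      πS ((ρ A : Matrix (Fin n) (Fin n) S) i j) = πR ((A : Matrix (Fin n) (Fin n) R) i j)) :
    ∃ (f : R →+* S) (X : GL (Fin n) S),
      IsLocalHom f ∧
      (∀ r : R, πS (f r) = πR r) ∧
      (∀ i j, (X : Matrix (Fin n) (Fin n) S) i j - (1 : Matrix (Fin n) (Fin n) S) i j ∈
        maximalIdeal S) ∧
      (∀ A : SpecialLinearGroup (Fin n) R,
        (ρ A : Matrix (Fin n) (Fin n) S) =
          (X : Matrix (Fin n) (Fin n) S) * (A : Matrix (Fin n) (Fin n) R).map f *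
            ((X⁻¹ : GL (Fin n) S) : Matrix (Fin n) (Fin n) S)) := by
  obtain ⟨e, H⟩ := SLnLift.exists_stein πR πS hkerS ρ hlift
  have hm : IsNilpotent (maximalIdeal S) := by
    have h := IsArtinianRing.isNilpotent_jacobson_bot (R := S)
    rwa [IsLocalRing.jacobson_eq_maximalIdeal _ bot_ne_top] at h
  obtain ⟨f, X, hX, hf, hE⟩ := H.exists_units hm hkerS hn
  refine ⟨f, X, ⟨fun r hr => ?_⟩, hf, ?_, ?_⟩
  · by_contra hc
    have h1 : r ∈ RingHom.ker πR := by
      rw [hkerR]; exact (IsLocalRing.mem_maximalIdeal r).2 hc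
    have h2 : f r ∈ RingHom.ker πS := by
      rw [RingHom.mem_ker, hf]; exact h1
    rw [hkerS] at h2
    exact (IsLocalRing.mem_maximalIdeal _).1 h2 hr
  · intro i j
    rw [← hkerS, RingHom.mem_ker, map_sub]
    have h := congrFun (congrFun hX i) j
    rw [Matrix.map_apply] at h
    rw [h, Matrix.one_apply, Matrix.one_apply]
    split_ifs <;> simp
  · intro A
    let φ : SpecialLinearGroup (Fin n) R →* GL (Fin n) S :=
      SpecialLinearGroup.toGL.comp (SpecialLinearGroup.map f)
    have key : ρ A * X = X * φ A := by
      refine Subgroup.closure_induction (p := fun A _ => ρ A * X = X * φ A) ?_ ?_ ?_ ?_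
        (SLnLift.elem_top A)
      · rintro _ ⟨i, j, h, c, rfl⟩
        apply Units.ext
        have h1 := hE i j c h
        rw [SLnLift.EE_eq ρ h] at h1
        have h2 : (φ (SpecialLinearGroup.transvection h c)).1 = 1 + single i j (f c) := by
          change (1 + single i j c : Matrix (Fin n) (Fin n) R).map f = _
          ext a b
          simp only [Matrix.map_apply, Matrix.add_apply, Matrix.one_apply, Matrix.single_apply,
            map_add]
          split_ifs <;> simp
        rw [Units.val_mul, Units.val_mul, h2]
        exact h1
      · simp
      · intro x y _ _ hx hy
        rw [map_mul, map_mul, mul_assoc, hy, ← mul_assoc, hx, mul_assoc]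
      · intro x _ hx
        rw [map_inv, map_inv, inv_mul_eq_iff_eq_mul, ← mul_assoc, hx, mul_inv_cancel_right]
    have h3 : ρ A = X * φ A * X⁻¹ := by rw [← key, mul_inv_cancel_right]
    rw [h3]
    rfl
end

section
/- Let k be a finite field with more than 2 elements (k ≠ F₂) and n = 3. Let R be a complete Noetherian local commutative ring with residue field k, and let S be an Artinian local commutative ring with residue field k. Then for every group homomorphism ρ : SL_3(R) → GL_3(S) lifting the natural representation (i.e. π_S(ρ(A)(i,j)) = π_R(A(i,j)) for all A ∈ SL_3(R) and all i,j), there exist a local ring homomorphism f : R → S with π_S ∘ f = π_R and a matrix X ∈ GL_3(S) with X ≡ I mod m_S such that ρ(A) = X · f(A) · X⁻¹ for all A ∈ SL_3(R), where f(A) denotes f applied entrywise. -/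
open Matrix IsLocalRing

namespace SL3Lift

/-- Elementary matrix in `SL_3`. -/
def el {R : Type*} [CommRing R] {i j : Fin 3} (h : i ≠ j) (r : R) : SpecialLinearGroup (Fin 3) R :=
  ⟨transvection i j r, det_transvection_of_ne i j h r⟩

theorem coe_el {R : Type*} [CommRing R] {i j : Fin 3} (h : i ≠ j) (r : R) :
    (el h r : Matrix (Fin 3) (Fin 3) R) = 1 + Matrix.single i j r := rfl

theorem el_apply {R : Type*} [CommRing R] {i j : Fin 3} (h : i ≠ j) (r : R) (x y : Fin 3) :
    (el h r : Matrix (Fin 3) (Fin 3) R) x y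
      = (if x = y then 1 else 0) + (if i = x ∧ j = y then r else 0) := by
  rw [coe_el, Matrix.add_apply, Matrix.one_apply, Matrix.single_apply]

theorem el_mul_apply {R : Type*} [CommRing R] {i j : Fin 3} (h : i ≠ j) (r : R)
    (A : SpecialLinearGroup (Fin 3) R) (x y : Fin 3) :
    (el h r * A : SpecialLinearGroup (Fin 3) R).1 x y
      = if x = i then A.1 i y + r * A.1 j y else A.1 x y := by
  split_ifs with hx
  · subst hx; exact transvection_mul_apply_same _ _ _ _ _
  · exact transvection_mul_apply_of_ne _ _ _ _ hx _ _

theorem el_add {R : Type*} [CommRing R] {i j : Fin 3} (h : i ≠ j) (r s : R) :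
    el h (r + s) = el h r * el h s := by
  apply Subtype.ext
  exact (transvection_mul_transvection_same i j h r s).symm

theorem el_comm_row {R : Type*} [CommRing R] {i j l : Fin 3} (h : i ≠ j) (h' : i ≠ l) (r s : R) :
    el h r * el h' s = el h' s * el h r := by
  apply Subtype.ext
  simp [coe_el, mul_add, add_mul, Matrix.single_mul_single_of_ne, h.symm, h'.symm]
  abel

theorem el_comm_col {R : Type*} [CommRing R] {i j l : Fin 3} (h : i ≠ j) (h' : l ≠ j) (r s : R) :
    el h r * el h' s = el h' s * el h r := by
  apply Subtype.ext
  simp [coe_el, mul_add, add_mul, Matrix.single_mul_single_of_ne, h.symm, h'.symm]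
  abel

theorem el_chev {R : Type*} [CommRing R] {i j l : Fin 3} (h : i ≠ j) (h' : j ≠ l) (h'' : i ≠ l)
    (r s : R) :
    el h r * el h' s = el h'' (r * s) * el h' s * el h r := by
  apply Subtype.ext
  simp [coe_el, mul_add, add_mul, Matrix.single_mul_single_of_ne, h'.symm, h''.symm]
  abel

/-- diagonal element -/
theorem exists_diag {R : Type*} [CommRing R] {i j : Fin 3} (h : i ≠ j) (a : Rˣ) :
    ∃ d : SpecialLinearGroup (Fin 3) R, d * el h 1 = el h (a : R) * d := by
  refine ⟨⟨diagonal (fun x => if x = i then (a : R) else if x = j then 1 else ((a⁻¹ : Rˣ) : R)),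
    ?_⟩, ?_⟩
  · rw [det_diagonal, Fin.prod_univ_three]
    revert h; fin_cases i <;> fin_cases j <;> simp
  · apply Subtype.ext
    change diagonal _ * (1 + Matrix.single i j (1 : R))
      = (1 + Matrix.single i j (a : R)) * diagonal _
    ext x y
    simp only [mul_add, add_mul, Matrix.add_apply, Matrix.diagonal_mul, Matrix.mul_diagonal,
      Matrix.single_apply, mul_one, one_mul]
    revert h; fin_cases i <;> fin_cases j <;> fin_cases x <;> fin_cases y <;> simp

section gen
variable {R : Type*} [CommRing R] [IsLocalRing R]

def E3 (R : Type*) [CommRing R] : Subgroup (SpecialLinearGroup (Fin 3) R) :=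
  Subgroup.closure {g | ∃ (i j : Fin 3) (h : i ≠ j) (r : R), g = el h r}

theorem el_mem {i j : Fin 3} (h : i ≠ j) (r : R) : el h r ∈ E3 R :=
  Subgroup.subset_closure ⟨i, j, h, r, rfl⟩

theorem of_el_mul {i j : Fin 3} (h : i ≠ j) (r : R) {A : SpecialLinearGroup (Fin 3) R}
    (hA : el h r * A ∈ E3 R) : A ∈ E3 R :=
  (Subgroup.mul_mem_cancel_left _ (el_mem h r)).1 hA

theorem step1 (A : SpecialLinearGroup (Fin 3) R) (h0 : A.1 0 0 = 1) (h1 : A.1 1 0 = 0)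
    (h2 : A.1 2 0 = 0) (h3 : A.1 1 1 = 1) (h4 : A.1 2 1 = 0) : A ∈ E3 R := by
  have h5 : A.1 2 2 = 1 := by
    have := A.2
    rw [Matrix.det_fin_three] at this
    simpa [h0, h1, h2, h3, h4] using this
  have h01 : (0 : Fin 3) ≠ 1 := by decide
  have h02 : (0 : Fin 3) ≠ 2 := by decide
  have h12 : (1 : Fin 3) ≠ 2 := by decide
  apply of_el_mul h01 (-A.1 0 1)
  apply of_el_mul h12 (-A.1 1 2)
  apply of_el_mul h02 (-(A.1 0 2 - A.1 0 1 * A.1 1 2))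
  convert (E3 R).one_mem
  ext x y
  fin_cases x <;> fin_cases y <;> simp [el_mul_apply, h0, h1, h2, h3, h4, h5, -SpecialLinearGroup.coe_mul]
  ring

theorem step2' (A : SpecialLinearGroup (Fin 3) R) (h0 : A.1 0 0 = 1) (h1 : A.1 1 0 = 0)
    (h2 : A.1 2 0 = 0) (h3 : IsUnit (A.1 2 1)) : A ∈ E3 R := by
  obtain ⟨u, hu⟩ := h3
  have h21 : (2 : Fin 3) ≠ 1 := by decide
  have h12 : (1 : Fin 3) ≠ 2 := by decide
  apply of_el_mul h12 ((1 - A.1 1 1) * (u⁻¹ : Rˣ))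
  apply of_el_mul h21 (- A.1 2 1)
  apply step1 <;> simp [el_mul_apply, h0, h1, h2, ← hu, -SpecialLinearGroup.coe_mul]

theorem step2 (A : SpecialLinearGroup (Fin 3) R) (h0 : A.1 0 0 = 1) (h1 : A.1 1 0 = 0)
    (h2 : A.1 2 0 = 0) : A ∈ E3 R := by
  by_cases h : IsUnit (A.1 2 1)
  · exact step2' A h0 h1 h2 h
  have h5 : A.1 1 1 * A.1 2 2 + - A.1 1 2 * A.1 2 1 = 1 := by
    have := A.2
    rw [Matrix.det_fin_three] at this
    rw [h0, h1, h2] at this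
    linear_combination this
  have h6 : IsUnit (A.1 1 1) := by
    rcases IsLocalRing.isUnit_or_isUnit_of_add_one h5 with h' | h'
    · exact isUnit_of_mul_isUnit_left h'
    · exact absurd (isUnit_of_mul_isUnit_right h') h
  obtain ⟨u, hu⟩ := h6
  have h21 : (2 : Fin 3) ≠ 1 := by decide
  apply of_el_mul h21 ((1 - A.1 2 1) * (u⁻¹ : Rˣ))
  apply step2' <;> simp [el_mul_apply, h0, h1, h2, ← hu, -SpecialLinearGroup.coe_mul]

theorem step3 (A : SpecialLinearGroup (Fin 3) R) (h0 : A.1 0 0 = 1) : A ∈ E3 R := by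
  have h10 : (1 : Fin 3) ≠ 0 := by decide
  have h20 : (2 : Fin 3) ≠ 0 := by decide
  apply of_el_mul h10 (-A.1 1 0)
  apply of_el_mul h20 (-A.1 2 0)
  apply step2 <;> simp [el_mul_apply, h0, -SpecialLinearGroup.coe_mul]

theorem step4 (A : SpecialLinearGroup (Fin 3) R) {i : Fin 3} (hi : 0 ≠ i)
    (h : IsUnit (A.1 i 0)) : A ∈ E3 R := by
  obtain ⟨u, hu⟩ := h
  apply of_el_mul hi ((1 - A.1 0 0) * (u⁻¹ : Rˣ))
  apply step3
  simp [el_mul_apply, ← hu, -SpecialLinearGroup.coe_mul]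

theorem gen (A : SpecialLinearGroup (Fin 3) R) : A ∈ E3 R := by
  have h01 : (0 : Fin 3) ≠ 1 := by decide
  have h02 : (0 : Fin 3) ≠ 2 := by decide
  by_cases h1 : IsUnit (A.1 1 0)
  · exact step4 A h01 h1
  by_cases h2 : IsUnit (A.1 2 0)
  · exact step4 A h02 h2
  have h0 : IsUnit (A.1 0 0) := by
    by_contra h0
    have e : A.1.det ∈ maximalIdeal R := by
      rw [Matrix.det_fin_three]
      have m0 : A.1 0 0 ∈ maximalIdeal R := h0
      have m1 : A.1 1 0 ∈ maximalIdeal R := h1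
      have m2 : A.1 2 0 ∈ maximalIdeal R := h2
      have : A.1 0 0 * A.1 1 1 * A.1 2 2 - A.1 0 0 * A.1 1 2 * A.1 2 1
        - A.1 0 1 * A.1 1 0 * A.1 2 2 + A.1 0 1 * A.1 1 2 * A.1 2 0
        + A.1 0 2 * A.1 1 0 * A.1 2 1 - A.1 0 2 * A.1 1 1 * A.1 2 0
        = (A.1 1 1 * A.1 2 2 - A.1 1 2 * A.1 2 1) * A.1 0 0
        + (A.1 0 2 * A.1 2 1 - A.1 0 1 * A.1 2 2) * A.1 1 0
        + (A.1 0 1 * A.1 1 2 - A.1 0 2 * A.1 1 1) * A.1 2 0 := by ring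
      rw [this]
      exact add_mem (add_mem (Ideal.mul_mem_left _ _ m0) (Ideal.mul_mem_left _ _ m1))
        (Ideal.mul_mem_left _ _ m2)
    rw [A.2] at e
    exact (Ideal.ne_top_iff_one _).1 (maximalIdeal.isMaximal R).ne_top e
  obtain ⟨u, hu⟩ := h0
  apply of_el_mul h01.symm ((1 - A.1 1 0) * (u⁻¹ : Rˣ))
  apply step4 _ h01
  simp [el_mul_apply, ← hu, -SpecialLinearGroup.coe_mul]

end gen
theorem sum3 {M : Type*} [AddCommMonoid M] {i j l : Fin 3} (hij : i ≠ j) (hjl : j ≠ l)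
    (hil : i ≠ l) (f : Fin 3 → M) : ∑ x, f x = f i + f j + f l := by
  rw [Fin.sum_univ_three]
  revert hij hjl hil
  fin_cases i <;> fin_cases j <;> fin_cases l <;> simp <;> abel

theorem cases3 {i j l : Fin 3} (hij : i ≠ j) (hjl : j ≠ l)
    (hil : i ≠ l) (x : Fin 3) : x = i ∨ x = j ∨ x = l := by
  revert hij hjl hil
  fin_cases i <;> fin_cases j <;> fin_cases l <;> fin_cases x <;> simp

theorem third {i j : Fin 3} (hij : i ≠ j) : ∃ l, j ≠ l ∧ i ≠ l := by
  revert hij; revert i j; decide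

section lin
variable {S : Type*} [CommRing S] [IsLocalRing S]

theorem nak (M : Matrix (Fin 3) (Fin 3) S)
    (h : ∀ x y, M x y ∈ maximalIdeal S • Ideal.span (Set.range fun p : Fin 3 × Fin 3 => M p.1 p.2)) :
    M = 0 := by
  have h0 : Ideal.span (Set.range fun p : Fin 3 × Fin 3 => M p.1 p.2) = ⊥ := by
    apply Submodule.eq_bot_of_le_smul_of_le_jacobson_bot (maximalIdeal S)
    · exact Submodule.fg_span (Set.finite_range _)
    · rw [Ideal.span_le]
      rintro _ ⟨p, rfl⟩
      exact h p.1 p.2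
    · exact IsLocalRing.maximalIdeal_le_jacobson _
  ext x y
  have : M x y ∈ Ideal.span (Set.range fun p : Fin 3 × Fin 3 => M p.1 p.2) :=
    Ideal.subset_span ⟨(x, y), rfl⟩
  rw [h0] at this
  simpa using this

theorem comm_aux (J : Ideal S) (A B : Matrix (Fin 3) (Fin 3) S) (i l : Fin 3)
    (hA : ∀ x y, A x y ∈ J)
    (hB : ∀ x y, (B - 1 - Matrix.single i l 1 : Matrix (Fin 3) (Fin 3) S) x y ∈ maximalIdeal S)
    (hc : A * B = B * A) (x y : Fin 3) :
    (if l = y then A x i else 0) - (if i = x then A l y else 0) ∈ maximalIdeal S • J := by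
  set D := B - 1 - Matrix.single i l 1 with hD
  have hB' : B = D + 1 + Matrix.single i l 1 := by rw [hD]; abel
  have e : A * Matrix.single i l 1 - Matrix.single i l 1 * A = D * A - A * D := by
    rw [hB'] at hc
    have : A * D + A + A * Matrix.single i l 1 = D * A + A + Matrix.single i l 1 * A := by
      simpa [mul_add, add_mul] using hc
    have h2 := congrArg (fun Z => Z - A - A * D - Matrix.single i l 1 * A) this
    have l1 : A * Matrix.single i l 1 - Matrix.single i l 1 * A
      = A * D + A + A * Matrix.single i l 1 - A - A * D - Matrix.single i l 1 * A := by abel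
    rw [l1, h2]; abel
  have e2 := congrFun (congrFun e x) y
  have e3 : (A * Matrix.single i l 1 - Matrix.single i l 1 * A : Matrix (Fin 3) (Fin 3) S) x y
      = (if l = y then A x i else 0) - (if i = x then A l y else 0) := by
    simp [Matrix.mul_apply, Matrix.single_apply, Finset.sum_ite_eq, ite_and]
  rw [← e3, e2, Matrix.sub_apply, Matrix.mul_apply, Matrix.mul_apply]
  refine sub_mem (sum_mem fun z _ => ?_) (sum_mem fun z _ => ?_)
  · exact Submodule.smul_mem_smul (hB _ _) (hA _ _)
  · rw [mul_comm]; exact Submodule.smul_mem_smul (hB _ _) (hA _ _)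

theorem span_lemma {i j l : Fin 3} (hij : i ≠ j) (hjl : j ≠ l) (hil : i ≠ l)
    (A B C E : Matrix (Fin 3) (Fin 3) S)
    (hB : ∀ x y, (B - 1 - Matrix.single i l 1 : Matrix (Fin 3) (Fin 3) S) x y ∈ maximalIdeal S)
    (hC : ∀ x y, (C - 1 - Matrix.single l j 1 : Matrix (Fin 3) (Fin 3) S) x y ∈ maximalIdeal S)
    (hE : IsUnit (E i j))
    (hAB : A * B = B * A) (hAC : A * C = C * A) (hEB : E * B = B * E) (hEC : E * C = C * E) :
    ∃ u g : S, A = u • 1 + g • E := by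
  obtain ⟨w, hw⟩ := hE
  set g := A i j * (w⁻¹ : Sˣ) with hg
  set u := A i i - g * E i i with hu
  refine ⟨u, g, ?_⟩
  set M := A - u • 1 - g • E with hM
  have hMij : M i j = 0 := by
    simp [hM, hij, hg, ← hw]
  have hMii : M i i = 0 := by
    simp [hM, hu]
  have hMB : M * B = B * M := by
    simp [hM, sub_mul, mul_sub, hAB, hEB]
  have hMC : M * C = C * M := by
    simp [hM, sub_mul, mul_sub, hAC, hEC]
  have hJ : ∀ x y, M x y ∈ Ideal.span (Set.range fun p : Fin 3 × Fin 3 => M p.1 p.2) :=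
    fun x y => Ideal.subset_span ⟨(x, y), rfl⟩
  have kB := comm_aux _ M B i l hJ hB hMB
  have kC := comm_aux _ M C l j hJ hC hMC
  have hM0 : M = 0 := by
    apply nak
    generalize maximalIdeal S • Ideal.span (Set.range fun p : Fin 3 × Fin 3 => M p.1 p.2) = K
      at kB kC ⊢
    have ji : M j i ∈ K := by simpa [hij] using kB j l
    have li : M l i ∈ K := by simpa [hil] using kB l l
    have lj : M l j ∈ K := by simpa [hjl.symm] using kB i j
    have il : M i l ∈ K := by simpa [hil.symm] using kC i j
    have jl : M j l ∈ K := by simpa [hjl.symm] using kC j j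
    have ll : M l l ∈ K := by simpa [hMii] using kB i l
    have jj : M j j ∈ K := by
      have := kC l j
      simp only [if_true] at this
      simpa using sub_mem ll this
    have ii : M i i ∈ K := by rw [hMii]; exact zero_mem _
    have ij : M i j ∈ K := by rw [hMij]; exact zero_mem _
    intro x y
    rcases cases3 hij hjl hil x with rfl | rfl | rfl <;>
    rcases cases3 hij hjl hil y with rfl | rfl | rfl <;> assumption
  have : A = M + u • 1 + g • E := by rw [hM]; abel
  rw [this, hM0, zero_add]

theorem rank_one {i j l : Fin 3} (hij : i ≠ j) (hjl : j ≠ l) (hil : i ≠ l)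
    (N h h' : Matrix (Fin 3) (Fin 3) S) (g a b : S)
    (hN : IsUnit (N i j)) (hh : h' * h = 1) (hg : IsUnit g) (hg1 : IsUnit (1 - g))
    (hc : h * N * h' = g • N) (hq : N * N = a • 1 + b • N) :
    N i i + N j j + N l l = 0 ∧ ∀ x y, N x y * N i j = N x j * N i y := by
  have htr : N i i + N j j + N l l = 0 := by
    have e := congrArg Matrix.trace hc
    rw [Matrix.trace_mul_comm, ← mul_assoc, hh, one_mul, Matrix.trace_smul, smul_eq_mul] at e
    have : (1 - g) * N.trace = 0 := by linear_combination e
    rw [hg1.mul_right_eq_zero] at this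
    rw [← this, Matrix.trace, sum3 hij hjl hil]; rfl
  refine ⟨htr, ?_⟩
  have hh' : h * h' = 1 := mul_eq_one_comm.1 hh
  have hb : b = 0 := by
    have e1 : (h * N * h') * (h * N * h') = h * (N * N) * h' := by
      calc _ = h * N * (h' * h) * N * h' := by simp only [mul_assoc]
        _ = _ := by rw [hh]; simp only [mul_assoc, mul_one]
    have e2 : h * (a • 1 + b • N) * h' = a • 1 + b • (h * N * h') := by
      simp [mul_add, add_mul, hh']
    rw [hq, e2, hc] at e1
    have e3 : (g • N) * (g • N) = (g * g) • (a • 1 + b • N) := by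
      rw [← hq]; simp [smul_smul]
    rw [e3] at e1
    have e4 := congrFun (congrFun e1 i) j
    simp [hij] at e4
    have e5 : (g * (1 - g) * N i j) * b = 0 := by linear_combination -e4
    rwa [((hg.mul hg1).mul hN).mul_right_eq_zero] at e5
  have hq' : ∀ x y, N x i * N i y + N x j * N j y + N x l * N l y = if x = y then a else 0 := by
    intro x y
    have := congrFun (congrFun hq x) y
    rw [Matrix.mul_apply, sum3 hij hjl hil, hb] at this
    simpa [Matrix.one_apply] using this
  have qij := hq' i j
  have qil := hq' i l
  have qlj := hq' l j
  have qii := hq' i i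
  have qll := hq' l l
  simp only [hij, hil, hjl.symm, if_true, if_false] at qij qil qlj qii qll
  have ll : N l l * N i j = N l j * N i l := by linear_combination (N i j) * htr - qij
  have jl : N j l * N i j = N j j * N i l := by linear_combination qil - (N i l) * htr
  have li : N l i * N i j = N l j * N i i := by linear_combination qlj - (N l j) * htr
  have ji : N j i * N i j = N j j * N i i := by
    have e : N i j * (N j i * N i j - N j j * N i i) = 0 := by
      linear_combination (N i j) * (qii - qll) + (N l l - N i i) * N i j * htr
        + N l j * jl - N j j * ll
    rw [hN.mul_right_eq_zero] at e
    linear_combination e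
  intro x y
  rcases cases3 hij hjl hil x with rfl | rfl | rfl <;>
  rcases cases3 hij hjl hil y with rfl | rfl | rfl <;> first | assumption | ring

theorem two_by_two {s t α β γ δ : S} (hα : IsUnit α) (hδ : IsUnit δ) (hβ : β ∈ maximalIdeal S)
    (h1 : α * s + β * t = 0) (h2 : γ * s + δ * t = 0) : s = 0 ∧ t = 0 := by
  have hu : IsUnit (α * δ - β * γ) := by
    by_contra hn
    have : α * δ - β * γ + γ * β ∈ maximalIdeal S :=
      add_mem (show α * δ - β * γ ∈ maximalIdeal S from hn) (Ideal.mul_mem_left _ _ hβ)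
    have e : α * δ - β * γ + γ * β = α * δ := by ring
    rw [e] at this
    exact this (hα.mul hδ)
  constructor
  · have : (α * δ - β * γ) * s = 0 := by linear_combination δ * h1 - β * h2
    rwa [hu.mul_right_eq_zero] at this
  · have : (α * δ - β * γ) * t = 0 := by linear_combination α * h2 - γ * h1
    rwa [hu.mul_right_eq_zero] at this
end lin
section root
variable {k : Type*} [Field k] {R : Type*} [CommRing R] {S : Type*} [CommRing S] [IsLocalRing S]

theorem unit_of (πS : S →+* k) (hkerS : RingHom.ker πS = maximalIdeal S) {x : S}
    (hx : πS x ≠ 0) : IsUnit x := by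
  by_contra h
  have h1 : x ∈ maximalIdeal S := h
  rw [← hkerS] at h1
  exact hx h1

theorem mem_of (πS : S →+* k) (hkerS : RingHom.ker πS = maximalIdeal S) {x : S}
    (hx : πS x = 0) : x ∈ maximalIdeal S := by
  rw [← hkerS]; exact hx

theorem root (πR : R →+* k) (πS : S →+* k) (hkerS : RingHom.ker πS = maximalIdeal S)
    (ρ : SpecialLinearGroup (Fin 3) R →* GL (Fin 3) S)
    (hlift : ∀ (A : SpecialLinearGroup (Fin 3) R) (i j : Fin 3),
      πS ((ρ A : Matrix (Fin 3) (Fin 3) S) i j) = πR ((A : Matrix (Fin 3) (Fin 3) R) i j))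
    (a : Rˣ) (ha : πR a ≠ 1) {i j : Fin 3} (hij : i ≠ j) :
    ∃ f φ : Fin 3 → S, f i = 1 ∧ (∀ x, x ≠ i → πS (f x) = 0) ∧ πS (φ j) = 1 ∧
      (∀ y, y ≠ j → πS (φ y) = 0) ∧ φ ⬝ᵥ f = 0 ∧
      ∀ r, ∃ u g : S, (ρ (el hij r) : Matrix (Fin 3) (Fin 3) S) = u • 1 + g • vecMulVec f φ := by
  obtain ⟨l, hjl, hil⟩ := third hij
  have hcomm : ∀ X Y : SpecialLinearGroup (Fin 3) R, X * Y = Y * X →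
      (ρ X : Matrix (Fin 3) (Fin 3) S) * (ρ Y : Matrix (Fin 3) (Fin 3) S)
        = (ρ Y : Matrix (Fin 3) (Fin 3) S) * (ρ X : Matrix (Fin 3) (Fin 3) S) := by
    intro X Y h
    rw [← Units.val_mul, ← Units.val_mul, ← map_mul, ← map_mul, h]
  have hred : ∀ {i j : Fin 3} (h : i ≠ j) (x y : Fin 3),
      ((ρ (el h 1) : Matrix (Fin 3) (Fin 3) S) - 1 - Matrix.single i j 1 : 
        Matrix (Fin 3) (Fin 3) S) x y ∈ maximalIdeal S := by
    intro i j h x y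
    apply mem_of πS hkerS
    rw [Matrix.sub_apply, Matrix.sub_apply, map_sub, map_sub, hlift, el_apply, Matrix.one_apply,
      Matrix.single_apply]
    split_ifs <;> simp
  set B := (ρ (el hil 1) : Matrix (Fin 3) (Fin 3) S) with hB
  set C := (ρ (el hjl.symm 1) : Matrix (Fin 3) (Fin 3) S) with hC
  set P : R → Matrix (Fin 3) (Fin 3) S := fun r => (ρ (el hij r) : Matrix (Fin 3) (Fin 3) S) with hP
  have hPB : ∀ r, P r * B = B * P r := fun r => hcomm _ _ (el_comm_row _ _ _ _)
  have hPC : ∀ r, P r * C = C * P r := fun r => hcomm _ _ (el_comm_col _ _ _ _)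
  have key : ∀ A E : Matrix (Fin 3) (Fin 3) S, IsUnit (E i j) → A * B = B * A → A * C = C * A →
      E * B = B * E → E * C = C * E → ∃ u g : S, A = u • 1 + g • E :=
    fun A E h1 h2 h3 h4 h5 => span_lemma hij hjl hil A B C E (hred hil) (hred hjl.symm) h1 h2 h3 h4 h5
  set E := P 1 - 1 with hE
  have hEr : ∀ x y, πS (E x y) = if i = x ∧ j = y then 1 else 0 := by
    intro x y
    rw [hE, Matrix.sub_apply, map_sub, hP, hlift, el_apply, Matrix.one_apply]
    split_ifs <;> simp
  have hEij : IsUnit (E i j) := unit_of πS hkerS (by rw [hEr]; simp)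
  have hEB : E * B = B * E := by rw [hE, sub_mul, mul_sub, hPB]; simp
  have hEC : E * C = C * E := by rw [hE, sub_mul, mul_sub, hPC]; simp
  obtain ⟨u, g, hug⟩ := key (P a) E hEij (hPB a) (hPC a) hEB hEC
  have hg : πS g = πR a := by
    have h1 := hlift (el hij (a : R)) i j
    change πS ((P a) i j) = _ at h1
    rw [hug, el_apply] at h1
    simpa [hij, hEr] using h1
  have hu : πS u = 1 := by
    have h1 := hlift (el hij (a : R)) i i
    change πS ((P a) i i) = _ at h1
    rw [hug, el_apply] at h1
    simpa [hij.symm, hEr] using h1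
  have hgu : IsUnit g := unit_of πS hkerS (by
    rw [hg]; exact (a.isUnit.map πR).ne_zero)
  have hg1 : IsUnit (1 - g) := unit_of πS hkerS (by
    rw [map_sub, hg, map_one, sub_ne_zero]; exact ha.symm)
  obtain ⟨d, hd⟩ := exists_diag hij a
  obtain ⟨v, hv⟩ := hg1
  set c := (u - 1) * (v⁻¹ : Sˣ) with hc
  have hcv : (1 - g) * c = u - 1 := by
    rw [← hv, hc, mul_comm, mul_assoc]; simp
  have hπc : πS c = 0 := by rw [hc, map_mul, map_sub, hu]; simp
  set N := E - c • 1 with hN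
  have hNr : ∀ x y, πS (N x y) = if i = x ∧ j = y then 1 else 0 := by
    intro x y
    rw [hN, Matrix.sub_apply, map_sub, hEr, Matrix.smul_apply, smul_eq_mul, map_mul, hπc]
    simp
  have hNij : IsUnit (N i j) := unit_of πS hkerS (by rw [hNr]; simp)
  have hNB : N * B = B * N := by rw [hN, sub_mul, mul_sub, hEB]; simp
  have hNC : N * C = C * N := by rw [hN, sub_mul, mul_sub, hEC]; simp
  obtain ⟨α, β, hq⟩ := key (N * N) N hNij (by rw [mul_assoc, hNB, ← mul_assoc, hNB, mul_assoc])
    (by rw [mul_assoc, hNC, ← mul_assoc, hNC, mul_assoc]) hNB hNC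
  set H := (ρ d : Matrix (Fin 3) (Fin 3) S) with hH
  set H' := ((ρ d)⁻¹ : GL (Fin 3) S).val with hH'
  have hHH : H' * H = 1 := by rw [hH, hH', ← Units.val_mul]; simp
  have hHH2 : H * H' = 1 := by rw [hH, hH', ← Units.val_mul]; simp
  have hHP : H * P 1 * H' = P a := by
    have : H * P 1 = P a * H := by
      simp only [hH, hP]
      rw [← Units.val_mul, ← Units.val_mul, ← map_mul, ← map_mul, hd]
    rw [this, mul_assoc, hHH2, mul_one]
  have hHN : H * N * H' = g • N := by
    have h1 : N = P 1 - (1 + c) • 1 := by rw [hN, hE, add_smul, one_smul]; abel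
    have h2 : H * N * H' = P a - (1 + c) • 1 := by
      rw [h1, mul_sub, sub_mul, hHP]; simp [hHH2]
    have h3 : u = (1 - g) * c + 1 := by rw [hcv]; ring
    rw [h2, hug, hN, h3]
    ext x y
    simp only [Matrix.sub_apply, Matrix.add_apply, Matrix.smul_apply, smul_eq_mul]
    ring
  obtain ⟨htr, hrk⟩ := rank_one hij hjl hil N H H' g α β hNij hHH hgu ⟨v, hv⟩ hHN hq
  obtain ⟨w, hw⟩ := hNij
  have hww : N i j * (w⁻¹ : Sˣ) = 1 := by rw [← hw]; simp
  have hNv : N = vecMulVec (fun x => N x j * (w⁻¹ : Sˣ)) (fun y => N i y) := by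
    ext x y
    rw [vecMulVec_apply]
    linear_combination (w⁻¹ : Sˣ) * hrk x y - N x y * hww
  refine ⟨fun x => N x j * (w⁻¹ : Sˣ), fun y => N i y, hww, ?_, ?_, ?_, ?_, ?_⟩
  · intro x hx
    rw [map_mul, hNr]; simp [hx.symm]
  · rw [hNr]; simp
  · intro y hy
    rw [hNr]; simp [hy.symm]
  · rw [dotProduct, sum3 hij hjl hil]
    have e := hrk
    linear_combination htr - (w⁻¹ : Sˣ) * (hrk i i + hrk j j + hrk l l)
      + (N i i + N j j + N l l) * hww
  · intro r
    obtain ⟨u, g, h⟩ := key (P r) N ⟨w, hw⟩ (hPB r) (hPC r) hNB hNC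
    exact ⟨u, g, by rw [← hNv]; exact h⟩

theorem conj_lemma (πS : S →+* k) (hkerS : RingHom.ker πS = maximalIdeal S)
    (F Φ : ∀ i j : Fin 3, i ≠ j → Fin 3 → S)
    (hF1 : ∀ i j h, F i j h i = 1) (hF0 : ∀ i j h x, x ≠ i → πS (F i j h x) = 0)
    (hΦ1 : ∀ i j h, πS (Φ i j h j) = 1) (hΦ0 : ∀ i j h x, x ≠ j → πS (Φ i j h x) = 0)
    (hd : ∀ i j h, Φ i j h ⬝ᵥ F i j h = 0)
    (hrow : ∀ i j l (h : i ≠ j) (h' : i ≠ l),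
      vecMulVec (F i j h) (Φ i j h) * vecMulVec (F i l h') (Φ i l h')
      = vecMulVec (F i l h') (Φ i l h') * vecMulVec (F i j h) (Φ i j h))
    (hcol : ∀ i j l (h : i ≠ j) (h' : l ≠ j),
      vecMulVec (F i j h) (Φ i j h) * vecMulVec (F l j h') (Φ l j h')
      = vecMulVec (F l j h') (Φ l j h') * vecMulVec (F i j h) (Φ i j h)) :
    ∃ X : GL (Fin 3) S, (∀ x y, πS (X.val x y) = if x = y then 1 else 0) ∧
      ∀ i j (h : i ≠ j), ∃ w : S, vecMulVec (F i j h) (Φ i j h) * X.val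
        = X.val * (w • Matrix.single i j 1) := by
  have uΦ : ∀ i j h, IsUnit (Φ i j h j) := fun i j h =>
    unit_of πS hkerS (by rw [hΦ1]; exact one_ne_zero)
  have orow : ∀ i j l (h : i ≠ j) (h' : i ≠ l), j ≠ l → Φ i j h ⬝ᵥ F i l h' = 0 := by
    intro i j l h h' hjl
    have e := hrow i j l h h'
    rw [vecMulVec_mul_vecMulVec, vecMulVec_mul_vecMulVec] at e
    have e1 := congrFun (congrFun e i) l
    have e2 := congrFun (congrFun e i) j
    simp only [Matrix.smul_apply, vecMulVec_apply, hF1, Pi.smul_apply, smul_eq_mul, one_mul] at e1 e2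
    refine (two_by_two (t := Φ i l h' ⬝ᵥ F i j h) (uΦ i l h') (uΦ i j h) (β := - Φ i j h l)
      (γ := - Φ i l h' j) ?_ ?_ ?_).1
    · apply mem_of πS hkerS; rw [map_neg, hΦ0 _ _ _ _ hjl.symm, neg_zero]
    · linear_combination e1
    · linear_combination -e2
  have ocol : ∀ i j l (h : i ≠ j) (h' : l ≠ j), i ≠ l → Φ i j h ⬝ᵥ F l j h' = 0 := by
    intro i j l h h' hil
    have e := hcol i j l h h'
    rw [vecMulVec_mul_vecMulVec, vecMulVec_mul_vecMulVec] at e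
    have e1 := congrFun (congrFun e i) j
    have e2 := congrFun (congrFun e l) j
    simp only [Matrix.smul_apply, vecMulVec_apply, hF1, Pi.smul_apply, smul_eq_mul, one_mul] at e1 e2
    refine (two_by_two (t := Φ l j h' ⬝ᵥ F i j h) (uΦ l j h') (uΦ i j h)
      (β := - (F l j h' i * Φ i j h j)) (γ := - (F i j h l * Φ l j h' j)) ?_ ?_ ?_).1
    · apply mem_of πS hkerS; rw [map_neg, map_mul, hF0 _ _ _ _ hil]; simp
    · linear_combination e1
    · linear_combination -e2
  have hFF : ∀ i j l (h : i ≠ j) (h' : i ≠ l), F i j h = F i l h' := by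
    intro i j l h h'
    by_cases hjl : j = l
    · subst hjl; rfl
    have a1 := hd i j h
    have a2 := orow i j l h h' hjl
    have a3 := hd i l h'
    have a4 := orow i l j h' h (Ne.symm hjl)
    rw [dotProduct, sum3 h hjl h'] at a1 a2 a3 a4
    rw [hF1] at a1 a2 a3 a4
    obtain ⟨b1, b2⟩ := two_by_two (s := F i j h j - F i l h' j) (t := F i j h l - F i l h' l)
      (uΦ i j h) (uΦ i l h') (β := Φ i j h l) (γ := Φ i l h' j)
      (mem_of πS hkerS (hΦ0 _ _ _ _ (Ne.symm hjl)))
      (by linear_combination a1 - a2) (by linear_combination a4 - a3)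
    ext x
    rcases cases3 h hjl h' x with rfl | rfl | rfl
    · rw [hF1, hF1]
    · exact sub_eq_zero.1 b1
    · exact sub_eq_zero.1 b2
  have hnx : ∀ i : Fin 3, i ≠ i + 1 := by decide
  set X0 : Matrix (Fin 3) (Fin 3) S := Matrix.of fun x i => F i (i + 1) (hnx i) x with hX0
  have hX0r : ∀ x y, πS (X0 x y) = if x = y then 1 else 0 := by
    intro x y
    rw [hX0, Matrix.of_apply]
    split_ifs with h
    · subst h; rw [hF1, map_one]
    · exact hF0 _ _ _ _ h
  have hdet : IsUnit X0.det := by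
    apply unit_of πS hkerS
    have : πS.mapMatrix X0 = 1 := by
      ext x y
      rw [RingHom.mapMatrix_apply, Matrix.map_apply, hX0r, Matrix.one_apply]
    rw [RingHom.map_det, this]; simp
  refine ⟨Matrix.nonsingInvUnit X0 hdet, hX0r, ?_⟩
  intro i j h
  refine ⟨Φ i j h ⬝ᵥ F j (j + 1) (hnx j), ?_⟩
  change vecMulVec (F i j h) (Φ i j h) * X0 = X0 * _
  obtain ⟨l, hjl, hil⟩ := third h
  ext x y
  have lhs : (vecMulVec (F i j h) (Φ i j h) * X0) x y
      = F i j h x * (Φ i j h ⬝ᵥ F y (y + 1) (hnx y)) := by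
    simp only [Matrix.mul_apply, vecMulVec_apply, dotProduct, hX0, Matrix.of_apply, Finset.mul_sum,
      mul_assoc]
  have rhs : (X0 * ((Φ i j h ⬝ᵥ F j (j + 1) (hnx j)) • Matrix.single i j (1 : S))) x y
      = if j = y then F i (i + 1) (hnx i) x * (Φ i j h ⬝ᵥ F j (j + 1) (hnx j)) else 0 := by
    simp [Matrix.mul_apply, Matrix.single_apply, hX0, ite_and]
  rw [lhs, rhs]
  rcases cases3 h hjl hil y with rfl | rfl | rfl
  · rw [if_neg h.symm, hFF y (y + 1) j (hnx y) h, hd, mul_zero]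
  · rw [if_pos rfl, hFF i y (i + 1) h (hnx i)]
  · rw [if_neg hjl, hFF y (y + 1) j (hnx y) hjl.symm, ocol i j y h hjl.symm hil, mul_zero]
end root
section final
variable {k : Type*} [Field k] {R : Type*} [CommRing R] {S : Type*} [CommRing S] [IsLocalRing S]

theorem chev_val (ρ : SpecialLinearGroup (Fin 3) R →* GL (Fin 3) S) {i j l : Fin 3}
    (h : i ≠ j) (h' : j ≠ l) (h'' : i ≠ l) (r s : R) (u u' v v' t t' : S)
    (e : (ρ (el h r)).val = u • 1 + t • Matrix.single i j 1)
    (e' : (ρ (el h' s)).val = u' • 1 + t' • Matrix.single j l 1)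
    (hu : u * v = 1) (hu' : u' * v' = 1) :
    (ρ (el h'' (r * s))).val = 1 + Matrix.single i l (v * v' * t * t') := by
  have c := congrArg (fun g => (ρ g).val) (el_chev h h' h'' r s)
  simp only [map_mul, Units.val_mul] at c
  set K := (ρ (el h' s)).val * (ρ (el h r)).val with hK
  have hK1 : K = (u * u') • 1 + (u * t') • Matrix.single j l 1 + (u' * t) • Matrix.single i j 1 := by
    rw [hK, e, e']
    simp [mul_add, add_mul, Matrix.single_mul_single_of_ne, h''.symm, smul_smul]
  have hK2 : (1 + Matrix.single i l (v * v' * t * t')) * K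
      = (ρ (el h r)).val * (ρ (el h' s)).val := by
    rw [hK1, e, e']
    have q : v * v' * t * t' * (u * u') = t * t' := by
      linear_combination (t * t') * (u' * v') * hu + (t * t') * hu'
    simp [mul_add, add_mul, Matrix.single_mul_single_of_ne, h''.symm, h'.symm, h.symm, smul_smul,
      Matrix.smul_single]
    rw [mul_comm (u * u'), q, mul_comm u' u]
    abel
  have hKu : IsUnit K := by
    rw [hK, ← Units.val_mul]; exact Units.isUnit _
  rw [mul_assoc, ← hK, ← hK2] at c
  exact (hKu.mul_left_injective c).symm

theorem stage2 (πR : R →+* k) (πS : S →+* k) (hkerS : RingHom.ker πS = maximalIdeal S)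
    (ρ : SpecialLinearGroup (Fin 3) R →* GL (Fin 3) S)
    (hlift : ∀ (A : SpecialLinearGroup (Fin 3) R) (i j : Fin 3),
      πS ((ρ A : Matrix (Fin 3) (Fin 3) S) i j) = πR ((A : Matrix (Fin 3) (Fin 3) R) i j))
    (H : ∀ (i j : Fin 3) (h : i ≠ j) (r : R), ∃ u t : S,
      (ρ (el h r)).val = u • 1 + t • Matrix.single i j 1) :
    ∃ (f : R →+* S) (z : Fin 3 → Sˣ), (∀ r, πS (f r) = πR r) ∧ (∀ i, πS (z i) = 1) ∧
      ∀ (i j : Fin 3) (h : i ≠ j) (r : R),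
        (ρ (el h r)).val = 1 + Matrix.single i j (z i * f r * (z j)⁻¹ : S) := by
  have H1 : ∀ (i j : Fin 3) (h : i ≠ j) (r : R), ∃ t : S,
      (ρ (el h r)).val = 1 + Matrix.single i j t := by
    intro i l h'' r
    obtain ⟨j, h', h⟩ := third h''
    obtain ⟨u, t, e⟩ := H i j h r
    obtain ⟨u', t', e'⟩ := H j l h'.symm 1
    have hu : πS u = 1 := by
      have := hlift (el h r) l l
      rw [e, el_apply] at this
      simpa [h''] using this
    have hu' : πS u' = 1 := by
      have := hlift (el h'.symm (1 : R)) i i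
      rw [e', el_apply] at this
      simpa [h.symm] using this
    obtain ⟨w, hw⟩ := unit_of πS hkerS (x := u) (by rw [hu]; exact one_ne_zero)
    obtain ⟨w', hw'⟩ := unit_of πS hkerS (x := u') (by rw [hu']; exact one_ne_zero)
    have := chev_val ρ h h'.symm h'' r 1 u u' (w⁻¹ : Sˣ) (w'⁻¹ : Sˣ) t t' e e'
      (by rw [← hw]; simp) (by rw [← hw']; simp)
    rw [mul_one] at this
    exact ⟨_, this⟩
  choose T hT using H1
  have hTe : ∀ i j (h : i ≠ j) r, (ρ (el h r)).val i j = T i j h r := by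
    intro i j h r; rw [hT]; simp [h]
  have hTadd : ∀ i j (h : i ≠ j) r s, T i j h (r + s) = T i j h r + T i j h s := by
    intro i j h r s
    rw [← hTe, el_add, map_mul, Units.val_mul, hT, hT]
    simp [mul_add, add_mul, Matrix.single_mul_single_of_ne, h.symm, h]
  have hTm : ∀ i j l (h : i ≠ j) (h' : j ≠ l) (h'' : i ≠ l) r s,
      T i l h'' (r * s) = T i j h r * T j l h' s := by
    intro i j l h h' h'' r s
    have := chev_val ρ h h' h'' r s 1 1 1 1 (T i j h r) (T j l h' s)
      (by rw [hT]; simp [Matrix.smul_single]) (by rw [hT]; simp [Matrix.smul_single])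
      (one_mul 1) (one_mul 1)
    rw [← hTe, this]; simp [h'']
  have hTπ : ∀ i j (h : i ≠ j) r, πS (T i j h r) = πR r := by
    intro i j h r
    rw [← hTe, hlift, el_apply]; simp [h]
  have h01 : (0 : Fin 3) ≠ 1 := by decide
  have h02 : (0 : Fin 3) ≠ 2 := by decide
  have h12 : (1 : Fin 3) ≠ 2 := by decide
  have h10 := h01.symm
  have h20 := h02.symm
  have h21 := h12.symm
  have hGu : ∀ i j (h : i ≠ j), IsUnit (T i j h 1) := fun i j h =>
    unit_of πS hkerS (by rw [hTπ, map_one]; exact one_ne_zero)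
  obtain ⟨a, ha⟩ := hGu 0 1 h01
  obtain ⟨b, hb⟩ := hGu 0 2 h02
  obtain ⟨c, hc⟩ := hGu 1 2 h12
  have ml : ∀ i j l (h : i ≠ j) (h' : j ≠ l) (h'' : i ≠ l) r,
      T i l h'' r = T i j h r * T j l h' 1 := by
    intro i j l h h' h'' r; rw [← hTm i j l h h' h'', mul_one]
  have mr : ∀ i j l (h : i ≠ j) (h' : j ≠ l) (h'' : i ≠ l) r,
      T i l h'' r = T i j h 1 * T j l h' r := by
    intro i j l h h' h'' r; rw [← hTm i j l h h' h'', one_mul]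
  have g02 : (b : S) = a * c := by rw [ha, hb, hc]; exact ml 0 1 2 h01 h12 h02 1
  have g12 : (c : S) = T 1 0 h10 1 * b := by rw [hb, hc]; exact ml 1 0 2 h10 h02 h12 1
  have g01 : (a : S) = b * T 2 1 h21 1 := by rw [ha, hb]; exact ml 0 2 1 h02 h21 h01 1
  have g20 : T 2 0 h20 1 = T 2 1 h21 1 * T 1 0 h10 1 := ml 2 1 0 h21 h10 h20 1
  have g20b : T 2 0 h20 1 * b = 1 := by
    have : (b : S) * (T 2 0 h20 1 * b) = b * 1 := by
      rw [g20]
      linear_combination -(b * T 2 1 h21 1) * g12 - c * g01 - g02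
    exact b.isUnit.mul_left_cancel this
  have g21c : T 2 1 h21 1 * c = 1 := by
    linear_combination T 2 1 h21 1 * g12 + g20b - b * g20
  have p12 : ∀ r, T 1 2 h12 r * a = c * T 0 1 h01 r := by
    intro r
    have e1 := ml 0 1 2 h01 h12 h02 r
    have e2 := mr 0 1 2 h01 h12 h02 r
    rw [← hc] at e1
    rw [← ha] at e2
    linear_combination e1 - e2
  have p02 : ∀ r, T 0 2 h02 r * a = b * T 0 1 h01 r := by
    intro r
    have e1 := ml 0 1 2 h01 h12 h02 r
    rw [← hc] at e1
    linear_combination a * e1 - T 0 1 h01 r * g02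
  have p10 : ∀ r, T 1 0 h10 r * a = T 1 0 h10 1 * T 0 1 h01 r := by
    intro r
    have e1 := ml 1 0 2 h10 h02 h12 r
    rw [← hb] at e1
    have : (b : S) * (T 1 0 h10 r * a) = b * (T 1 0 h10 1 * T 0 1 h01 r) := by
      linear_combination -a * e1 + p12 r + T 0 1 h01 r * g12
    exact b.isUnit.mul_left_cancel this
  have p21 : ∀ r, T 2 1 h21 r * a = T 2 1 h21 1 * T 0 1 h01 r := by
    intro r
    have e1 := mr 0 2 1 h02 h21 h01 r
    rw [← hb] at e1
    linear_combination T 2 1 h21 r * g01 - T 2 1 h21 1 * e1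
  have p20 : ∀ r, T 2 0 h20 r * a = T 2 0 h20 1 * T 0 1 h01 r := by
    intro r
    have e1 := ml 2 0 1 h20 h01 h21 r
    have e2 := mr 2 0 1 h20 h01 h21 r
    rw [← ha] at e1
    linear_combination e2 - e1
  have hT0 : T 0 1 h01 0 = 0 := by
    have := hTadd 0 1 h01 0 0
    rw [add_zero] at this
    linear_combination -this
  have aa : (a : S) * (a⁻¹ : Sˣ) = 1 := by simp
  have cc : (c : S) * (c⁻¹ : Sˣ) = 1 := by simp
  have bb : (b : S) * (b⁻¹ : Sˣ) = 1 := by simp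
  let f : R →+* S :=
    { toFun := fun r => T 0 1 h01 r * (a⁻¹ : Sˣ)
      map_one' := by rw [← ha]; simp
      map_zero' := by rw [hT0]; simp
      map_add' := by intro r s; rw [hTadd]; ring
      map_mul' := by
        intro r s
        have e1 := ml 0 1 2 h01 h12 h02 (r * s)
        have e2 := hTm 0 1 2 h01 h12 h02 r s
        rw [← hc] at e1
        have : (c : S) * (T 0 1 h01 (r * s) * a) = c * (T 0 1 h01 r * T 0 1 h01 s) := by
          linear_combination a * (e2 - e1) + T 0 1 h01 r * p12 s
        have := c.isUnit.mul_left_cancel this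
        linear_combination ((a⁻¹ : Sˣ) : S) ^ 2 * this - T 0 1 h01 (r * s) * (a⁻¹ : Sˣ) * aa }
  have hf : ∀ r, f r = T 0 1 h01 r * (a⁻¹ : Sˣ) := fun r => rfl
  have hfa : ∀ r, f r * a = T 0 1 h01 r := by intro r; rw [hf]; simp
  have fin : ∀ {i j : Fin 3} (h : i ≠ j) (G : S) (r : R), T i j h r * a = G * T 0 1 h01 r →
      T i j h r = G * f r := by
    intro i j h G r e
    rw [← hfa, ← mul_assoc] at e
    exact a.isUnit.mul_right_cancel e
  refine ⟨f, ![b, c, 1], ?_, ?_, ?_⟩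
  · intro r
    have e1 := congrArg πS (hfa r)
    rw [map_mul, ha, hTπ, hTπ, map_one, mul_one] at e1
    exact e1
  · intro i
    fin_cases i
    · change πS (b : S) = 1; rw [hb, hTπ, map_one]
    · change πS (c : S) = 1; rw [hc, hTπ, map_one]
    · simp
  · intro i j h r
    rw [hT]
    congr 2
    fin_cases i <;> fin_cases j
    · exact absurd rfl h
    · change T 0 1 h01 r = b * f r * ((c⁻¹ : Sˣ) : S)
      rw [← hfa]
      linear_combination -(f r * (c⁻¹ : Sˣ)) * g02 - f r * a * cc
    · change T 0 2 h02 r = b * f r * (((1 : Sˣ)⁻¹ : Sˣ) : S)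
      rw [fin h02 _ r (p02 r)]; simp
    · change T 1 0 h10 r = c * f r * ((b⁻¹ : Sˣ) : S)
      rw [fin h10 _ r (p10 r)]
      linear_combination -(f r * (b⁻¹ : Sˣ)) * g12 - f r * T 1 0 h10 1 * bb
    · exact absurd rfl h
    · change T 1 2 h12 r = c * f r * (((1 : Sˣ)⁻¹ : Sˣ) : S)
      rw [fin h12 _ r (p12 r)]; simp
    · change T 2 0 h20 r = ((1 : Sˣ) : S) * f r * ((b⁻¹ : Sˣ) : S)
      rw [fin h20 _ r (p20 r), Units.val_one]
      linear_combination (f r * (b⁻¹ : Sˣ)) * g20b - f r * T 2 0 h20 1 * bb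
    · change T 2 1 h21 r = ((1 : Sˣ) : S) * f r * ((c⁻¹ : Sˣ) : S)
      rw [fin h21 _ r (p21 r), Units.val_one]
      linear_combination (f r * (c⁻¹ : Sˣ)) * g21c - f r * T 2 1 h21 1 * cc
    · exact absurd rfl h
end final
end SL3Lift

theorem sln_universal_lift_dim_three
    {k : Type*} [Field k] [Fintype k]
    {R : Type*} [CommRing R] [IsLocalRing R] [IsNoetherianRing R]
    [IsAdicComplete (maximalIdeal R) R]
    {S : Type*} [CommRing S] [IsLocalRing S] [IsArtinianRing S]
    (hk : 2 < Fintype.card k)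
    (πR : R →+* k) (hπR : Function.Surjective πR)
    (hkerR : RingHom.ker πR = maximalIdeal R)
    (πS : S →+* k) (hπS : Function.Surjective πS)
    (hkerS : RingHom.ker πS = maximalIdeal S)
    (ρ : SpecialLinearGroup (Fin 3) R →* GL (Fin 3) S)
    (hlift : ∀ (A : SpecialLinearGroup (Fin 3) R) (i j : Fin 3),
      πS ((ρ A : Matrix (Fin 3) (Fin 3) S) i j) = πR ((A : Matrix (Fin 3) (Fin 3) R) i j)) :
    ∃ (f : R →+* S) (X : GL (Fin 3) S),
      IsLocalHom f ∧
      (∀ r : R, πS (f r) = πR r) ∧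
      (∀ i j, (X : Matrix (Fin 3) (Fin 3) S) i j - (1 : Matrix (Fin 3) (Fin 3) S) i j ∈
        maximalIdeal S) ∧
      (∀ A : SpecialLinearGroup (Fin 3) R,
        (ρ A : Matrix (Fin 3) (Fin 3) S) =
          (X : Matrix (Fin 3) (Fin 3) S) * (A : Matrix (Fin 3) (Fin 3) R).map f *
            ((X⁻¹ : GL (Fin 3) S) : Matrix (Fin 3) (Fin 3) S)) := by
  classical
  obtain ⟨a, ha⟩ : ∃ a : Rˣ, πR a ≠ 1 := by
    obtain ⟨x, hx⟩ : ∃ x : k, x ∉ ({0, 1} : Finset k) := by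
      by_contra hcon
      push Not at hcon
      have h1 : (Finset.univ : Finset k) ⊆ {0, 1} := fun x _ => hcon x
      have h2 := Finset.card_le_card h1
      have h3 : ({0, 1} : Finset k).card ≤ 2 := Finset.card_le_two
      rw [Finset.card_univ] at h2
      omega
    simp only [Finset.mem_insert, Finset.mem_singleton, not_or] at hx
    obtain ⟨y, rfl⟩ := hπR x
    obtain ⟨a, rfl⟩ := SL3Lift.unit_of πR hkerR hx.1
    exact ⟨a, hx.2⟩
  choose F Φ hF1 hF0 hΦ1 hΦ0 hd hspan using
    fun (i j : Fin 3) (h : i ≠ j) => SL3Lift.root πR πS hkerS ρ hlift a ha h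
  have hcomm : ∀ (i j i' j' : Fin 3) (h : i ≠ j) (h' : i' ≠ j'),
      SL3Lift.el h (1 : R) * SL3Lift.el h' 1 = SL3Lift.el h' 1 * SL3Lift.el h 1 →
      vecMulVec (F i j h) (Φ i j h) * vecMulVec (F i' j' h') (Φ i' j' h')
      = vecMulVec (F i' j' h') (Φ i' j' h') * vecMulVec (F i j h) (Φ i j h) := by
    intro i j i' j' h h' e
    have unitg : ∀ (i j : Fin 3) (h : i ≠ j) (u g : S),
        (ρ (SL3Lift.el h 1)).val = u • 1 + g • vecMulVec (F i j h) (Φ i j h) → IsUnit g := by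
      intro i j h u g e
      apply SL3Lift.unit_of πS hkerS
      have := hlift (SL3Lift.el h 1) i j
      rw [e, SL3Lift.el_apply] at this
      simp [h, vecMulVec_apply, hF1, hΦ1] at this
      rw [this]; exact one_ne_zero
    obtain ⟨u, g, e1⟩ := hspan i j h 1
    obtain ⟨u', g', e2⟩ := hspan i' j' h' 1
    have ug := unitg i j h u g e1
    have ug' := unitg i' j' h' u' g' e2
    have c := congrArg (fun x => (ρ x).val) e
    simp only [map_mul, Units.val_mul] at c
    rw [e1, e2] at c
    set N := vecMulVec (F i j h) (Φ i j h)
    set N' := vecMulVec (F i' j' h') (Φ i' j' h')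
    have c2 : (g * g') • (N * N') = (g * g') • (N' * N) := by
      simp only [mul_add, add_mul, smul_mul_assoc, mul_smul_comm, mul_one, one_mul, smul_add,
        smul_smul] at c
      ext x y
      have := congrFun (congrFun c x) y
      simp only [Matrix.add_apply, Matrix.smul_apply, smul_eq_mul] at this ⊢
      linear_combination this
    exact (ug.mul ug').smul_left_cancel.1 c2
  obtain ⟨X, hX, hXN⟩ := SL3Lift.conj_lemma πS hkerS F Φ hF1 hF0 hΦ1 hΦ0 hd
    (fun i j l h h' => hcomm i j i l h h' (SL3Lift.el_comm_row h h' 1 1))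
    (fun i j l h h' => hcomm i j l j h h' (SL3Lift.el_comm_col h h' 1 1))
  have hXm : πS.mapMatrix X.val = 1 := by
    ext x y; rw [RingHom.mapMatrix_apply, Matrix.map_apply, hX, Matrix.one_apply]
  have hXm' : πS.mapMatrix (X⁻¹).val = 1 := by
    have h1 : πS.mapMatrix (X⁻¹).val * πS.mapMatrix X.val = 1 := by
      rw [← map_mul, ← Units.val_mul]; simp
    rwa [hXm, mul_one] at h1
  let σ : SpecialLinearGroup (Fin 3) R →* GL (Fin 3) S := (MulAut.conj X⁻¹).toMonoidHom.comp ρ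
  have hσ : ∀ A, σ A = X⁻¹ * ρ A * X := by
    intro A; simp [σ]
  have hσlift : ∀ (A : SpecialLinearGroup (Fin 3) R) (i j : Fin 3),
      πS ((σ A : Matrix (Fin 3) (Fin 3) S) i j) = πR ((A : Matrix (Fin 3) (Fin 3) R) i j) := by
    intro A i j
    have h1 : πS.mapMatrix (σ A).val = πS.mapMatrix (ρ A).val := by
      rw [hσ, Units.val_mul, Units.val_mul, map_mul, map_mul, hXm, hXm', one_mul, mul_one]
    have h2 := congrFun (congrFun h1 i) j
    rw [← hlift]
    exact h2
  obtain ⟨f, z, hf, hz, hfz⟩ := SL3Lift.stage2 πR πS hkerS σ hσlift (by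
    intro i j h r
    obtain ⟨u, g, e⟩ := hspan i j h r
    obtain ⟨w, hw⟩ := hXN i j h
    refine ⟨u, g * w, ?_⟩
    rw [hσ, Units.val_mul, Units.val_mul, e, mul_assoc, add_mul, smul_mul_assoc, smul_mul_assoc,
      hw, one_mul, mul_add, mul_smul_comm, mul_smul_comm, ← mul_assoc, ← Units.val_mul,
      inv_mul_cancel, Units.val_one, one_mul, smul_smul])
  let Z : GL (Fin 3) S :=
    ⟨diagonal fun i => (z i : S), diagonal fun i => ((z i)⁻¹ : Sˣ), by simp, by simp⟩
  let τ : SpecialLinearGroup (Fin 3) R →* GL (Fin 3) S :=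
    (MulAut.conj (X * Z)).toMonoidHom.comp
      (SpecialLinearGroup.toGL.comp (SpecialLinearGroup.map f))
  have hτ : ∀ A, τ A = X * Z * (SpecialLinearGroup.toGL (SpecialLinearGroup.map f A)) * (X * Z)⁻¹ := by
    intro A; rfl
  have hρτ : ρ = τ := by
    have htop : SL3Lift.E3 R = ⊤ := by
      rw [eq_top_iff]; intro A _; exact SL3Lift.gen A
    apply MonoidHom.eq_of_eqOn_dense htop
    rintro _ ⟨i, j, h, r, rfl⟩
    have h1 : σ (SL3Lift.el h r) =
        Z * (SpecialLinearGroup.toGL (SpecialLinearGroup.map f (SL3Lift.el h r))) * Z⁻¹ := by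
      apply Units.ext
      rw [hfz, Units.val_mul, Units.val_mul]
      have h2 : (SpecialLinearGroup.toGL (SpecialLinearGroup.map f (SL3Lift.el h r))).val
          = 1 + Matrix.single i j (f r) := by
        ext x y
        change f ((SL3Lift.el h r).1 x y) = _
        rw [SL3Lift.el_apply, Matrix.add_apply, Matrix.one_apply, Matrix.single_apply]
        split_ifs <;> simp
      rw [h2]
      change _ = diagonal (fun i => (z i : S)) * _ * diagonal (fun i => (((z i)⁻¹ : Sˣ) : S))
      rw [mul_add, add_mul, mul_one, diagonal_mul_diagonal]
      ext x y
      simp only [Matrix.add_apply, Matrix.mul_diagonal, Matrix.diagonal_mul, Matrix.single_apply,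
        Units.mul_inv, Matrix.diagonal_one]
      by_cases hxy : i = x ∧ j = y
      · obtain ⟨rfl, rfl⟩ := hxy
        simp
      · simp [hxy]
    rw [hσ] at h1
    rw [hτ]
    have h3 : ρ (SL3Lift.el h r) = X * (X⁻¹ * ρ (SL3Lift.el h r) * X) * X⁻¹ := by group
    rw [h3, h1]; group
  refine ⟨f, X * Z, ⟨?_⟩, hf, ?_, ?_⟩
  · intro r hr
    apply SL3Lift.unit_of πR hkerR
    rw [← hf]
    exact (hr.map πS).ne_zero
  · intro i j
    apply SL3Lift.mem_of πS hkerS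
    rw [Units.val_mul, map_sub]
    change πS ((X.val * diagonal (fun i => (z i : S))) i j) - _ = 0
    rw [Matrix.mul_diagonal, map_mul, hX, hz, Matrix.one_apply]
    split_ifs <;> simp
  · intro A
    rw [hρτ, hτ, Units.val_mul, Units.val_mul]
    rfl
end

section
/- Let k be a finite field, n ≥ 2, let R be a complete Noetherian local commutative ring with residue field k, and let S be a complete Noetherian local commutative ring with residue field k. Let ρ : SL_n(R) → GL_n(S) be a group homomorphism lifting the natural representation (i.e. π_S(ρ(A)(i,j)) = π_R(A(i,j)) for all A and i,j). Assume that for every pair of distinct indices a,b ∈ {1,…,n} and every r ∈ R there exists c ∈ S with ρ(t_ab^r) = t_ab^c. Then there exist a local ring homomorphism f : R → S with π_S ∘ f = π_R and a matrix X ∈ GL_n(S) with X ≡ I mod m_S such that ρ(A) = X · f(A) · X⁻¹ for all A ∈ SL_n(R), where f(A) denotes f applied entrywise. -/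
open Matrix IsLocalRing

namespace SLnLift

/-- Submonoid generated by elementary transvections. -/
def elem (n : ℕ) (R : Type*) [CommRing R] : Submonoid (Matrix (Fin n) (Fin n) R) :=
  Submonoid.closure {M | ∃ (a b : Fin n) (_ : a ≠ b) (r : R), M = transvection a b r}

variable {n : ℕ} {R : Type*} [CommRing R]

theorem trans_mem {a b : Fin n} (h : a ≠ b) (r : R) : transvection a b r ∈ elem n R :=
  Submonoid.subset_closure ⟨a, b, h, r, rfl⟩

theorem exists_inv {M : Matrix (Fin n) (Fin n) R} (hM : M ∈ elem n R) :
    ∃ N ∈ elem n R, N * M = 1 := by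
  induction hM using Submonoid.closure_induction with
  | mem x hx =>
    obtain ⟨a, b, h, r, rfl⟩ := hx
    exact ⟨transvection a b (-r), trans_mem h _, by
      rw [transvection_mul_transvection_same _ _ h]; simp⟩
  | one => exact ⟨1, one_mem _, by simp⟩
  | mul x y _ _ hx hy =>
    obtain ⟨N, hN, h1⟩ := hx
    obtain ⟨N', hN', h2⟩ := hy
    refine ⟨N' * N, mul_mem hN' hN, ?_⟩
    rw [mul_assoc, ← mul_assoc N, h1, one_mul, h2]

theorem mem_of_mul_left {M A : Matrix (Fin n) (Fin n) R} (hM : M ∈ elem n R)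
    (h : M * A ∈ elem n R) : A ∈ elem n R := by
  obtain ⟨N, hN, h1⟩ := exists_inv hM
  have := mul_mem hN h
  rwa [← mul_assoc, h1, one_mul] at this

theorem mem_of_mul_right {M A : Matrix (Fin n) (Fin n) R} (hM : M ∈ elem n R)
    (h : A * M ∈ elem n R) : A ∈ elem n R := by
  obtain ⟨N, hN, h1⟩ := exists_inv hM
  have := mul_mem h hN
  rwa [mul_assoc, mul_eq_one_comm.mp h1, mul_one] at this

theorem det_elem {M : Matrix (Fin n) (Fin n) R} (hM : M ∈ elem n R) : M.det = 1 := by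
  induction hM using Submonoid.closure_induction with
  | mem x hx =>
    obtain ⟨a, b, h, r, rfl⟩ := hx
    exact det_transvection_of_ne _ _ h _
  | one => simp
  | mul x y _ _ hx hy => rw [det_mul, hx, hy, one_mul]

theorem col_mem (i : Fin n) (v : Fin n → R) (t : Finset (Fin n)) (ht : i ∉ t) :
    1 + ∑ l ∈ t, single l i (v l) ∈ elem n R := by
  induction t using Finset.induction_on with
  | empty => simp
  | insert j t hj ih =>
    have hij : j ≠ i := by rintro rfl; simp at ht
    have h1 := mul_mem (ih (by simp at ht; tauto)) (trans_mem hij (v j))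
    convert h1 using 1
    rw [Finset.sum_insert hj, transvection, mul_add, mul_one, add_mul, one_mul, Finset.sum_mul]
    have : ∑ l ∈ t, single l i (v l) * single j i (v j) = 0 :=
      Finset.sum_eq_zero fun l _ => single_mul_single_of_ne _ _ _ _ hij.symm _
    rw [this]
    try simp
    abel

theorem row_mem (i : Fin n) (v : Fin n → R) (t : Finset (Fin n)) (ht : i ∉ t) :
    1 + ∑ l ∈ t, single i l (v l) ∈ elem n R := by
  induction t using Finset.induction_on with
  | empty => simp
  | insert j t hj ih =>
    have hij : j ≠ i := by rintro rfl; simp at ht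
    have h1 := mul_mem (trans_mem hij.symm (v j)) (ih (by simp at ht; tauto))
    convert h1 using 1
    rw [Finset.sum_insert hj, transvection, mul_add, mul_one, add_mul, one_mul, Finset.mul_sum]
    have : ∑ l ∈ t, single i j (v j) * single i l (v l) = 0 :=
      Finset.sum_eq_zero fun l _ => single_mul_single_of_ne _ _ _ _ hij _
    rw [this]
    try simp
    abel

theorem col_apply (i : Fin n) (v : Fin n → R) (A : Matrix (Fin n) (Fin n) R) (p q : Fin n) :
    ((1 + ∑ l ∈ Finset.univ.erase i, single l i (v l)) * A) p q =
      A p q + if p = i then 0 else v p * A i q := by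
  rw [add_mul, one_mul, Matrix.add_apply, Finset.sum_mul, Matrix.sum_apply]
  congr 1
  split_ifs with h
  · subst h
    refine Finset.sum_eq_zero fun l hl => ?_
    rw [single_mul_apply_of_ne]
    exact (Finset.ne_of_mem_erase hl).symm
  · rw [Finset.sum_eq_single p]
    · simp
    · intro l _ hl
      rw [single_mul_apply_of_ne]
      exact hl.symm
    · simp [h]

theorem row_apply (i : Fin n) (v : Fin n → R) (A : Matrix (Fin n) (Fin n) R) (p q : Fin n) :
    (A * (1 + ∑ l ∈ Finset.univ.erase i, single i l (v l))) p q =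
      A p q + if q = i then 0 else A p i * v q := by
  rw [mul_add, mul_one, Matrix.add_apply, Finset.mul_sum, Matrix.sum_apply]
  congr 1
  split_ifs with h
  · subst h
    refine Finset.sum_eq_zero fun l hl => ?_
    rw [mul_single_apply_of_ne]
    exact (Finset.ne_of_mem_erase hl).symm
  · rw [Finset.sum_eq_single q]
    · simp
    · intro l _ hl
      rw [mul_single_apply_of_ne]
      exact hl.symm
    · simp [h]

/-- agreement with the identity matrix on the rows and columns in `s` -/
def Good (s : Finset (Fin n)) (A : Matrix (Fin n) (Fin n) R) : Prop :=
  ∀ p q, (p ∈ s ∨ q ∈ s) → A p q = (1 : Matrix (Fin n) (Fin n) R) p q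

theorem Good.trans_mul {s : Finset (Fin n)} {A : Matrix (Fin n) (Fin n) R} (hA : Good s A)
    {a b : Fin n} (ha : a ∉ s) (hb : b ∉ s) (r : R) : Good s (transvection a b r * A) := by
  intro p q h
  by_cases hp : p = a
  · subst hp
    rw [transvection_mul_apply_same]
    have hq : q ∈ s := by tauto
    rw [hA p q h, hA b q (Or.inr hq), one_apply_ne (show b ≠ q by rintro rfl; tauto)]
    simp
  · rw [transvection_mul_apply_of_ne _ _ _ _ hp, hA p q h]

theorem generation [IsLocalRing R] (A : Matrix (Fin n) (Fin n) R) (hdet : A.det = 1) :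
    A ∈ elem n R := by
  suffices H : ∀ (m : ℕ) (s : Finset (Fin n)), sᶜ.card = m →
      ∀ A : Matrix (Fin n) (Fin n) R, A.det = 1 → Good s A → A ∈ elem n R from
    H _ ∅ rfl A hdet (by intro p q h; simp at h)
  intro m
  induction m with
  | zero =>
    intro s hs A _ hA
    have hs' : s = Finset.univ := by simpa using hs
    have : A = 1 := by ext p q; exact hA p q (by simp [hs'])
    rw [this]; exact one_mem _
  | succ m ih =>
    intro s hs A hdet hA
    obtain ⟨i, hi⟩ : sᶜ.Nonempty := by rw [← Finset.card_pos]; omega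
    have hi' : i ∉ s := by simpa using hi
    by_cases hone : sᶜ = {i}
    · have hmem : ∀ p, p ≠ i → p ∈ s := by
        intro p hp
        by_contra h
        have : p ∈ sᶜ := by simpa using h
        rw [hone] at this
        simp at this; exact hp this
      have hdiag : A = diagonal (fun p => A p p) := by
        ext p q
        by_cases hpq : p = q
        · subst hpq; simp
        · rw [diagonal_apply_ne _ hpq, hA p q, one_apply_ne hpq]
          by_cases h : p = i
          · right; apply hmem; rintro rfl; exact hpq h
          · left; exact hmem p h
      have hii : A i i = 1 := by
        rw [hdiag, det_diagonal, Finset.prod_eq_single i] at hdet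
        · exact hdet
        · intro p _ hp; rw [hA p p (Or.inl (hmem p hp)), one_apply_eq]
        · simp
      have : A = 1 := by
        ext p q
        by_cases h : p = i ∧ q = i
        · rw [h.1, h.2, hii, one_apply_eq]
        · apply hA
          by_cases hp : p = i
          · right; apply hmem; tauto
          · left; exact hmem p hp
      rw [this]; exact one_mem _
    -- step 3: corner entry equal to one
    have step3 : ∀ A : Matrix (Fin n) (Fin n) R, A.det = 1 → Good s A → A i i = 1 →
        A ∈ elem n R := by
      intro A hdet hA hii
      have hL := col_mem i (fun l => - A l i) (Finset.univ.erase i) (by simp)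
      have hU := row_mem i (fun l => - A i l) (Finset.univ.erase i) (by simp)
      refine mem_of_mul_left hL (mem_of_mul_right hU ?_)
      refine ih (insert i s) ?_ _ ?_ ?_
      · rw [Finset.compl_insert, Finset.card_erase_of_mem hi]; omega
      · rw [det_mul, det_mul, det_elem hL, det_elem hU, hdet]; simp
      · intro p q h
        rw [row_apply, col_apply, col_apply]
        by_cases hp : p = i
        · subst hp
          by_cases hq : q = p
          · subst hq; simp [hii]
          · rw [one_apply_ne (Ne.symm hq)]; simp [hii, hq]
        · by_cases hq : q = i
          · subst hq
            rw [one_apply_ne hp]; simp [hii, hp]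
          · simp only [hp, hq, if_false, hii]
            have h' : p ∈ s ∨ q ∈ s := by simpa [hp, hq] using h
            rw [hA p q h']
            rcases h' with h' | h'
            · rw [hA p i (Or.inl h'), one_apply_ne hp]; ring
            · rw [hA i q (Or.inr h'), one_apply_ne (Ne.symm hq)]; ring
    -- step 2: a unit below the corner
    have step2 : ∀ A : Matrix (Fin n) (Fin n) R, A.det = 1 → Good s A →
        ∀ j, j ≠ i → j ∉ s → IsUnit (A j i) → A ∈ elem n R := by
      intro A hdet hA j hj hjs hu
      obtain ⟨u, hu⟩ := hu
      have hT := trans_mem hj.symm ((1 - A i i) * (↑u⁻¹ : R))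
      refine mem_of_mul_left hT (step3 _ ?_ (hA.trans_mul hi' hjs _) ?_)
      · rw [det_mul, det_elem hT, hdet, one_mul]
      · rw [transvection_mul_apply_same, ← hu, mul_assoc, Units.inv_mul]; ring
    -- step 1: a unit in the column
    have step1 : ∃ l, IsUnit (A l i) := by
      by_contra hcon
      push Not at hcon
      have : A.det ∈ maximalIdeal R := by
        rw [det_apply]
        refine Ideal.sum_mem _ fun σ _ => ?_
        refine Submodule.smul_of_tower_mem _ _ ?_
        rw [← Finset.mul_prod_erase _ _ (Finset.mem_univ i)]
        exact Ideal.mul_mem_right _ _ ((mem_maximalIdeal _).2 (hcon _))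
      rw [hdet] at this
      exact (mem_maximalIdeal _).1 this isUnit_one
    obtain ⟨l, hl⟩ := step1
    have hls : l ∉ s := by
      intro hmem
      have hli : l ≠ i := by rintro rfl; exact hi' hmem
      rw [hA l i (Or.inl hmem), one_apply_ne hli] at hl
      exact not_isUnit_zero hl
    by_cases hli : l = i
    · subst hli
      obtain ⟨j, hj, hjl⟩ : ∃ j ∈ sᶜ, j ≠ l := by
        by_contra hcon
        push Not at hcon
        exact hone (Finset.eq_singleton_iff_unique_mem.2 ⟨hi, hcon⟩)
      have hjs : j ∉ s := by simpa using hj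
      by_cases hu : IsUnit (A j l)
      · exact step2 A hdet hA j hjl hjs hu
      · have hT := trans_mem hjl (1 : R)
        refine mem_of_mul_left hT (step2 _ ?_ (hA.trans_mul hjs hi' _) j hjl hjs ?_)
        · rw [det_mul, det_elem hT, hdet, one_mul]
        · rw [transvection_mul_apply_same, one_mul]
          by_contra hcon
          have h1 := Ideal.sub_mem _ ((mem_maximalIdeal _).2 hcon) ((mem_maximalIdeal _).2 hu)
          rw [add_sub_cancel_left] at h1
          exact (mem_maximalIdeal _).1 h1 hl
    · exact step2 A hdet hA l hli hls hl

/-- inclusion of a basis pair -/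
def inc (a b : Fin n) (R : Type*) [CommRing R] : Matrix (Fin n) (Fin 2) R :=
  fun p q => if p = ![a, b] q then 1 else 0

theorem inc_tmul {a b : Fin n} (h : a ≠ b) : (inc a b R)ᵀ * inc a b R = 1 := by
  have hne : ∀ c d : Fin n, c ≠ d →
      ∑ j : Fin n, (if j = c then (1 : R) else 0) * (if j = d then 1 else 0) = 0 := by
    intro c d hcd
    refine Finset.sum_eq_zero fun j _ => ?_
    by_cases hj : j = c
    · rw [if_neg (show j ≠ d by rw [hj]; exact hcd), mul_zero]
    · rw [if_neg hj, zero_mul]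
  have heq : ∀ c : Fin n,
      ∑ j : Fin n, (if j = c then (1 : R) else 0) * (if j = c then 1 else 0) = 1 := by
    intro c
    rw [Finset.sum_eq_single c]
    · simp
    · intro j _ hj
      rw [if_neg hj, zero_mul]
    · simp
  ext p q
  rw [mul_apply]
  fin_cases p <;> fin_cases q
  · exact heq a
  · exact hne a b h
  · exact hne b a h.symm
  · exact heq b

/-- block embedding of two by two matrices -/
def J (a b : Fin n) (M : Matrix (Fin 2) (Fin 2) R) : Matrix (Fin n) (Fin n) R :=
  1 + inc a b R * (M - 1) * (inc a b R)ᵀ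

theorem J_mul {a b : Fin n} (h : a ≠ b) (M N : Matrix (Fin 2) (Fin 2) R) :
    J a b M * J a b N = J a b (M * N) := by
  have key : inc a b R * (M - 1) * (inc a b R)ᵀ * (inc a b R * (N - 1) * (inc a b R)ᵀ) =
      inc a b R * ((M - 1) * (N - 1)) * (inc a b R)ᵀ := by
    simp only [Matrix.mul_assoc]
    rw [← Matrix.mul_assoc (inc a b R)ᵀ (inc a b R), inc_tmul h, Matrix.one_mul]
  have e : M * N - 1 = (M - 1) + (N - 1) + (M - 1) * (N - 1) := by noncomm_ring
  unfold J
  rw [add_mul, mul_add, mul_add, key, e, Matrix.mul_add, Matrix.mul_add, Matrix.add_mul,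
    Matrix.add_mul]
  simp
  abel

theorem J_inj {a b : Fin n} (h : a ≠ b) {M N : Matrix (Fin 2) (Fin 2) R}
    (e : J a b M = J a b N) : M = N := by
  have key : ∀ M : Matrix (Fin 2) (Fin 2) R,
      (inc a b R)ᵀ * (inc a b R * (M - 1) * (inc a b R)ᵀ) * inc a b R = M - 1 := by
    intro M
    simp only [Matrix.mul_assoc]
    rw [inc_tmul h, Matrix.mul_one, ← Matrix.mul_assoc, inc_tmul h, Matrix.one_mul]
  have e' := add_left_cancel e
  have := key M
  rw [e', key N] at this
  exact (sub_left_injective this).symm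

theorem J_upper (a b : Fin n) (r : R) : transvection a b r = J a b !![1, r; 0, 1] := by
  ext p q
  simp [transvection, J, inc, mul_apply, Fin.sum_univ_two, single_apply, one_apply]
  grind

theorem J_lower (a b : Fin n) (r : R) : transvection b a r = J a b !![1, 0; r, 1] := by
  ext p q
  simp [transvection, J, inc, mul_apply, Fin.sum_univ_two, single_apply, one_apply]
  grind

theorem comm_rel {a b c : Fin n} (hab : a ≠ b) (hbc : b ≠ c) (hac : a ≠ c) (r s : R) :
    transvection a b r * transvection b c s =
      transvection a c (r * s) * transvection b c s * transvection a b r := by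
  simp [transvection, mul_add, add_mul, hab, hbc, hac, hab.symm, hbc.symm, hac.symm]
  abel

theorem comm_rel_conv {a b c : Fin n} (hab : a ≠ b) (hbc : b ≠ c) (hac : a ≠ c) {r s t : R}
    (h : transvection a b r * transvection b c s =
      transvection a c t * transvection b c s * transvection a b r) : r * s = t := by
  rw [comm_rel hab hbc hac, mul_assoc, mul_assoc] at h
  have h2 : IsUnit (transvection b c s * transvection a b r) := by
    rw [isUnit_iff_isUnit_det, det_mul, det_transvection_of_ne _ _ hbc,
      det_transvection_of_ne _ _ hab]
    simp
  have h3 := congrFun₂ (h2.mul_right_cancel h) a c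
  simpa [transvection, hac] using h3

end SLnLift

open SLnLift in
/-- If a lift `ρ : SL_n(R) → GL_n(S)` of the natural representation sends
every elementary transvection `t_ab^r` (a ≠ b, r ∈ R) to an elementary transvection
`t_ab^c` for some `c ∈ S`, then `ρ` is conjugate (by a matrix `≡ I mod m_S`) to the
lift induced by a local ring homomorphism `f : R → S` compatible with the reductions. -/
theorem sln_lift_of_transvection_form
    {k : Type*} [Field k] [Fintype k]
    {R : Type*} [CommRing R] [IsLocalRing R] [IsNoetherianRing R]
    [IsAdicComplete (maximalIdeal R) R]
    {S : Type*} [CommRing S] [IsLocalRing S] [IsNoetherianRing S]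
    [IsAdicComplete (maximalIdeal S) S]
    (n : ℕ) (hn : 2 ≤ n)
    (πR : R →+* k) (hπR : Function.Surjective πR)
    (hkerR : RingHom.ker πR = maximalIdeal R)
    (πS : S →+* k) (hπS : Function.Surjective πS)
    (hkerS : RingHom.ker πS = maximalIdeal S)
    (ρ : SpecialLinearGroup (Fin n) R →* GL (Fin n) S)
    (hlift : ∀ (A : SpecialLinearGroup (Fin n) R) (i j : Fin n),
      πS ((ρ A : Matrix (Fin n) (Fin n) S) i j) = πR ((A : Matrix (Fin n) (Fin n) R) i j))
    (htrans : ∀ (a b : Fin n) (hab : a ≠ b) (r : R),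
      ∃ c : S,
        (ρ ⟨Matrix.transvection a b r, Matrix.det_transvection_of_ne a b hab r⟩ :
            Matrix (Fin n) (Fin n) S) = Matrix.transvection a b c) :
    ∃ (f : R →+* S) (X : GL (Fin n) S),
      IsLocalHom f ∧
      (∀ r : R, πS (f r) = πR r) ∧
      (∀ i j, (X : Matrix (Fin n) (Fin n) S) i j - (1 : Matrix (Fin n) (Fin n) S) i j ∈
        maximalIdeal S) ∧
      (∀ A : SpecialLinearGroup (Fin n) R,
        (ρ A : Matrix (Fin n) (Fin n) S) =
          (X : Matrix (Fin n) (Fin n) S) * (A : Matrix (Fin n) (Fin n) R).map f *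
            ((X⁻¹ : GL (Fin n) S) : Matrix (Fin n) (Fin n) S)) := by
  classical
  have hSL : ∀ A B : SpecialLinearGroup (Fin n) R,
      (A : Matrix (Fin n) (Fin n) R) = (B : Matrix (Fin n) (Fin n) R) → A = B :=
    fun A B h => Subtype.ext h
  choose φ' hφ' using htrans
  let φ : Fin n → Fin n → R → S := fun a b r => if h : a ≠ b then φ' a b h r else 0
  let T : ∀ a b : Fin n, a ≠ b → R → SpecialLinearGroup (Fin n) R := fun a b h r =>
    ⟨Matrix.transvection a b r, Matrix.det_transvection_of_ne a b h r⟩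
  have hT : ∀ a b (h : a ≠ b) r, (T a b h r : Matrix (Fin n) (Fin n) R) = transvection a b r :=
    fun _ _ _ _ => rfl
  have hφ : ∀ a b (h : a ≠ b) r,
      (ρ (T a b h r) : Matrix (Fin n) (Fin n) S) = transvection a b (φ a b r) := by
    intro a b h r
    simp only [φ, dif_pos h]
    exact hφ' a b h r
  clear_value φ T
  clear hφ'
  have hπ : ∀ a b, a ≠ b → ∀ r, πS (φ a b r) = πR r := by
    intro a b h r
    have := hlift (T a b h r) a b
    rw [hφ, hT] at this
    simpa [transvection, h] using this
  have hunit : ∀ s : S, πS s ≠ 0 → IsUnit s := by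
    intro s hs
    by_contra hcon
    have h1 : s ∈ maximalIdeal S := (mem_maximalIdeal _).2 hcon
    rw [← hkerS] at h1
    exact hs h1
  have hφu : ∀ a b, a ≠ b → ∀ r, IsUnit r → IsUnit (φ a b r) := by
    intro a b h r hr
    apply hunit
    rw [hπ a b h]
    exact (hr.map πR).ne_zero
  have hadd : ∀ a b, a ≠ b → ∀ r s, φ a b (r + s) = φ a b r + φ a b s := by
    intro a b h r s
    have e : T a b h (r + s) = T a b h r * T a b h s := by
      apply hSL
      rw [Matrix.SpecialLinearGroup.coe_mul]
      simp only [hT]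
      rw [transvection_mul_transvection_same _ _ h]
    have e' := congrArg (fun g => (ρ g : Matrix (Fin n) (Fin n) S)) e
    simp only [map_mul, Units.val_mul, hφ] at e'
    rw [transvection_mul_transvection_same _ _ h] at e'
    have := congrFun₂ e' a b
    simpa [transvection, h] using this
  have hneg : ∀ a b, a ≠ b → ∀ r, φ a b (-r) = - φ a b r := by
    intro a b h r
    have h0 := hadd a b h 0 0
    have h1 := hadd a b h r (-r)
    simp at h0
    rw [add_neg_cancel, h0] at h1
    linear_combination -h1
  -- conjugation relation
  have rel1 : ∀ a b, a ≠ b → ∀ u v r : R, u * v = 1 →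
      φ a b u * φ b a v = 1 ∧ φ b a v * φ a b r = φ b a (v * v * r) * φ a b u := by
    intro a b h u v r huv
    have main : ∀ r, (1 - φ a b u * φ b a v) * φ a b r = 0 ∧
        1 - φ b a v * φ a b r + (- φ a b u * φ b a v) =
          - φ b a (v * v * r) * (2 * φ a b u - φ a b u * φ a b u * φ b a v)
            + (1 - φ a b u * φ b a v) := by
      intro r
      have e : T a b h u * T b a h.symm (-v) * T a b h u * T a b h r =
          T b a h.symm (-(v * v * r)) * T a b h u * T b a h.symm (-v) * T a b h u := by
        apply hSL
        simp only [Matrix.SpecialLinearGroup.coe_mul, hT]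
        simp only [J_upper a b, J_lower a b, J_mul h]
        congr 1
        have hv : v * u = 1 := by rw [mul_comm]; exact huv
        ext p q
        fin_cases p <;> fin_cases q <;> simp [mul_apply, Fin.sum_univ_two] <;> grind
      have e' := congrArg (fun g => (ρ g : Matrix (Fin n) (Fin n) S)) e
      simp only [map_mul, Units.val_mul, hφ] at e'
      simp only [J_upper a b, J_lower a b, J_mul h] at e'
      have e2 := J_inj h e'
      simp only [hneg b a h.symm] at e2
      have e3 := congrFun₂ e2 0 1
      have e4 := congrFun₂ e2 1 1
      simp [mul_apply, Fin.sum_univ_two] at e3 e4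
      constructor
      · linear_combination e3
      · linear_combination e4
    have h1 : φ a b u * φ b a v = 1 := by
      have h2 := (main 1).1
      have h3 := (hφu a b h 1 isUnit_one).mul_left_eq_zero.1 h2
      linear_combination -h3
    refine ⟨h1, ?_⟩
    have h2 := (main r).2
    linear_combination -h2 - (φ b a (v * v * r) * φ a b u) * h1
  have hsym : ∀ a b, a ≠ b → ∀ r, φ b a 1 * φ a b r = φ b a r * φ a b 1 := by
    intro a b h r
    simpa using (rel1 a b h 1 1 r (by simp)).2
  have hone : ∀ a b, a ≠ b → φ a b 1 * φ b a 1 = 1 := by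
    intro a b h
    exact (rel1 a b h 1 1 1 (by simp)).1
  -- the diagonal torus
  have rel2 : ∀ a b, a ≠ b → ∀ u v : R, IsUnit u → IsUnit v →
      φ a b (u * v) = φ a b u * φ b a 1 * φ a b v := by
    intro a b h u v hu hv
    obtain ⟨u', hu'⟩ := hu.exists_right_inv
    obtain ⟨v', hv'⟩ := hv.exists_right_inv
    have W : ∀ {A : Type _} [CommRing A] (α β : A), α * β = 1 →
        J a b (!![1, α; 0, 1] * !![1, 0; -β, 1] * !![1, α; 0, 1]) = J a b !![0, α; -β, 0] := by
      intro A _ α β hαβ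
      congr 1
      ext p q
      fin_cases p <;> fin_cases q <;> simp [mul_apply, Fin.sum_univ_two] <;> grind
    have W' : ∀ {A : Type _} [CommRing A] (α β : A), α * β = 1 →
        J a b (!![1, α; 0, 1] * !![1, 0; -β, 1] * !![1, α; 0, 1]) = J a b !![0, α; -β, 0] := by
      intro A _ α β hαβ
      congr 1
      ext p q
      fin_cases p <;> fin_cases q <;> simp [mul_apply, Fin.sum_univ_two] <;> grind
    let w : R → R → SpecialLinearGroup (Fin n) R := fun x y =>
      T a b h x * T b a h.symm (-y) * T a b h x
    have hw : ∀ x y, x * y = 1 →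
        (w x y : Matrix (Fin n) (Fin n) R) = J a b !![0, x; -y, 0] := by
      intro x y hxy
      simp only [w, Matrix.SpecialLinearGroup.coe_mul, hT]
      simp only [J_upper a b, J_lower a b, J_mul h]
      exact W x y hxy
    have hρw : ∀ x y, x * y = 1 → (ρ (w x y) : Matrix (Fin n) (Fin n) S) =
        J a b !![0, φ a b x; -φ b a y, 0] := by
      intro x y hxy
      simp only [w, map_mul, Units.val_mul, hφ]
      simp only [J_upper a b, J_lower a b, J_mul h, hneg b a h.symm]
      exact W' _ _ (rel1 a b h x y 1 hxy).1
    have huv : (u * v) * (v' * u') = 1 := by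
      linear_combination (u * u') * hv' + hu'
    have h11 : (-1 : R) * -1 = 1 := by ring
    have e : w u u' * w (-1) (-1) * w v v' = w (u * v) (v' * u') := by
      apply hSL
      simp only [Matrix.SpecialLinearGroup.coe_mul]
      rw [hw _ _ hu', hw _ _ hv', hw _ _ huv, hw _ _ h11, J_mul h, J_mul h]
      congr 1
      ext p q
      fin_cases p <;> fin_cases q <;> simp [mul_apply, Fin.sum_univ_two]
      ring
    have e' := congrArg (fun g => (ρ g : Matrix (Fin n) (Fin n) S)) e
    simp only [map_mul, Units.val_mul] at e'
    rw [hρw _ _ hu', hρw _ _ hv', hρw _ _ huv, hρw _ _ h11, J_mul h, J_mul h] at e'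
    have e2 := congrFun₂ (J_inj h e') 0 1
    simp [mul_apply, Fin.sum_univ_two, hneg b a h.symm] at e2
    exact e2.symm
  have hmul : ∀ a b, a ≠ b → ∀ x y : R, φ a b (x * y) = φ a b x * φ b a 1 * φ a b y := by
    intro a b h
    have unit_or : ∀ x : R, IsUnit x ∨ IsUnit (1 + x) := by
      intro x
      by_contra hcon
      push Not at hcon
      have h1 := Ideal.sub_mem _ ((mem_maximalIdeal _).2 hcon.2) ((mem_maximalIdeal _).2 hcon.1)
      rw [add_sub_cancel_right] at h1
      exact (mem_maximalIdeal _).1 h1 isUnit_one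
    have half : ∀ x y : R, IsUnit x → φ a b (x * y) = φ a b x * φ b a 1 * φ a b y := by
      intro x y hx
      rcases unit_or y with hy | hy
      · exact rel2 a b h x y hx hy
      · have h1 := rel2 a b h x (1 + y) hx hy
        rw [mul_add, mul_one, hadd a b h, hadd a b h] at h1
        linear_combination h1 + φ a b x * hone a b h
    intro x y
    rcases unit_or x with hx | hx
    · exact half x y hx
    · have h1 := half (1 + x) y hx
      rw [add_mul, one_mul, hadd a b h, hadd a b h] at h1
      linear_combination h1 + φ a b y * hone a b h
  have hcomm : ∀ a b c, a ≠ b → b ≠ c → a ≠ c → ∀ r s,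
      φ a b r * φ b c s = φ a c (r * s) := by
    intro a b c hab hbc hac r s
    have e : T a b hab r * T b c hbc s = T a c hac (r * s) * T b c hbc s * T a b hab r := by
      apply hSL
      simp only [Matrix.SpecialLinearGroup.coe_mul, hT]
      exact comm_rel hab hbc hac r s
    have e' := congrArg (fun g => (ρ g : Matrix (Fin n) (Fin n) S)) e
    simp only [map_mul, Units.val_mul, hφ] at e'
    exact comm_rel_conv hab hbc hac e'
  -- the ring homomorphism and the conjugating diagonal matrix
  obtain ⟨i0, i1, h10⟩ : ∃ i0 i1 : Fin n, i1 ≠ i0 :=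
    ⟨⟨0, by omega⟩, ⟨1, by omega⟩, by simp⟩
  let f : R →+* S :=
    { toFun := fun r => φ i0 i1 1 * φ i1 i0 r
      map_one' := hone i0 i1 h10.symm
      map_mul' := fun x y => by rw [hmul i1 i0 h10]; ring
      map_zero' := by
        have h0 := hadd i1 i0 h10 0 0
        simp at h0
        simp [h0]
      map_add' := fun x y => by rw [hadd i1 i0 h10]; ring }
  have hf : ∀ r, f r = φ i0 i1 1 * φ i1 i0 r := fun _ => rfl
  have hfπ : ∀ r, πS (f r) = πR r := by
    intro r
    rw [hf, map_mul, hπ _ _ h10.symm, hπ _ _ h10, map_one, one_mul]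
  let d : Fin n → S := fun i => if i = i0 then 1 else φ i i0 1
  have hd0 : d i0 = 1 := by simp [d]
  have hd : ∀ i, i ≠ i0 → d i = φ i i0 1 := fun i hi => by simp [d, hi]
  have hdπ : ∀ i, πS (d i) = 1 := by
    intro i
    by_cases hi : i = i0
    · rw [hi, hd0, map_one]
    · rw [hd i hi, hπ _ _ hi, map_one]
  clear_value f d
  have hA : ∀ a, a ≠ i0 → ∀ r, φ a i0 r = φ a i0 1 * f r := by
    intro a ha r
    have h1 := hone i1 i0 h10
    by_cases ha1 : a = i1
    · subst ha1
      rw [hf]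
      linear_combination -φ a i0 r * h1
    · have h2 := hcomm a i1 i0 ha1 h10 ha 1 r
      have h3 := hcomm a i1 i0 ha1 h10 ha 1 1
      rw [one_mul] at h2 h3
      rw [hf, ← h2, ← h3]
      linear_combination -(φ a i1 1 * φ i1 i0 r) * h1
  have key : ∀ a b, a ≠ b → ∀ r, φ a b r * d b = d a * f r := by
    intro a b hab r
    by_cases hb : b = i0
    · subst hb
      rw [hd0, hd a hab, mul_one, hA a hab]
    · by_cases ha : a = i0
      · subst ha
        rw [hd0, hd b hb]
        have h1 := hsym b a hb r
        rw [hA b hb r] at h1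
        have h2 := hone b a hb
        linear_combination -h1 + f r * h2
      · rw [hd a ha, hd b hb, hcomm a b i0 hab hb ha, mul_one, hA a ha]
  have hXu : IsUnit (diagonal d : Matrix (Fin n) (Fin n) S) := by
    rw [isUnit_iff_isUnit_det]
    apply hunit
    rw [det_diagonal, map_prod]
    simp [hdπ]
  obtain ⟨X, hX⟩ := hXu
  have hall : ∀ M ∈ elem n R, ∃ A : SpecialLinearGroup (Fin n) R,
      (A : Matrix (Fin n) (Fin n) R) = M ∧
      (ρ A : Matrix (Fin n) (Fin n) S) * diagonal d = diagonal d * M.map f := by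
    intro M hM
    induction hM using Submonoid.closure_induction with
    | mem x hx =>
      obtain ⟨a, b, h, r, rfl⟩ := hx
      refine ⟨T a b h r, hT a b h r, ?_⟩
      rw [hφ]
      ext p q
      rw [mul_diagonal, diagonal_mul, map_apply]
      by_cases hpq : p = a ∧ q = b
      · obtain ⟨rfl, rfl⟩ := hpq
        simpa [transvection, h] using key p q h r
      · have h' : ¬ (a = p ∧ b = q) := by
          rintro ⟨rfl, rfl⟩; exact hpq ⟨rfl, rfl⟩
        simp only [transvection, Matrix.add_apply, single_apply, if_neg h', add_zero]
        by_cases e : p = q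
        · subst e; simp
        · simp [one_apply_ne e]
    | one => exact ⟨1, by simp, by simp⟩
    | mul x y _ _ hx hy =>
      obtain ⟨A, hA1, hA2⟩ := hx
      obtain ⟨B, hB1, hB2⟩ := hy
      refine ⟨A * B, by rw [Matrix.SpecialLinearGroup.coe_mul, hA1, hB1], ?_⟩
      rw [map_mul, Units.val_mul, mul_assoc, hB2, ← mul_assoc, hA2, Matrix.map_mul, mul_assoc]
  refine ⟨f, X, ⟨?_⟩, hfπ, ?_, ?_⟩
  · intro r hr
    by_contra hcon
    have h1 : r ∈ maximalIdeal R := (mem_maximalIdeal _).2 hcon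
    rw [← hkerR] at h1
    have h2 : πR r = 0 := h1
    rw [← hfπ] at h2
    exact (hr.map πS).ne_zero h2
  · intro i j
    rw [hX, ← hkerS]
    change πS _ = 0
    by_cases e : i = j
    · subst e; simp [hdπ]
    · simp [e]
  · intro A
    obtain ⟨B, hB1, hB2⟩ := hall _ (generation _ A.det_coe)
    have hBA := hSL _ _ hB1
    subst hBA
    rw [Units.eq_mul_inv_iff_mul_eq, hX]
    exact hB2
end

section
/- Let k be a finite field, let R be a complete Noetherian local commutative ring with residue field k and reduction π_R : R → k, let G be a group, let ρ̄ : G → GL_n(k) be a group homomorphism, and let ρ : G → GL_n(R) be a group homomorphism with π_R(ρ(g)(i,j)) = ρ̄(g)(i,j) for all g ∈ G and all i,j. Assume that every matrix M ∈ M_n(k) satisfying M·ρ̄(g) = ρ̄(g)·M for all g ∈ G is a scalar matrix. Then every matrix X ∈ M_n(R) satisfying X·ρ(g) = ρ(g)·X for all g ∈ G is a scalar matrix, i.e. X = λ·I for some λ ∈ R. -/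
open Matrix IsLocalRing

/-- If the reduction `ρ̄` of the lift `ρ` has only scalar centralizer in
`M_n(k)`, then every matrix in `M_n(R)` commuting with the image of `ρ` is scalar. -/
theorem centralizer_of_lift_is_scalar
    {k : Type*} [Field k] [Fintype k]
    {R : Type*} [CommRing R] [IsLocalRing R] [IsNoetherianRing R]
    [IsAdicComplete (maximalIdeal R) R]
    (πR : R →+* k) (hπR : Function.Surjective πR)
    (hkerR : RingHom.ker πR = maximalIdeal R)
    {G : Type*} [Group G] (n : ℕ)
    (ρbar : G →* GL (Fin n) k) (ρ : G →* GL (Fin n) R)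
    (hlift : ∀ (g : G) (i j : Fin n),
      πR ((ρ g : Matrix (Fin n) (Fin n) R) i j) = (ρbar g : Matrix (Fin n) (Fin n) k) i j)
    (hcent : ∀ M : Matrix (Fin n) (Fin n) k,
      (∀ g : G, M * (ρbar g : Matrix (Fin n) (Fin n) k) =
        (ρbar g : Matrix (Fin n) (Fin n) k) * M) →
      ∃ lam : k, M = lam • (1 : Matrix (Fin n) (Fin n) k))
    (X : Matrix (Fin n) (Fin n) R)
    (hX : ∀ g : G, X * (ρ g : Matrix (Fin n) (Fin n) R) =
      (ρ g : Matrix (Fin n) (Fin n) R) * X) :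
    ∃ lam : R, X = lam • (1 : Matrix (Fin n) (Fin n) R) := by
  rcases Nat.eq_zero_or_pos n with hn | hn
  · subst hn
    exact ⟨0, Subsingleton.elim _ _⟩
  let i0 : Fin n := ⟨0, hn⟩
  refine ⟨X i0 i0, ?_⟩
  rw [← sub_eq_zero]
  set Z := X - X i0 i0 • (1 : Matrix (Fin n) (Fin n) R) with hZdef
  have hZ0 : Z i0 i0 = 0 := by simp [hZdef]
  have hZ : ∀ g : G, Z * (ρ g : Matrix (Fin n) (Fin n) R) =
      (ρ g : Matrix (Fin n) (Fin n) R) * Z := by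
    intro g
    simp [hZdef, sub_mul, mul_sub, hX g]
  have hρ : ∀ g : G, (ρ g : Matrix (Fin n) (Fin n) R).map πR = ρbar g := by
    intro g; ext i j; exact hlift g i j
  -- functionals on matrices over `k` that lift to functionals killing `Z`
  let S : Submodule k (Module.Dual k (Matrix (Fin n) (Fin n) k)) :=
    { carrier := {φ | ∃ Φ : Matrix (Fin n) (Fin n) R →ₗ[R] R, Φ Z = 0 ∧
        ∀ Y, πR (Φ Y) = φ (Y.map πR)}
      zero_mem' := ⟨0, by simp, by simp⟩
      add_mem' := by
        rintro φ ψ ⟨Φ, h1, h2⟩ ⟨Ψ, h3, h4⟩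
        exact ⟨Φ + Ψ, by simp [h1, h3], fun Y => by simp [h2, h4]⟩
      smul_mem' := by
        rintro c φ ⟨Φ, h1, h2⟩
        obtain ⟨r, rfl⟩ := hπR c
        exact ⟨r • Φ, by simp [h1], fun Y => by simp [h2]⟩ }
  have hS : S = ⊤ := by
    have hco : S.dualCoannihilator = ⊥ := by
      rw [eq_bot_iff]
      intro M hM
      rw [Submodule.mem_dualCoannihilator] at hM
      have hM0 : M i0 i0 = 0 :=
        hM (Matrix.entryLinearMap k k i0 i0)
          ⟨Matrix.entryLinearMap R R i0 i0, by simpa using hZ0, fun Y => by simp⟩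
      obtain ⟨lam, rfl⟩ := hcent M (by
        intro g
        ext a b
        have := hM (Matrix.entryLinearMap k k a b ∘ₗ
            (LinearMap.mulRight k (ρbar g : Matrix (Fin n) (Fin n) k) -
              LinearMap.mulLeft k (ρbar g : Matrix (Fin n) (Fin n) k)))
          ⟨Matrix.entryLinearMap R R a b ∘ₗ
            (LinearMap.mulRight R (ρ g : Matrix (Fin n) (Fin n) R) -
              LinearMap.mulLeft R (ρ g : Matrix (Fin n) (Fin n) R)),
            by simp [hZ g], fun Y => by
              simp [← hρ g, Matrix.mul_apply]⟩
        simpa [sub_eq_zero] using this)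
      have : lam = 0 := by simpa using hM0
      simp [this]
    have := Subspace.dualCoannihilator_dualAnnihilator_eq (W := S)
    rw [← this, hco]
    simp
  let I : Ideal R := Ideal.span (Set.range fun p : Fin n × Fin n => Z p.1 p.2)
  have hmem : ∀ a b, Z a b ∈ I := fun a b => Ideal.subset_span ⟨(a, b), rfl⟩
  have hI : I = ⊥ := by
    apply Submodule.eq_bot_of_le_smul_of_le_jacobson_bot (maximalIdeal R) I
    · exact Submodule.fg_span (Set.finite_range _)
    · refine Ideal.span_le.2 ?_
      rintro _ ⟨⟨a, b⟩, rfl⟩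
      obtain ⟨Φ, h1, h2⟩ : Matrix.entryLinearMap k k a b ∈ S := hS ▸ Submodule.mem_top
      let Ψ := Matrix.entryLinearMap R R a b - Φ
      have hΨ : ∀ Y, Ψ Y ∈ maximalIdeal R := by
        intro Y
        rw [← hkerR, RingHom.mem_ker]
        simp [Ψ, h2]
      have e : Z a b = Ψ Z := by simp [Ψ, h1]
      show Z a b ∈ maximalIdeal R • I
      rw [e, Matrix.matrix_eq_sum_single Z, map_sum]
      refine Submodule.sum_mem _ fun i _ => ?_
      rw [map_sum]
      refine Submodule.sum_mem _ fun j _ => ?_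
      have e2 : Matrix.single i j (Z i j) = Z i j • Matrix.single i j (1 : R) := by simp
      rw [e2, map_smul, smul_eq_mul (Z i j), mul_comm (Z i j)]
      exact Ideal.mul_mem_mul (hΨ _) (hmem i j)
    · exact (IsLocalRing.jacobson_eq_maximalIdeal ⊥ bot_ne_top).ge
  ext a b
  have := hmem a b
  rw [hI] at this
  simpa using this
end

section
/- Let R be a commutative ring and let f : ℕ → R[X] be the sequence of polynomials determined by f 0 = 0, f 1 = 1 and f (n+2) = X·f (n+1) − f n for all n. Let M be a 2×2 matrix over R with det M = 1 such that at least one of its two off-diagonal entries is not a zero divisor in R. If n = 2k+1 is an odd positive integer, then M^n = −I holds if and only if the trace t of M is a root of the polynomial f (k+1) − f k, i.e. (f (k+1) − f k) evaluated at t is 0. -/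
open Matrix Polynomial

/-- For the Chebyshev-like polynomials `f 0 = 0`, `f 1 = 1`,
`f (n+2) = X·f (n+1) − f n`, a matrix `M ∈ M_2(R)` with `det M = 1` whose off-diagonal
entries include a non-zero-divisor satisfies `M^(2k+1) = −I` iff `tr M` is a root of
`f (k+1) − f k`. -/
theorem matrix_odd_power_eq_neg_one_iff_chebyshev
    {R : Type*} [CommRing R] (f : ℕ → Polynomial R)
    (hf0 : f 0 = 0) (hf1 : f 1 = 1)
    (hrec : ∀ n : ℕ, f (n + 2) = Polynomial.X * f (n + 1) - f n)
    (M : Matrix (Fin 2) (Fin 2) R) (hdet : M.det = 1)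
    (hoff : (∀ s : R, M 0 1 * s = 0 → s = 0) ∨ (∀ s : R, M 1 0 * s = 0 → s = 0))
    (k : ℕ) :
    M ^ (2 * k + 1) = -1 ↔ (f (k + 1) - f k).eval M.trace = 0 := by
  obtain ⟨g, hg⟩ : ∃ g : ℕ → R, ∀ n, g n = (f n).eval M.trace := ⟨_, fun _ => rfl⟩
  set t := M.trace with ht
  have g0 : g 0 = 0 := by simp [hg, hf0]
  have g1 : g 1 = 1 := by simp [hg, hf1]
  have gr : ∀ n, g (n + 2) = t * g (n + 1) - g n := by
    intro n; simp [hg, hrec]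
  have hCH : M * M = t • M - (1 : R) • (1 : Matrix (Fin 2) (Fin 2) R) := by
    rw [Matrix.det_fin_two] at hdet
    rw [Matrix.trace_fin_two] at ht
    ext i j
    fin_cases i <;> fin_cases j <;> simp [Matrix.mul_apply, Fin.sum_univ_two, ht] <;>
      first | ring1 | linear_combination hdet | linear_combination (-1 : R) * hdet
  have hpow : ∀ n, M ^ (n + 1) = g (n + 1) • M - g n • (1 : Matrix (Fin 2) (Fin 2) R) := by
    intro n
    induction n with
    | zero => simp [g0, g1]
    | succ n ih =>
      rw [pow_succ, ih, sub_mul, smul_mul_assoc, hCH, gr, smul_mul_assoc, one_mul]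
      module
  have hinv : ∀ n, g (n + 1) ^ 2 - t * g (n + 1) * g n + g n ^ 2 = 1 := by
    intro n
    induction n with
    | zero => simp [g0, g1]
    | succ n ih => rw [gr]; linear_combination ih
  have hdbl : ∀ n, g (2 * n + 1) = g (n + 1) ^ 2 - g n ^ 2 ∧
      g (2 * n) = 2 * g (n + 1) * g n - t * g n ^ 2 := by
    intro n
    induction n with
    | zero => simp [g0, g1]
    | succ n ih =>
      obtain ⟨h1, h2⟩ := ih
      have e1 : g (2 * (n + 1)) = t * g (2 * n + 1) - g (2 * n) := gr (2 * n)
      have e2 : g (2 * (n + 1) + 1) = t * g (2 * (n + 1)) - g (2 * n + 1) := gr (2 * n + 1)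
      rw [e2, e1, gr n, h1, h2]
      constructor <;> ring
  obtain ⟨hd1, hd2⟩ := hdbl k
  have hi := hinv k
  rw [Polynomial.eval_sub, ← hg, ← hg, hpow]
  generalize g (k + 1) = a at *
  generalize g k = b at *
  constructor
  · intro h
    have hz : g (2 * k + 1) = 0 := by
      rcases hoff with ho | ho
      · apply ho
        have := congrFun (congrFun h 0) 1
        simpa [mul_comm] using this
      · apply ho
        have := congrFun (congrFun h 1) 0
        simpa [mul_comm] using this
    have ho : g (2 * k) = 1 := by
      have := congrFun (congrFun h 0) 0
      simpa [hz] using this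
    rw [hz] at hd1
    rw [ho] at hd2
    have hb : (a - b) * (2 + t) * b = 0 := by
      linear_combination -hd2 - hi - hd1
    linear_combination (a - b) * hd2 - 2 * b * hd1 - b * hb
  · intro h
    have hab : a = b := sub_eq_zero.mp h
    subst hab
    have hz : g (2 * k + 1) = 0 := by rw [hd1]; ring
    have ho : g (2 * k) = 1 := by rw [hd2]; linear_combination hi
    rw [hz, ho]; simp
end

section
/- Let O := ℤ₅[X]/(X²−5), with the ring homomorphism π : O → F₅ induced by reduction modulo 5 on ℤ₅ and by sending the class of X to 0. Then there exists a group homomorphism ρ₀ : SL_2(F₅) → GL_2(O) with π(ρ₀(M)(a,b)) = M(a,b) for all M and a,b, having the following universal property: for every Artinian local commutative ring S with residue field F₅ (with reduction π_S : S → F₅) and every group homomorphism ρ : SL_2(F₅) → GL_2(S) satisfying π_S(ρ(M)(a,b)) = M(a,b) for all M, a, b, there exist a unique local ring homomorphism f : O → S with π_S ∘ f = π and a matrix X ∈ GL_2(S) with X ≡ I mod m_S such that ρ(M) = X · f(ρ₀(M)) · X⁻¹ for all M ∈ SL_2(F₅), where f is applied entrywise. -/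
open Matrix IsLocalRing

instance : Fact (Nat.Prime 5) := ⟨by norm_num⟩

/-- The ring `O = ℤ₅[√5] = ℤ₅[X]/(X² − 5)`. -/
noncomputable abbrev Z5sqrt5 : Type :=
  AdjoinRoot (Polynomial.X ^ 2 - 5 : Polynomial ℤ_[5])

/-- The reduction `π : ℤ₅[√5] → F₅`, induced by reduction mod 5 on `ℤ₅` and sending
the class of `X` to `0`. -/
noncomputable def Z5sqrt5.toZMod : Z5sqrt5 →+* ZMod 5 :=
  AdjoinRoot.lift PadicInt.toZMod (0 : ZMod 5) (by
    simp [Polynomial.eval₂_sub, Polynomial.eval₂_pow]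
    decide)


/-! ### A computable model of the icosians (scaled) -/

abbrev SL25 := SpecialLinearGroup (Fin 2) (ZMod 5)

abbrev Qt : Type := (ℤ√5) × (ℤ√5) × (ℤ√5) × (ℤ√5)

def qmul (x y : Qt) : Qt :=
  (x.1 * y.1 - x.2.1 * y.2.1 - x.2.2.1 * y.2.2.1 - x.2.2.2 * y.2.2.2,
   x.1 * y.2.1 + x.2.1 * y.1 + x.2.2.1 * y.2.2.2 - x.2.2.2 * y.2.2.1,
   x.1 * y.2.2.1 - x.2.1 * y.2.2.2 + x.2.2.1 * y.1 + x.2.2.2 * y.2.1,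
   x.1 * y.2.2.2 + x.2.1 * y.2.2.1 - x.2.2.1 * y.2.1 + x.2.2.2 * y.1)

/-- multiplication by an integer -/
def qsc (n : ℤ√5) (x : Qt) : Qt := (n * x.1, n * x.2.1, n * x.2.2.1, n * x.2.2.2)

/-- `4 U` -/
def qU : Qt := (⟨-1, 1⟩, 0, ⟨2, 0⟩, ⟨1, 1⟩)
/-- `4 U²` -/
def qU2 : Qt := (⟨-1, -1⟩, 0, ⟨-1, 1⟩, ⟨2, 0⟩)
def qconj (x : Qt) : Qt := (x.1, -x.2.1, -x.2.2.1, -x.2.2.2)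

def qupow (x : ZMod 5) : Qt :=
  if x = 0 then (⟨4, 0⟩, 0, 0, 0) else if x = 1 then qU else if x = 2 then qU2
  else if x = 3 then qconj qU2 else qconj qU

def qh (t : ZMod 5) : Qt :=
  if t = 1 then (1, 0, 0, 0) else if t = 2 then (0, 1, 0, 0)
  else if t = 4 then (-1, 0, 0, 0) else (0, -1, 0, 0)

/-- inverse in `F₅` -/
def inv5 (c : ZMod 5) : ZMod 5 := c * c * c

def qq (a b c d : ZMod 5) : Qt :=
  if c = 0 then qsc ⟨4, 0⟩ (qmul (qh a) (qupow (b * inv5 a)))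
  else qmul (qmul (qupow (a * inv5 c)) (qmul (qh (- inv5 c)) (0, 0, 1, 0))) (qupow (d * inv5 c))

theorem qq_u : ∀ a b c d : ZMod 5, a * d - b * c = 1 →
    qsc ⟨16, 0⟩ (qq (a + c) (b + d) c d) = qmul (qq 1 1 0 1) (qq a b c d) := by
  decide +kernel

theorem qq_w : ∀ a b c d : ZMod 5, a * d - b * c = 1 →
    qsc ⟨16, 0⟩ (qq c d (-a) (-b)) = qmul (qq 0 1 (-1) 0) (qq a b c d) := by
  decide +kernel

theorem qq_h : ∀ a b c d : ZMod 5, a * d - b * c = 1 →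
    qsc ⟨16, 0⟩ (qq (2 * a) (2 * b) (3 * c) (3 * d)) = qmul (qq 2 0 0 3) (qq a b c d) := by
  decide +kernel

theorem qq_red : ∀ a b c d : ZMod 5, a * d - b * c = 1 →
    let x := qq a b c d
    (x.1.re + 2 * x.2.1.re : ZMod 5) = a ∧ (x.2.2.1.re + 2 * x.2.2.2.re : ZMod 5) = b ∧
    (- x.2.2.1.re + 2 * x.2.2.2.re : ZMod 5) = c ∧ (x.1.re - 2 * x.2.1.re : ZMod 5) = d := by
  decide +kernel

def gu : SL25 := ⟨!![1, 1; 0, 1], by decide⟩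
def gw : SL25 := ⟨!![0, 1; -1, 0], by decide⟩
def gh : SL25 := ⟨!![2, 0; 0, 3], by decide⟩

/-- discrete logarithm to base `2` in `F₅` -/
def dlog (t : ZMod 5) : ℕ :=
  if t = 1 then 0 else if t = 2 then 1 else if t = 4 then 2 else 3

theorem gen_aux1 : ∀ a b d : ZMod 5, a * d - b * 0 = 1 →
    !![a, b; 0, d] = (gh ^ dlog a * gu ^ (b * inv5 a).val : SL25).1 := by
  decide +kernel

theorem gen_aux2 : ∀ a c : ZMod 5, ∀ d b : ZMod 5, c ≠ 0 → a * d - b * c = 1 →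
    !![a, b; c, d] = (gu ^ (a * inv5 c).val *
      (gh ^ dlog (-inv5 c) * (gw * gu ^ (d * inv5 c).val)) : SL25).1 := by
  decide +kernel

theorem gen_aux (a b c d : ZMod 5) (h : a * d - b * c = 1) :
    ∃ x y e : ℕ,
      !![a, b; c, d] = (gu ^ x * (gh ^ e * (gw * gu ^ y)) : SL25).1 ∨
      !![a, b; c, d] = (gh ^ e * gu ^ y : SL25).1 := by
  by_cases hc : c = 0
  · subst hc
    exact ⟨0, _, _, Or.inr (gen_aux1 a b d h)⟩
  · exact ⟨_, _, _, Or.inl (gen_aux2 a c d b hc h)⟩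

theorem gen_ind (P : SL25 → Prop) (h1 : P 1) (hu : ∀ M, P M → P (gu * M))
    (hw : ∀ M, P M → P (gw * M)) (hh : ∀ M, P M → P (gh * M)) (M : SL25) : P M := by
  have hup : ∀ (n : ℕ) M, P M → P (gu ^ n * M) := by
    intro n
    induction n with
    | zero => intro M h; simpa using h
    | succ n ih => intro M h; rw [pow_succ', mul_assoc]; exact hu _ (ih _ h)
  have hhp : ∀ (n : ℕ) M, P M → P (gh ^ n * M) := by
    intro n
    induction n with
    | zero => intro M h; simpa using h
    | succ n ih => intro M h; rw [pow_succ', mul_assoc]; exact hh _ (ih _ h)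
  have hup1 : ∀ n : ℕ, P (gu ^ n) := fun n => by simpa using hup n 1 h1
  have hdet : M.1 0 0 * M.1 1 1 - M.1 0 1 * M.1 1 0 = 1 := by
    have := M.2; rwa [Matrix.det_fin_two] at this
  obtain ⟨x, y, e, h | h⟩ := gen_aux _ _ _ _ hdet
  · have : M = gu ^ x * (gh ^ e * (gw * gu ^ y)) := by
      apply Subtype.ext; rw [← h]; exact Matrix.eta_fin_two _
    rw [this]; exact hup _ _ (hhp _ _ (hw _ (hup1 _)))
  · have : M = gh ^ e * gu ^ y := by
      apply Subtype.ext; rw [← h]; exact Matrix.eta_fin_two _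
    rw [this]; exact hhp _ _ (hup1 _)

/-! ### The universal lift -/

theorem unit_of_toZMod_padic (x : ℤ_[5]) (h : PadicInt.toZMod x ≠ 0) : IsUnit x := by
  by_contra hx
  apply h
  rw [← RingHom.mem_ker, PadicInt.ker_toZMod]
  exact hx

theorem exists_iota : ∃ z : ℤ_[5], z ^ 2 = -1 ∧ PadicInt.toZMod z = 2 := by
  have key : ‖(Polynomial.X ^ 2 + 1 : Polynomial ℤ_[5]).aeval (2 : ℤ_[5])‖ <
      ‖(Polynomial.X ^ 2 + 1 : Polynomial ℤ_[5]).derivative.aeval (2 : ℤ_[5])‖ ^ 2 := by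
    have h1 : (Polynomial.X ^ 2 + 1 : Polynomial ℤ_[5]).aeval (2 : ℤ_[5]) = 5 := by
      simp; norm_num
    have h2 : (Polynomial.X ^ 2 + 1 : Polynomial ℤ_[5]).derivative.aeval (2 : ℤ_[5]) = 4 := by
      simp; norm_num
    have h3 : ‖(5 : ℤ_[5])‖ < 1 := by
      have := PadicInt.norm_p (p := 5)
      push_cast at this
      rw [this]; norm_num
    have h4 : ‖(4 : ℤ_[5])‖ = 1 := by
      exact PadicInt.isUnit_iff.1 (unit_of_toZMod_padic _ (by rw [map_ofNat]; decide))
    rw [h1, h2, h4]; simpa using h3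
  have h4 : ‖(Polynomial.X ^ 2 + 1 : Polynomial ℤ_[5]).derivative.aeval (2 : ℤ_[5])‖ ≤ 1 :=
    PadicInt.norm_le_one _
  obtain ⟨z, hz, hz2, -⟩ := hensels_lemma key
  refine ⟨z, ?_, ?_⟩
  · simp at hz; linear_combination hz
  · have : z - 2 ∈ maximalIdeal ℤ_[5] := by
      rw [mem_maximalIdeal, PadicInt.mem_nonunits]; linarith
    rw [← PadicInt.ker_toZMod, RingHom.mem_ker, map_sub, sub_eq_zero] at this
    rw [this, map_ofNat]

noncomputable def iota0 : ℤ_[5] := exists_iota.choose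
theorem iota0_sq : iota0 ^ 2 = -1 := exists_iota.choose_spec.1
theorem iota0_red : PadicInt.toZMod iota0 = 2 := exists_iota.choose_spec.2

noncomputable def ofO : ℤ_[5] →+* Z5sqrt5 :=
  AdjoinRoot.of (Polynomial.X ^ 2 - 5 : Polynomial ℤ_[5])

noncomputable def iot : Z5sqrt5 := ofO iota0
noncomputable def rt : Z5sqrt5 := AdjoinRoot.root (Polynomial.X ^ 2 - 5 : Polynomial ℤ_[5])

theorem iot_sq : iot ^ 2 = -1 := by
  rw [iot, ← map_pow, iota0_sq]; simp

theorem toZMod_ofO (x : ℤ_[5]) : Z5sqrt5.toZMod (ofO x) = PadicInt.toZMod x := by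
  simp [Z5sqrt5.toZMod, ofO]

theorem toZMod_rt : Z5sqrt5.toZMod rt = 0 := by
  simp [Z5sqrt5.toZMod, rt]

theorem rt_sq : rt * rt = 5 := by
  have := AdjoinRoot.eval₂_root (Polynomial.X ^ 2 - 5 : Polynomial ℤ_[5])
  rw [Polynomial.eval₂_sub, Polynomial.eval₂_pow, Polynomial.eval₂_X, Polynomial.eval₂_ofNat] at this
  rw [rt]; linear_combination this

theorem exists_quarter : ∃ z : ℤ_[5], 4 * z = 1 := by
  have : IsUnit (4 : ℤ_[5]) := unit_of_toZMod_padic _ (by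
    rw [map_ofNat]; decide)
  obtain ⟨z, hz⟩ := this.exists_right_inv
  exact ⟨z, hz⟩

noncomputable def quarter : Z5sqrt5 := ofO exists_quarter.choose
theorem quarter_spec : 4 * quarter = 1 := by
  have := congrArg ofO exists_quarter.choose_spec
  rwa [map_mul, map_ofNat, map_one] at this

theorem exists_coords (x : Z5sqrt5) : ∃ a b : ℤ_[5], x = ofO a + ofO b * rt := by
  induction x using AdjoinRoot.induction_on with
  | ih p =>
    induction p using Polynomial.induction_on' with
    | add p q hp hq =>
      obtain ⟨a, b, h⟩ := hp
      obtain ⟨a', b', h'⟩ := hq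
      exact ⟨a + a', b + b', by rw [map_add, h, h']; simp only [map_add]; ring⟩
    | monomial n c =>
      induction n with
      | zero => exact ⟨c, 0, by simp [ofO]⟩
      | succ n ih =>
        obtain ⟨a, b, h⟩ := ih
        refine ⟨5 * b, a, ?_⟩
        rw [← Polynomial.monomial_mul_X, map_mul, h, AdjoinRoot.mk_X]
        change _ * rt = _
        rw [map_mul, map_ofNat]
        linear_combination ofO b * rt_sq

theorem unit_of_toZMod (x : Z5sqrt5) (h : Z5sqrt5.toZMod x ≠ 0) : IsUnit x := by
  obtain ⟨a, b, rfl⟩ := exists_coords x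
  rw [map_add, map_mul, toZMod_ofO, toZMod_ofO, toZMod_rt, mul_zero, add_zero] at h
  have : IsUnit (a ^ 2 - 5 * b ^ 2) := unit_of_toZMod_padic _ (by
    rw [map_sub, map_mul, map_ofNat]
    have : (OfNat.ofNat 5 : ZMod 5) = 0 := by decide
    rw [this, zero_mul, sub_zero, map_pow]
    exact pow_ne_zero _ h)
  have h2 := this.map ofO
  refine isUnit_of_mul_isUnit_left (y := ofO a - ofO b * rt) ?_
  convert h2 using 1
  simp only [map_sub, map_mul, map_pow, map_ofNat]
  linear_combination (- ofO b ^ 2) * rt_sq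

/-- `ℤ[√5] → O` -/
noncomputable def zO : ℤ√5 →+* Z5sqrt5 := Zsqrtd.lift ⟨rt, by rw [rt_sq]; norm_num⟩

theorem zO_apply (x : ℤ√5) : zO x = (x.re : Z5sqrt5) + x.im * rt := by
  simp [zO]

noncomputable def Phi (x : Qt) : Matrix (Fin 2) (Fin 2) Z5sqrt5 :=
  !![zO x.1 + iot * zO x.2.1, zO x.2.2.1 + iot * zO x.2.2.2;
     - zO x.2.2.1 + iot * zO x.2.2.2, zO x.1 - iot * zO x.2.1]

theorem Phi_mul (x y : Qt) : Phi (qmul x y) = Phi x * Phi y := by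
  have h := iot_sq
  ext i j
  fin_cases i <;> fin_cases j <;>
    simp [Phi, qmul, Matrix.mul_apply, Fin.sum_univ_two] 
  · linear_combination (-zO x.2.1 * zO y.2.1 - zO x.2.2.2 * zO y.2.2.2) * h
  · linear_combination (-zO x.2.1 * zO y.2.2.2 + zO x.2.2.2 * zO y.2.1) * h
  · linear_combination (zO x.2.1 * zO y.2.2.2 - zO x.2.2.2 * zO y.2.1) * h
  · linear_combination (-zO x.2.1 * zO y.2.1 - zO x.2.2.2 * zO y.2.2.2) * h

theorem Phi_sc (n : ℤ√5) (x : Qt) : Phi (qsc n x) = zO n • Phi x := by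
  ext i j
  fin_cases i <;> fin_cases j <;> simp [Phi, qsc] <;> ring

noncomputable def F0 (M : SL25) : Matrix (Fin 2) (Fin 2) Z5sqrt5 :=
  (quarter ^ 2) • Phi (qq (M.1 0 0) (M.1 0 1) (M.1 1 0) (M.1 1 1))

theorem sl_det (M : SL25) : M.1 0 0 * M.1 1 1 - M.1 0 1 * M.1 1 0 = 1 := by
  have := M.2; rwa [Matrix.det_fin_two] at this

theorem zO_16 : quarter ^ 2 * zO ⟨16, 0⟩ = 1 := by
  rw [zO_apply]
  push_cast
  linear_combination (4 * quarter + 1) * quarter_spec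

theorem F0_aux (A B C : Qt) (h : qsc ⟨16, 0⟩ A = qmul B C) :
    quarter ^ 2 • Phi A = (quarter ^ 2 • Phi B) * (quarter ^ 2 • Phi C) := by
  rw [smul_mul_smul_comm, ← Phi_mul, ← h, Phi_sc, smul_smul, mul_assoc, zO_16, mul_one]

theorem F0_u (M : SL25) : F0 (gu * M) = F0 gu * F0 M := by
  have := F0_aux _ _ _ (qq_u _ _ _ _ (sl_det M))
  have e0 : (gu * M).1 0 0 = M.1 0 0 + M.1 1 0 := by
    rw [Matrix.SpecialLinearGroup.coe_mul, Matrix.mul_apply, Fin.sum_univ_two]; simp [gu]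
  have e1 : (gu * M).1 0 1 = M.1 0 1 + M.1 1 1 := by
    rw [Matrix.SpecialLinearGroup.coe_mul, Matrix.mul_apply, Fin.sum_univ_two]; simp [gu]
  have e2 : (gu * M).1 1 0 = M.1 1 0 := by
    rw [Matrix.SpecialLinearGroup.coe_mul, Matrix.mul_apply, Fin.sum_univ_two]; simp [gu]
  have e3 : (gu * M).1 1 1 = M.1 1 1 := by
    rw [Matrix.SpecialLinearGroup.coe_mul, Matrix.mul_apply, Fin.sum_univ_two]; simp [gu]
  rw [F0, e0, e1, e2, e3]
  exact this

theorem F0_w (M : SL25) : F0 (gw * M) = F0 gw * F0 M := by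
  have := F0_aux _ _ _ (qq_w _ _ _ _ (sl_det M))
  have e0 : (gw * M).1 0 0 = M.1 1 0 := by
    rw [Matrix.SpecialLinearGroup.coe_mul, Matrix.mul_apply, Fin.sum_univ_two]; simp [gw]
  have e1 : (gw * M).1 0 1 = M.1 1 1 := by
    rw [Matrix.SpecialLinearGroup.coe_mul, Matrix.mul_apply, Fin.sum_univ_two]; simp [gw]
  have e2 : (gw * M).1 1 0 = -M.1 0 0 := by
    rw [Matrix.SpecialLinearGroup.coe_mul, Matrix.mul_apply, Fin.sum_univ_two]; simp [gw]
  have e3 : (gw * M).1 1 1 = -M.1 0 1 := by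
    rw [Matrix.SpecialLinearGroup.coe_mul, Matrix.mul_apply, Fin.sum_univ_two]; simp [gw]
  rw [F0, e0, e1, e2, e3]
  exact this

theorem F0_h (M : SL25) : F0 (gh * M) = F0 gh * F0 M := by
  have := F0_aux _ _ _ (qq_h _ _ _ _ (sl_det M))
  have e0 : (gh * M).1 0 0 = 2 * M.1 0 0 := by
    rw [Matrix.SpecialLinearGroup.coe_mul, Matrix.mul_apply, Fin.sum_univ_two]; simp [gh]
  have e1 : (gh * M).1 0 1 = 2 * M.1 0 1 := by
    rw [Matrix.SpecialLinearGroup.coe_mul, Matrix.mul_apply, Fin.sum_univ_two]; simp [gh]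
  have e2 : (gh * M).1 1 0 = 3 * M.1 1 0 := by
    rw [Matrix.SpecialLinearGroup.coe_mul, Matrix.mul_apply, Fin.sum_univ_two]; simp [gh]
  have e3 : (gh * M).1 1 1 = 3 * M.1 1 1 := by
    rw [Matrix.SpecialLinearGroup.coe_mul, Matrix.mul_apply, Fin.sum_univ_two]; simp [gh]
  rw [F0, e0, e1, e2, e3]
  exact this

theorem qq_one : qq 1 0 0 1 = (⟨16, 0⟩, 0, 0, 0) := by decide +kernel
theorem qq_gu : qq 1 1 0 1 = (⟨-4, 4⟩, 0, ⟨8, 0⟩, ⟨4, 4⟩) := by decide +kernel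
theorem qq_gw : qq 0 1 (-1) 0 = (0, 0, ⟨16, 0⟩, 0) := by decide +kernel
theorem qq_gh : qq 2 0 0 3 = (0, ⟨16, 0⟩, 0, 0) := by decide +kernel

theorem F0_one : F0 1 = 1 := by
  have h := zO_16
  ext i j
  fin_cases i <;> fin_cases j <;> simp [F0, qq_one, Phi, h]

theorem F0_gw : F0 gw = !![0, 1; -1, 0] := by
  have h := zO_16
  ext i j
  fin_cases i <;> fin_cases j <;> simp [F0, gw, qq_gw, Phi, h]

theorem F0_gh : F0 gh = !![iot, 0; 0, -iot] := by
  have h := zO_16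
  ext i j
  fin_cases i <;> fin_cases j <;> simp [F0, gh, qq_gh, Phi, h]
  · linear_combination iot * h
  · linear_combination iot * h

theorem F0_gu : F0 gu = !![quarter * (rt - 1), quarter * (2 + iot * (1 + rt));
    quarter * (-2 + iot * (1 + rt)), quarter * (rt - 1)] := by
  have h := quarter_spec
  ext i j
  fin_cases i <;> fin_cases j <;> simp [F0, gu, qq_gu, Phi, zO_apply]
  · linear_combination (quarter * (rt - 1)) * h
  · linear_combination quarter * (2 + iot * (1 + rt)) * h
  · linear_combination quarter * (-2 + iot * (1 + rt)) * h
  · linear_combination (quarter * (rt - 1)) * h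

theorem F0_mul (g M : SL25) : F0 (g * M) = F0 g * F0 M := by
  revert M
  refine gen_ind (fun g => ∀ M, F0 (g * M) = F0 g * F0 M) ?_ ?_ ?_ ?_ g
  · intro M; rw [F0_one]; simp
  · intro g hg M; rw [mul_assoc, F0_u, hg, F0_u, Matrix.mul_assoc]
  · intro g hg M; rw [mul_assoc, F0_w, hg, F0_w, Matrix.mul_assoc]
  · intro g hg M; rw [mul_assoc, F0_h, hg, F0_h, Matrix.mul_assoc]

noncomputable def rho0 : SL25 →* GL (Fin 2) Z5sqrt5 :=
  MonoidHom.toHomUnits { toFun := F0, map_one' := F0_one, map_mul' := F0_mul }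

theorem rho0_coe (M : SL25) : (rho0 M : Matrix (Fin 2) (Fin 2) Z5sqrt5) = F0 M := rfl

theorem quarter_red : Z5sqrt5.toZMod quarter = 4 := by
  have := congrArg Z5sqrt5.toZMod quarter_spec
  rw [map_mul, map_one, map_ofNat] at this
  generalize Z5sqrt5.toZMod quarter = x at this
  revert x; decide

theorem rho0_red (M : SL25) (a b : Fin 2) :
    Z5sqrt5.toZMod ((rho0 M : Matrix (Fin 2) (Fin 2) Z5sqrt5) a b) = M.1 a b := by
  rw [rho0_coe]
  obtain ⟨h1, h2, h3, h4⟩ := qq_red _ _ _ _ (sl_det M)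
  have hq : Z5sqrt5.toZMod (quarter ^ 2) = 1 := by
    rw [map_pow, quarter_red]; decide
  have hi : Z5sqrt5.toZMod iot = 2 := by rw [iot, toZMod_ofO, iota0_red]
  have hz : ∀ x, Z5sqrt5.toZMod (zO x) = (x.re : ZMod 5) := by
    intro x; rw [zO_apply]; simp [toZMod_rt]
  fin_cases a <;> fin_cases b <;>
    simp only [F0, Phi, Matrix.smul_apply, smul_eq_mul, map_mul, hq, one_mul] <;>
    simp [hi, hz, h1, h2, h3, h4]

/-! ### Lemmas on the target ring -/

theorem conj_aux {R : Type*} [Ring R] (A B D E : R) (hA : A * A = -1) (hB : B * B = -1)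
    (hBA : B * A = -(A * B)) (hD : D * D = -1) (hE : E * E = -1) (hED : E * D = -(D * E)) :
    A * (1 - A * D - B * E - A * B * D * E) = (1 - A * D - B * E - A * B * D * E) * D ∧
    B * (1 - A * D - B * E - A * B * D * E) = (1 - A * D - B * E - A * B * D * E) * E := by
  constructor
  · linear_combination (norm := noncomm_ring) -(hA * D) - hA * B * D * E + A * hD + B * hED
      + A * B * D * hED - A * B * hD * E
  · linear_combination (norm := noncomm_ring) -(hBA * D) - hB * E - hBA * B * D * E
      + A * hB * D * E + B * hE + A * B * D * hE

theorem core_aux {S : Type} [CommRing S] (πS : S →+* ZMod 5)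
    (hunit : ∀ x, πS x ≠ 0 → IsUnit x) (i p q r s : S)
    (hi : i ^ 2 = -1) (hi2 : πS i = 2) (hp : πS p = 1) (hq : πS q = 1) (hr : πS r = 0)
    (h1 : (!![i, 0; 0, -i] * !![p, q; r, s]) * (!![i, 0; 0, -i] * !![p, q; r, s]) = -1)
    (h2 : (!![0, 1; -1, 0] * !![p, q; r, s]) * (!![0, 1; -1, 0] * !![p, q; r, s])
      * (!![0, 1; -1, 0] * !![p, q; r, s]) = 1)
    (h3 : !![p, q; r, s] * !![p, q; r, s] * !![p, q; r, s] * !![p, q; r, s] * !![p, q; r, s] = 1) :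
    s = p ∧ q = r + 1 ∧ (4 * p + 1) * (4 * p + 1) = 5 ∧ 2 * (2 * r + 1) = i * (4 * p + 2) := by
  have cancel : ∀ x y : S, πS x ≠ 0 → x * y = 0 → y = 0 := by
    intro x y hx h
    exact (hunit x hx).mul_right_eq_zero.1 h
  have hsp : s = p := by
    have := congrFun (congrFun h1 0) 1
    simp [Matrix.one_fin_two] at this
    have h := cancel q (s - p) (by rw [hq]; decide)
      (by linear_combination this - (p * q - q * s) * hi)
    linear_combination h
  subst hsp
  rename' s => p
  have hdet : p ^ 2 - q * r = 1 := by
    have := congrFun (congrFun h1 0) 0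
    simp [Matrix.one_fin_two] at this
    linear_combination -this + (p * p - q * r) * hi
  have ht : (r - q) ^ 2 - 1 = 0 := by
    have := congrFun (congrFun h2 0) 1
    simp [Matrix.one_fin_two] at this
    exact cancel p _ (by rw [hp]; decide) (by linear_combination this + p * hdet)
  have hqr : q = r + 1 := by
    have := congrFun (congrFun h2 0) 0
    simp [Matrix.one_fin_two] at this
    linear_combination this - (q - 2 * r) * hdet - r * ht
  have h5 : q * (16 * p ^ 4 - 12 * p ^ 2 + 1) = 0 := by
    have := congrFun (congrFun h3 0) 1
    simp [Matrix.one_fin_two] at this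
    linear_combination this + q * (11 * p ^ 2 - 1 + q * r) * hdet
  have h6 := cancel q _ (by rw [hq]; decide) h5
  have h7 := cancel (4 * p ^ 2 - 2 * p - 1) (4 * p ^ 2 + 2 * p - 1)
    (by simp only [map_sub, map_mul, map_pow, hp, map_ofNat, map_one]; decide)
    (by linear_combination h6)
  refine ⟨rfl, hqr, by linear_combination 4 * h7, ?_⟩
  have h8 := cancel (2 * (2 * r + 1) + i * (4 * p + 2)) (2 * (2 * r + 1) - i * (4 * p + 2))
    (by simp only [map_add, map_mul, hp, hr, hi2, map_ofNat, map_one]; decide)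
    (by subst hqr; linear_combination -16 * hdet - (4 * p + 2) ^ 2 * hi + 8 * h7)
  linear_combination h8

section target
variable {S : Type} [CommRing S] [IsLocalRing S] [IsArtinianRing S] (πS : S →+* ZMod 5)

theorem unit_S (hker : RingHom.ker πS = maximalIdeal S) (x : S) (hx : πS x ≠ 0) : IsUnit x := by
  by_contra h
  apply hx
  rw [← RingHom.mem_ker, hker]
  exact h

theorem five_nilp (hker : RingHom.ker πS = maximalIdeal S) : ∃ n : ℕ, (5 : S) ^ n = 0 := by
  have h5 : (5 : S) ∈ maximalIdeal S := by
    rw [← hker, RingHom.mem_ker, map_ofNat]; decide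
  obtain ⟨n, hn⟩ := IsArtinianRing.isNilpotent_jacobson_bot (R := S)
  rw [jacobson_eq_maximalIdeal _ bot_ne_top] at hn
  refine ⟨n, ?_⟩
  have := Ideal.pow_mem_pow h5 n
  rw [hn] at this
  simpa using this

theorem exists_padicHom (hker : RingHom.ker πS = maximalIdeal S) :
    Nonempty (ℤ_[5] →+* S) := by
  obtain ⟨n, hn⟩ := five_nilp πS hker
  have hd : ringChar S ∣ 5 ^ n := by
    apply ringChar.dvd; push_cast; exact hn
  exact ⟨(ZMod.castHom hd S).comp (PadicInt.toZModPow n)⟩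

theorem padicHom_ext (hker : RingHom.ker πS = maximalIdeal S) (f g : ℤ_[5] →+* S) : f = g := by
  obtain ⟨n, hn⟩ := five_nilp πS hker
  ext x
  have := PadicInt.appr_spec n x
  rw [Ideal.mem_span_singleton'] at this
  obtain ⟨y, hy⟩ := this
  have hx : x = y * 5 ^ n + (x.appr n : ℤ_[5]) := by
    push_cast at hy
    linear_combination -hy
  have h5 : ∀ F : ℤ_[5] →+* S, F x = (x.appr n : S) := by
    intro F
    conv_lhs => rw [hx]
    rw [map_add, map_mul, map_pow, map_ofNat, map_natCast]
    change F y * 5 ^ n + _ = _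
    rw [hn, mul_zero, zero_add]
  rw [h5, h5]

theorem mat_unit (hker : RingHom.ker πS = maximalIdeal S) (N : Matrix (Fin 2) (Fin 2) S)
    (h : (πS.mapMatrix N).det ≠ 0) : IsUnit N := by
  rw [Matrix.isUnit_iff_isUnit_det]
  apply unit_S πS hker
  rw [RingHom.map_det]; exact h

theorem sq_aux (hker : RingHom.ker πS = maximalIdeal S) (N : Matrix (Fin 2) (Fin 2) S)
    (h4 : N * N * (N * N) = 1) (h : (πS.mapMatrix N * πS.mapMatrix N - 1).det ≠ 0) :
    N * N = -1 := by
  have hu : IsUnit (N * N - 1) := by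
    apply mat_unit πS hker
    rwa [map_sub, map_mul, map_one]
  have : (N * N - 1) * (N * N + 1) = 0 := by
    rw [sub_mul, mul_add, h4]; noncomm_ring
  have := hu.mul_right_eq_zero.1 this
  exact eq_neg_of_add_eq_zero_left this

end target

/-! ### Main proof -/

section main
variable {S : Type} [CommRing S] [IsLocalRing S] [IsArtinianRing S] (πS : S →+* ZMod 5)

theorem padic_red (f : ℤ_[5] →+* S) (x : ℤ_[5]) :
    πS (f x) = PadicInt.toZMod x := by
  have h := padicHom_ext (S := ZMod 5) (RingHom.id _)
    (by rw [IsLocalRing.maximalIdeal_eq_bot]; ext; simp)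
    (πS.comp f) PadicInt.toZMod
  exact congrArg (fun g : ℤ_[5] →+* ZMod 5 => g x) h

/-- Simultaneous conjugation of the quaternion subgroup to standard form. -/
theorem conj_Q8 (hker : RingHom.ker πS = maximalIdeal S) (ρ : SL25 →* GL (Fin 2) S)
    (hρ : ∀ M : SL25, πS.mapMatrix (ρ M).1 = M.1) (i : S) (hi : i ^ 2 = -1) (hi2 : πS i = 2) :
    ∃ X : GL (Fin 2) S, πS.mapMatrix X.1 = 1 ∧
      (ρ gh).1 * X.1 = X.1 * !![i, 0; 0, -i] ∧ (ρ gw).1 * X.1 = X.1 * !![0, 1; -1, 0] := by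
  have hmul : ∀ M N : SL25, (ρ (M * N)).1 = (ρ M).1 * (ρ N).1 := fun M N => by
    rw [map_mul]; rfl
  have hone : (ρ 1).1 = 1 := by rw [map_one]; rfl
  have hA : (ρ gh).1 * (ρ gh).1 = -1 := by
    apply sq_aux πS hker
    · rw [← hmul, ← hmul, show gh * gh * (gh * gh) = 1 by decide, hone]
    · rw [hρ]; decide
  have hB : (ρ gw).1 * (ρ gw).1 = -1 := by
    rw [← hmul, show gw * gw = gh * gh by decide, hmul, hA]
  have hBA : (ρ gw).1 * (ρ gh).1 = -((ρ gh).1 * (ρ gw).1) := by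
    rw [← hmul, show gw * gh = gh * gh * (gh * gw) by decide, hmul, hmul, hmul, hA, neg_one_mul]
  have hD : (!![i, 0; 0, -i] : Matrix (Fin 2) (Fin 2) S) * !![i, 0; 0, -i] = -1 := by
    ext a b
    fin_cases a <;> fin_cases b <;> simp <;> linear_combination hi
  have hE : (!![0, 1; -1, 0] : Matrix (Fin 2) (Fin 2) S) * !![0, 1; -1, 0] = -1 := by
    ext a b
    fin_cases a <;> fin_cases b <;> simp
  have hED : (!![0, 1; -1, 0] : Matrix (Fin 2) (Fin 2) S) * !![i, 0; 0, -i] =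
      -(!![i, 0; 0, -i] * !![0, 1; -1, 0]) := by
    ext a b
    fin_cases a <;> fin_cases b <;> simp
  obtain ⟨k, hk⟩ := (unit_S πS hker 4 (by rw [map_ofNat]; decide)).exists_right_inv
  have hk2 : πS k = 4 := by
    have := congrArg πS hk
    rw [map_mul, map_one, map_ofNat] at this
    generalize πS k = x at this
    revert x; decide
  obtain ⟨h1, h2⟩ := conj_aux _ _ _ _ hA hB hBA hD hE hED
  set Y := (1 - (ρ gh).1 * !![i, 0; 0, -i] - (ρ gw).1 * !![0, 1; -1, 0] -
    (ρ gh).1 * (ρ gw).1 * !![i, 0; 0, -i] * !![0, 1; -1, 0]) with hY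
  have hmapD : πS.mapMatrix !![i, 0; 0, -i] = gh.1 := by
    ext a b
    fin_cases a <;> fin_cases b <;> simp [hi2, gh]
    decide
  have hmapE : πS.mapMatrix !![0, 1; -1, 0] = gw.1 := by
    ext a b
    fin_cases a <;> fin_cases b <;> simp [gw]
  have hYred : πS.mapMatrix (k • Y) = 1 := by
    have e : πS.mapMatrix (k • Y) = (4 : ZMod 5) • πS.mapMatrix Y := by
      ext a b; simp [hk2]
    rw [e, hY]
    simp only [map_sub, map_mul, map_one, hρ, hmapD, hmapE]
    decide
  have hu : IsUnit (k • Y) := by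
    apply mat_unit πS hker
    rw [hYred]; simp
  obtain ⟨X, hX⟩ := hu
  refine ⟨X, ?_, ?_, ?_⟩
  · rw [hX, hYred]
  · rw [hX, Matrix.mul_smul, Matrix.smul_mul, h1]
  · rw [hX, Matrix.mul_smul, Matrix.smul_mul, h2]

theorem exists_f (hker : RingHom.ker πS = maximalIdeal S) (ρ : SL25 →* GL (Fin 2) S)
    (hρ : ∀ M : SL25, πS.mapMatrix (ρ M).1 = M.1) :
    ∃ f : Z5sqrt5 →+* S, (∀ x, πS (f x) = Z5sqrt5.toZMod x) ∧
      ∃ X : GL (Fin 2) S, πS.mapMatrix X.1 = 1 ∧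
        ∀ M, (ρ M).1 = X.1 * (F0 M).map f * (X⁻¹).1 := by
  obtain ⟨f0⟩ := exists_padicHom πS hker
  have hi : f0 iota0 ^ 2 = -1 := by rw [← map_pow, iota0_sq, map_neg, map_one]
  have hi2 : πS (f0 iota0) = 2 := by rw [padic_red πS, iota0_red]
  obtain ⟨X, hX1, hXh, hXw⟩ := conj_Q8 πS hker ρ hρ _ hi hi2
  set i := f0 iota0 with hidef
  let ρ' : SL25 →* GL (Fin 2) S := (MulAut.conj X⁻¹).toMonoidHom.comp ρ
  have hρ'g : ∀ M, ρ' M = X⁻¹ * ρ M * X := fun M => by simp [ρ']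
  have hρ'c : ∀ M, (ρ' M).1 = (X⁻¹).1 * (ρ M).1 * X.1 := fun M => by rw [hρ'g]; rfl
  have hXX : (X⁻¹).1 * X.1 = 1 := by
    rw [← Units.val_mul, inv_mul_cancel, Units.val_one]
  have hXi : πS.mapMatrix (X⁻¹).1 = 1 := by
    have := congrArg πS.mapMatrix hXX
    rwa [map_mul, hX1, mul_one, map_one] at this
  have hred : ∀ M : SL25, πS.mapMatrix (ρ' M).1 = M.1 := fun M => by
    rw [hρ'c, map_mul, map_mul, hXi, hX1, hρ, one_mul, mul_one]
  have hh : (ρ' gh).1 = !![i, 0; 0, -i] := by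
    rw [hρ'c, Matrix.mul_assoc, hXh, ← Matrix.mul_assoc, hXX, one_mul]
  have hw : (ρ' gw).1 = !![0, 1; -1, 0] := by
    rw [hρ'c, Matrix.mul_assoc, hXw, ← Matrix.mul_assoc, hXX, one_mul]
  have hmul : ∀ M N : SL25, (ρ' (M * N)).1 = (ρ' M).1 * (ρ' N).1 := fun M N => by
    rw [map_mul]; rfl
  have hone : (ρ' 1).1 = 1 := by rw [map_one]; rfl
  obtain ⟨p, q, r, s, hV⟩ : ∃ p q r s, (ρ' gu).1 = !![p, q; r, s] :=
    ⟨_, _, _, _, Matrix.eta_fin_two _⟩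
  have hredu := hred gu
  rw [hV] at hredu
  have hp : πS p = 1 := by simpa [gu] using congrFun (congrFun hredu 0) 0
  have hq : πS q = 1 := by simpa [gu] using congrFun (congrFun hredu 0) 1
  have hr : πS r = 0 := by simpa [gu] using congrFun (congrFun hredu 1) 0
  obtain ⟨hs, hqr, hd, hir⟩ := core_aux πS (unit_S πS hker) i p q r s hi hi2 hp hq hr
    (by
      rw [← hh, ← hV, ← hmul, ← hmul, show gh * gu * (gh * gu) = gh * gh by decide, hmul, hh]
      ext a b
      fin_cases a <;> fin_cases b <;> simp <;> linear_combination hi)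
    (by
      rw [← hw, ← hV, ← hmul, ← hmul, ← hmul,
        show gw * gu * (gw * gu) * (gw * gu) = 1 by decide, hone])
    (by
      rw [← hV, ← hmul, ← hmul, ← hmul, ← hmul,
        show gu * gu * gu * gu * gu = 1 by decide, hone])
  let f : Z5sqrt5 →+* S := AdjoinRoot.lift f0 (4 * p + 1) (by
    rw [Polynomial.eval₂_sub, Polynomial.eval₂_pow, Polynomial.eval₂_X, Polynomial.eval₂_ofNat]
    linear_combination hd)
  have hfof : ∀ x, f (ofO x) = f0 x := fun x => by simp [f, ofO]
  have hfrt : f rt = 4 * p + 1 := by simp [f, rt]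
  have hfi : f iot = i := hfof _
  have hfq : 4 * f quarter = 1 := by
    have := congrArg f quarter_spec
    rwa [map_mul, map_one, map_ofNat] at this
  refine ⟨f, ?_, X, hX1, ?_⟩
  · intro x
    obtain ⟨a, b, rfl⟩ := exists_coords x
    have : πS (4 * p + 1) = 0 := by
      rw [map_add, map_mul, map_ofNat, hp, map_one]; decide
    rw [map_add f, map_mul f, hfof, hfof, hfrt, map_add πS, map_mul πS, this,
      map_add Z5sqrt5.toZMod, map_mul Z5sqrt5.toZMod, toZMod_rt, toZMod_ofO, padic_red πS]
    simp
  · have hmapmul : ∀ g M, (F0 (g * M)).map f = (F0 g).map f * (F0 M).map f := fun g M => by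
      rw [F0_mul, Matrix.map_mul]
    have hf2 : f 2 = 2 := map_ofNat f 2
    have hgu : (ρ' gu).1 = (F0 gu).map f := by
      rw [hV, F0_gu]
      subst hs hqr
      ext a b
      fin_cases a <;> fin_cases b <;> simp [hfrt, hfi, hf2]
      · linear_combination -s * hfq
      · linear_combination -(r + 1) * hfq + f quarter * hir
      · linear_combination -r * hfq + f quarter * hir
      · linear_combination -s * hfq
    have hgw : (ρ' gw).1 = (F0 gw).map f := by
      rw [hw, F0_gw]
      ext a b
      fin_cases a <;> fin_cases b <;> simp
    have hgh : (ρ' gh).1 = (F0 gh).map f := by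
      rw [hh, F0_gh]
      ext a b
      fin_cases a <;> fin_cases b <;> simp [hfi]
    have key : ∀ M, (ρ' M).1 = (F0 M).map f := by
      intro M
      refine gen_ind (fun M => (ρ' M).1 = (F0 M).map f) ?_ ?_ ?_ ?_ M
      · rw [hone, F0_one]; simp
      · intro M h; rw [hmul, hmapmul, hgu, h]
      · intro M h; rw [hmul, hmapmul, hgw, h]
      · intro M h; rw [hmul, hmapmul, hgh, h]
    intro M
    rw [← key, ← Units.val_mul, ← Units.val_mul, hρ'g]
    congr 1
    group

/-- `f` is determined on `√5` by the trace of `ρ(u)`. -/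
theorem f_rt (ρ : SL25 →* GL (Fin 2) S) (f : Z5sqrt5 →+* S) (X : GL (Fin 2) S)
    (h : ∀ M, (ρ M).1 = X.1 * (F0 M).map f * (X⁻¹).1) :
    f rt = 2 * (ρ gu).1.trace + 1 := by
  have hXX : (X⁻¹).1 * X.1 = 1 := by
    rw [← Units.val_mul, inv_mul_cancel, Units.val_one]
  have hfq : 4 * f quarter = 1 := by
    have := congrArg f quarter_spec
    rwa [map_mul, map_one, map_ofNat] at this
  rw [h, Matrix.trace_mul_comm, ← Matrix.mul_assoc, hXX, one_mul, F0_gu, Matrix.trace_fin_two]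
  simp
  linear_combination (1 - f rt) * hfq

theorem f_unique (hker : RingHom.ker πS = maximalIdeal S) (f g : Z5sqrt5 →+* S)
    (h : f rt = g rt) : f = g := by
  refine RingHom.ext fun x => ?_
  obtain ⟨a, b, rfl⟩ := exists_coords x
  have := padicHom_ext πS hker (f.comp ofO) (g.comp ofO)
  have h2 : ∀ y, f (ofO y) = g (ofO y) := fun y =>
    congrArg (fun F : ℤ_[5] →+* S => F y) this
  rw [map_add, map_add, map_mul, map_mul, h2, h2, h]

end main

/-- `O = ℤ₅[√5]` is the universal deformation ring of the natural
representation of `SL_2(F₅)`: there is a lift `ρ₀` of the inclusion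
`SL_2(F₅) ⊆ GL_2(F₅)` to `O` such that every lift `ρ` to an Artinian local ring `S`
with residue field `F₅` is strictly equivalent to `f ∘ ρ₀` for a unique local ring
homomorphism `f : O → S` compatible with the reductions. -/
theorem Z5sqrt5_is_universal_deformation_ring_of_sl2_F5 :
    ∃ ρ₀ : SpecialLinearGroup (Fin 2) (ZMod 5) →* GL (Fin 2) Z5sqrt5,
      (∀ (M : SpecialLinearGroup (Fin 2) (ZMod 5)) (a b : Fin 2),
        Z5sqrt5.toZMod ((ρ₀ M : Matrix (Fin 2) (Fin 2) Z5sqrt5) a b) =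
          (M : Matrix (Fin 2) (Fin 2) (ZMod 5)) a b) ∧
      ∀ (S : Type) (_ : CommRing S) (_ : IsLocalRing S) (_ : IsArtinianRing S)
        (πS : S →+* ZMod 5), Function.Surjective πS → RingHom.ker πS = maximalIdeal S →
        ∀ ρ : SpecialLinearGroup (Fin 2) (ZMod 5) →* GL (Fin 2) S,
          (∀ (M : SpecialLinearGroup (Fin 2) (ZMod 5)) (a b : Fin 2),
            πS ((ρ M : Matrix (Fin 2) (Fin 2) S) a b) =
              (M : Matrix (Fin 2) (Fin 2) (ZMod 5)) a b) →
          ∃! f : Z5sqrt5 →+* S,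
            IsLocalHom f ∧
            (∀ x : Z5sqrt5, πS (f x) = Z5sqrt5.toZMod x) ∧
            ∃ X : GL (Fin 2) S,
              (∀ a b, (X : Matrix (Fin 2) (Fin 2) S) a b -
                (1 : Matrix (Fin 2) (Fin 2) S) a b ∈ maximalIdeal S) ∧
              ∀ M : SpecialLinearGroup (Fin 2) (ZMod 5),
                (ρ M : Matrix (Fin 2) (Fin 2) S) =
                  (X : Matrix (Fin 2) (Fin 2) S) *
                    (ρ₀ M : Matrix (Fin 2) (Fin 2) Z5sqrt5).map f *
                    ((X⁻¹ : GL (Fin 2) S) : Matrix (Fin 2) (Fin 2) S) := by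
  refine ⟨rho0, rho0_red, ?_⟩
  intro S _ _ _ πS _ hker ρ hρ
  have hρ2 : ∀ M : SL25, πS.mapMatrix (ρ M).1 = M.1 := by
    intro M; ext a b; exact hρ M a b
  obtain ⟨f, hf, X, hX, hfX⟩ := exists_f πS hker ρ hρ2
  refine ⟨f, ⟨⟨?_⟩, hf, X, ?_, hfX⟩, ?_⟩
  · intro x hx
    apply unit_of_toZMod
    rw [← hf]
    exact (hx.map πS).ne_zero
  · intro a b
    rw [← hker, RingHom.mem_ker, map_sub, sub_eq_zero]
    have h1 := congrFun (congrFun hX a) b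
    have h2 : πS.mapMatrix (1 : Matrix (Fin 2) (Fin 2) S) a b =
      (1 : Matrix (Fin 2) (Fin 2) (ZMod 5)) a b := by rw [map_one]
    exact h1.trans h2.symm
  · rintro g ⟨-, -, Y, -, hgY⟩
    apply f_unique πS hker
    rw [f_rt ρ g Y hgY, f_rt ρ f X hfX]
end
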